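/- arXiv:1706.04903 — 2 statements merged into one kernel-verified Lean document; each statement's English description precedes it below -/
import Mathlib

section
/- There exist a constant C > 0 and N such that for every n ≥ N, every proper edge colouring of the complete graph K_n on n vertices using at most χ'(K_n) colours (where χ'(K_n) = n - 1 if n is even and χ'(K_n) = n if n is odd) contains a Hamiltonian cycle whose edges use at most C·(log n)^3 distinct colours. -/
/-- An edge colouring `c` (given as a function on unordered pairs of vertices) is proper if
no two distinct edges sharing a vertex receive the same colour. -/
def IsProperEdgeColoring {V α : Type*} (c : Sym2 V → α) : Prop :=
  ∀ e₁ e₂ : Sym2 V, ¬ e₁.IsDiag → ¬ e₂.IsDiag → e₁ ≠ e₂ →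
    (∃ v, v ∈ e₁ ∧ v ∈ e₂) → c e₁ ≠ c e₂

section HamiltonianCycle

open Finset Matrix

section Spectral

variable {V : Type*} [Fintype V]

theorem sq_norm_mulVec_le_trace_mul {A : Matrix V V ℝ} (hA : A.IsSymm) (g : V → ℝ) :
    (A *ᵥ g) ⬝ᵥ (A *ᵥ g) ≤ (A * A).trace * (g ⬝ᵥ g) := by
  have h1 : (A * A).trace = ∑ x, ∑ y, A x y ^ 2 := by
    simp only [Matrix.trace, Matrix.diag, Matrix.mul_apply]
    refine Finset.sum_congr rfl fun x _ => Finset.sum_congr rfl fun y _ => ?_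
    rw [hA.apply x y, sq]
  rw [h1, Finset.sum_mul]
  simp only [dotProduct, Matrix.mulVec]
  refine Finset.sum_le_sum fun x _ => ?_
  have := Finset.sum_mul_sq_le_sq_mul_sq Finset.univ (fun y => A x y) g
  simpa [sq] using this

variable [DecidableEq V]

theorem sq_norm_mulVec_pow_le {A : Matrix V V ℝ} (hA : A.IsSymm) (g : V → ℝ) (hg : 0 < g ⬝ᵥ g)
    (j : ℕ) :
    (g ⬝ᵥ g) * ((A *ᵥ g) ⬝ᵥ (A *ᵥ g)) ^ 2 ^ j ≤
      (g ⬝ᵥ g) ^ 2 ^ j * ((A ^ 2 ^ j *ᵥ g) ⬝ᵥ (A ^ 2 ^ j *ᵥ g)) := by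
  induction j with
  | zero => simp
  | succ j ih =>
    set G := g ⬝ᵥ g
    set s := (A *ᵥ g) ⬝ᵥ (A *ᵥ g)
    set B := A ^ 2 ^ j with hB
    have hs : 0 ≤ s := by
      simp only [s, dotProduct]; exact Finset.sum_nonneg fun _ _ => mul_self_nonneg _
    have hBs : B.IsSymm := hA.pow _
    have hB2 : A ^ 2 ^ (j + 1) = B * B := by rw [hB, ← pow_add]; congr 1; ring
    have h1 : (B *ᵥ g) ⬝ᵥ (B *ᵥ g) = g ⬝ᵥ ((B * B) *ᵥ g) := by
      rw [← Matrix.mulVec_mulVec, Matrix.dotProduct_mulVec g B, ← Matrix.mulVec_transpose, hBs]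
    have h2 : ((B *ᵥ g) ⬝ᵥ (B *ᵥ g)) ^ 2 ≤
        G * (((B * B) *ᵥ g) ⬝ᵥ ((B * B) *ᵥ g)) := by
      rw [h1]
      have := Finset.sum_mul_sq_le_sq_mul_sq Finset.univ g ((B * B) *ᵥ g)
      simpa [sq, G, dotProduct] using this
    rw [hB2]
    have h3 : (G * s ^ 2 ^ j) ^ 2 ≤ (G ^ 2 ^ j * ((B *ᵥ g) ⬝ᵥ (B *ᵥ g))) ^ 2 := by
      gcongr
    have h4 : G * (G * s ^ 2 ^ (j + 1)) ≤
        G * (G ^ 2 ^ (j + 1) * (((B * B) *ᵥ g) ⬝ᵥ ((B * B) *ᵥ g))) := by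
      calc G * (G * s ^ 2 ^ (j + 1)) = (G * s ^ 2 ^ j) ^ 2 := by ring
        _ ≤ _ := h3
        _ = G ^ 2 ^ (j + 1) * ((B *ᵥ g) ⬝ᵥ (B *ᵥ g)) ^ 2 := by ring
        _ ≤ G ^ 2 ^ (j + 1) * (G * (((B * B) *ᵥ g) ⬝ᵥ ((B * B) *ᵥ g))) := by gcongr
        _ = _ := by ring
    exact le_of_mul_le_mul_left h4 hg

theorem sq_norm_mulVec_pow_le_trace {A : Matrix V V ℝ} (hA : A.IsSymm) (g : V → ℝ) (j : ℕ) :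
    ((A *ᵥ g) ⬝ᵥ (A *ᵥ g)) ^ 2 ^ j ≤ (A ^ (2 ^ j + 2 ^ j)).trace * (g ⬝ᵥ g) ^ 2 ^ j := by
  have hG : 0 ≤ g ⬝ᵥ g := by
    simp only [dotProduct]; exact Finset.sum_nonneg fun _ _ => mul_self_nonneg _
  rcases hG.eq_or_lt with h0 | hg
  · have : g = 0 := dotProduct_self_eq_zero.1 h0.symm
    simp [this]
  · have h1 := sq_norm_mulVec_pow_le hA g hg j
    have h2 := sq_norm_mulVec_le_trace_mul (hA.pow (2 ^ j)) g
    rw [← pow_add] at h2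
    refine le_of_mul_le_mul_left ?_ hg
    calc _ ≤ _ := h1
      _ ≤ (g ⬝ᵥ g) ^ 2 ^ j * ((A ^ (2 ^ j + 2 ^ j)).trace * (g ⬝ᵥ g)) := by gcongr
      _ = _ := by ring

end Spectral

section Words

/-- A word in which every letter occurs at least twice. -/
def NoSingleton {r K : ℕ} (w : Fin r → Fin K) : Prop :=
  ∀ p, ∃ q, q ≠ p ∧ w q = w p

theorem card_noSingleton_le (m K : ℕ) (hm : 0 < m)
    [DecidablePred (NoSingleton (r := m + m) (K := K))] :
    #{w : Fin (m + m) → Fin K | NoSingleton w} ≤ K ^ m * m ^ (m + m) := by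
  classical
  have hsub : ({w : Fin (m + m) → Fin K | NoSingleton w} : Finset _) ⊆
      (univ : Finset ((Fin m → Fin K) × (Fin (m + m) → Fin m))).image
        (fun fg => fg.1 ∘ fg.2) := by
    intro w hw
    simp only [mem_filter, mem_univ, true_and] at hw
    have h2 : 2 * #(univ.image w) ≤ #(univ : Finset (Fin (m + m))) := by
      refine Finset.mul_card_image_le_card _ _ fun a ha => ?_
      obtain ⟨p, -, rfl⟩ := mem_image.1 ha
      obtain ⟨q, hqp, hq⟩ := hw p
      exact Finset.one_lt_card.2 ⟨q, by simp [hq], p, by simp, hqp⟩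
    have h3 : #(univ.image w) ≤ m := by simp at h2; omega
    let e := (Finset.equivFin (univ.image w))
    let p0 : Fin (m + m) := ⟨0, by omega⟩
    let f : Fin m → Fin K := fun a =>
      if h : a.1 < #(univ.image w) then (e.symm ⟨a.1, h⟩).1 else w p0
    let g : Fin (m + m) → Fin m := fun p =>
      Fin.castLE h3 (e ⟨w p, mem_image_of_mem w (mem_univ p)⟩)
    refine mem_image.2 ⟨(f, g), mem_univ _, ?_⟩
    funext p
    simp [f, g]
  refine (card_le_card hsub).trans (card_image_le.trans ?_)
  simp

end Words

section Trace

variable {V Q : Type*} [Fintype V] [DecidableEq V] [Fintype Q]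

/-- The matrix all of whose entries are `1 / |V|`. -/
noncomputable def avgMatrix (V : Type*) [Fintype V] : Matrix V V ℝ :=
  Matrix.of fun _ _ => (Fintype.card V : ℝ)⁻¹

theorem doublyStochastic_mul_avgMatrix {P : Matrix V V ℝ} (hP : P ∈ doublyStochastic ℝ V) :
    P * avgMatrix V = avgMatrix V := by
  ext x y
  simp [Matrix.mul_apply, avgMatrix, ← Finset.sum_mul, sum_row_of_mem_doublyStochastic hP]

theorem avgMatrix_mul_doublyStochastic {P : Matrix V V ℝ} (hP : P ∈ doublyStochastic ℝ V) :
    avgMatrix V * P = avgMatrix V := by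
  ext x y
  simp [Matrix.mul_apply, avgMatrix, ← Finset.mul_sum, sum_col_of_mem_doublyStochastic hP]

theorem avgMatrix_mem_doublyStochastic [Nonempty V] : avgMatrix V ∈ doublyStochastic ℝ V := by
  rw [mem_doublyStochastic_iff_sum]
  simp [avgMatrix]

theorem exists_list_prod_eq_doublyStochastic_sub [Nonempty V] (l : List (Matrix V V ℝ))
    (hl : ∀ M ∈ l, ∃ P ∈ doublyStochastic ℝ V, M = P - avgMatrix V) (hne : l ≠ []) :
    ∃ P ∈ doublyStochastic ℝ V, l.prod = P - avgMatrix V := by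
  induction l with
  | nil => exact absurd rfl hne
  | cons M l ih =>
    obtain ⟨P, hP, rfl⟩ := hl M (by simp)
    rcases eq_or_ne l [] with rfl | hl'
    · exact ⟨P, hP, by simp⟩
    · obtain ⟨R, hR, hR'⟩ := ih (fun M hM => hl M (by simp [hM])) hl'
      refine ⟨P * R, mul_mem hP hR, ?_⟩
      rw [List.prod_cons, hR', sub_mul, mul_sub, mul_sub, doublyStochastic_mul_avgMatrix hP,
        avgMatrix_mul_doublyStochastic hR,
        doublyStochastic_mul_avgMatrix avgMatrix_mem_doublyStochastic]
      abel

theorem trace_doublyStochastic_sub_le [Nonempty V] {P : Matrix V V ℝ}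
    (hP : P ∈ doublyStochastic ℝ V) : (P - avgMatrix V).trace ≤ Fintype.card V := by
  rw [Matrix.trace_sub]
  have h1 : P.trace ≤ Fintype.card V := by
    calc P.trace = ∑ x, P x x := rfl
      _ ≤ ∑ _x : V, (1 : ℝ) := Finset.sum_le_sum fun x _ => le_one_of_mem_doublyStochastic hP
      _ = _ := by simp
  have h2 : 0 ≤ (avgMatrix V).trace := by
    simp [Matrix.trace, avgMatrix]
  linarith

theorem sum_trace_word_eq_zero {K r : ℕ} (M : Q → Matrix V V ℝ) (hM : ∑ q, M q = 0)
    (w : Fin r → Fin K) (hw : ¬ NoSingleton w) :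
    ∑ c : Fin K → Q, (List.ofFn fun p => M (c (w p))).prod.trace = 0 := by
  simp only [NoSingleton, not_forall, not_exists, not_and] at hw
  obtain ⟨p, hp⟩ := hw
  have key : ∀ c : Fin K → Q,
      ∑ q, (List.ofFn fun t => M (Function.update c (w p) q (w t))).prod.trace = 0 := by
    intro c
    have h1 : ∀ q, (fun t => M (Function.update c (w p) q (w t))) =
        Function.update (fun t => M (c (w t))) p (M q) := by
      intro q
      funext t
      by_cases ht : t = p
      · subst ht; simp
      · simp [Function.update_of_ne ht, Function.update_of_ne (hp t ht)]
    simp only [h1]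
    rw [← Matrix.trace_sum]
    have := (MultilinearMap.mkPiAlgebraFin ℝ r (Matrix V V ℝ)).map_update_sum univ p M
      (fun t => M (c (w t)))
    simp only [MultilinearMap.mkPiAlgebraFin_apply] at this
    rw [← this, hM]
    have h0 := (MultilinearMap.mkPiAlgebraFin ℝ r (Matrix V V ℝ)).map_update_zero
      (fun t => M (c (w t))) p
    simp only [MultilinearMap.mkPiAlgebraFin_apply] at h0
    rw [h0]; simp
  by_cases hQ : Nonempty Q
  · let e := Equiv.funSplitAt (w p) Q
    rw [← e.symm.sum_comp, Fintype.sum_prod_type_right]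
    refine Finset.sum_eq_zero fun d _ => ?_
    obtain ⟨q0⟩ := hQ
    rw [← key (e.symm (q0, d))]
    refine Finset.sum_congr rfl fun q _ => ?_
    have : e.symm (q, d) = Function.update (e.symm (q0, d)) (w p) q := by
      funext t
      by_cases ht : t = w p
      · subst ht; simp [e, Equiv.funSplitAt]
      · simp [e, Equiv.funSplitAt, ht]
    rw [this]
  · have : IsEmpty (Fin K → Q) := ⟨fun f => hQ ⟨f (w p)⟩⟩
    simp

theorem exists_trace_pow_le [Nonempty V] [Nonempty Q] {K m : ℕ} (hm : 0 < m)
    (M : Q → Matrix V V ℝ) (hM : ∑ q, M q = 0)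
    (hP : ∀ q, ∃ P ∈ doublyStochastic ℝ V, M q = P - avgMatrix V) :
    ∃ c : Fin K → Q, ((∑ i, M (c i)) ^ (m + m)).trace ≤
      Fintype.card V * (K ^ m * m ^ (m + m)) := by
  classical
  have hexp : ∀ c : Fin K → Q, ((∑ i, M (c i)) ^ (m + m)).trace =
      ∑ w : Fin (m + m) → Fin K, (List.ofFn fun p => M (c (w p))).prod.trace := by
    intro c
    rw [← Matrix.trace_sum]
    have h := (MultilinearMap.mkPiAlgebraFin ℝ (m + m) (Matrix V V ℝ)).map_sum
      (fun _ (i : Fin K) => M (c i))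
    rw [MultilinearMap.mkPiAlgebraFin_apply_const] at h
    rw [h]
    rfl
  have hw : ∀ w : Fin (m + m) → Fin K,
      ∑ c : Fin K → Q, (List.ofFn fun p => M (c (w p))).prod.trace ≤
      if NoSingleton w then ((Fintype.card (Fin K → Q) : ℝ) * Fintype.card V) else 0 := by
    intro w
    split_ifs with h
    · calc _ ≤ ∑ c : Fin K → Q, (Fintype.card V : ℝ) := by
            refine Finset.sum_le_sum fun c _ => ?_
            obtain ⟨P, hPm, hP'⟩ := exists_list_prod_eq_doublyStochastic_sub
              (List.ofFn fun p => M (c (w p))) (by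
                intro X hX
                obtain ⟨p, rfl⟩ := (List.mem_ofFn' _ _).1 hX
                exact hP _) (by simp; omega)
            rw [hP']
            exact trace_doublyStochastic_sub_le hPm
        _ = _ := by simp
    · exact (sum_trace_word_eq_zero M hM w h).le
  have htot : ∑ c : Fin K → Q, ((∑ i, M (c i)) ^ (m + m)).trace ≤
      ∑ _c : Fin K → Q, (Fintype.card V * (K ^ m * m ^ (m + m)) : ℝ) := by
    simp only [hexp]
    rw [Finset.sum_comm]
    refine (Finset.sum_le_sum fun w _ => hw w).trans ?_
    rw [← Finset.sum_filter, Finset.sum_const, Finset.sum_const, nsmul_eq_mul, nsmul_eq_mul]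
    have h := card_noSingleton_le m K hm
    have h' : ((#{w : Fin (m + m) → Fin K | NoSingleton w} : ℕ) : ℝ) ≤ K ^ m * m ^ (m + m) := by
      exact_mod_cast h
    rw [Finset.card_univ]
    calc _ ≤ ((K : ℝ) ^ m * m ^ (m + m)) * ((Fintype.card (Fin K → Q) : ℝ) * Fintype.card V) := by
          gcongr
      _ = _ := by ring
  obtain ⟨c, -, hc⟩ := Finset.exists_le_of_sum_le Finset.univ_nonempty htot
  exact ⟨c, hc⟩

end Trace

section Weight

variable {V Q : Type*} [Fintype V] [DecidableEq V] [Fintype Q] [DecidableEq Q]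

/-- A symmetric stochastic weight on pairs of vertices which is close, in mean square, to the
uniform weight on every vertex set. -/
structure IsPseudorandom (w : V → V → ℝ) (θ : ℝ) : Prop where
  nonneg : ∀ x y, 0 ≤ w x y
  symm : ∀ x y, w x y = w y x
  sum_eq_one : ∀ x, ∑ y, w x y = 1
  sum_sq_le : ∀ Y : Finset V,
    ∑ x, (∑ y ∈ Y, w x y - #Y / (Fintype.card V : ℝ)) ^ 2 ≤ θ * #Y

/-- The proportion of the sampled symbols `c` agreeing with the entry `L x y`. -/
noncomputable def sampleWeight {K : ℕ} (L : V → V → Q) (c : Fin K → Q) (x y : V) : ℝ :=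
  (#{i | c i = L x y} : ℝ) / K

theorem exists_isPseudorandom_sampleWeight [Nonempty V] (L : V → V → Q)
    (hsymm : ∀ x y, L x y = L y x) (hbij : ∀ x, Function.Bijective (L x))
    {K j : ℕ} (hK : 0 < K) {θ : ℝ} (hθ0 : 0 ≤ θ)
    (hθ : (Fintype.card V : ℝ) * (K ^ 2 ^ j * (2 ^ j : ℕ) ^ (2 ^ j + 2 ^ j)) ≤
      (θ * K ^ 2) ^ 2 ^ j) :
    ∃ c : Fin K → Q, IsPseudorandom (sampleWeight L c) θ := by
  obtain ⟨v0⟩ := ‹Nonempty V›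
  have : Nonempty V := ⟨v0⟩
  have : Nonempty Q := ⟨L v0 v0⟩
  have hcard : Fintype.card Q = Fintype.card V :=
    (Fintype.card_of_bijective (hbij v0)).symm
  let P : Q → Matrix V V ℝ := fun q => Matrix.of fun x y => if L x y = q then 1 else 0
  have hrow : ∀ q x, ∑ y, P q x y = 1 := by
    intro q x
    obtain ⟨y, rfl⟩ := (hbij x).2 q
    simp [P, (hbij x).1.eq_iff]
  have hPs : ∀ q, (P q).IsSymm := fun q => by
    ext x y; simp [P, hsymm x y]
  have hPd : ∀ q, P q ∈ doublyStochastic ℝ V := by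
    intro q
    rw [mem_doublyStochastic_iff_sum]
    refine ⟨fun x y => ?_, hrow q, fun y => ?_⟩
    · simp only [P, Matrix.of_apply]; split_ifs <;> norm_num
    · rw [← hrow q y]
      exact Finset.sum_congr rfl fun x _ => (hPs q).apply y x
  have hsum : ∑ q, (P q - avgMatrix V) = 0 := by
    ext x y
    simp [Matrix.sum_apply, P, avgMatrix, hcard]
  obtain ⟨c, hc⟩ := exists_trace_pow_le (K := K) (m := 2 ^ j) (by positivity)
    (fun q => P q - avgMatrix V) hsum (fun q => ⟨P q, hPd q, rfl⟩)
  have hw : ∀ x y, sampleWeight L c x y = (∑ i, P (c i) x y) / K := by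
    intro x y
    simp [sampleWeight, P, eq_comm]
  have hK' : (0 : ℝ) < K := by exact_mod_cast hK
  refine ⟨c, fun x y => ?_, fun x y => ?_, fun x => ?_, fun Y => ?_⟩
  · rw [sampleWeight]; positivity
  · simp [sampleWeight, hsymm x y]
  · simp only [hw]
    rw [← Finset.sum_div, Finset.sum_comm]
    simp [hrow, hK'.ne']
  · set A := ∑ i, (P (c i) - avgMatrix V) with hA
    have hAs : A.IsSymm := by
      rw [hA, Matrix.IsSymm, Matrix.transpose_sum]
      refine Finset.sum_congr rfl fun i _ => ?_
      rw [Matrix.transpose_sub, hPs]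
      rfl
    let g : V → ℝ := fun y => if y ∈ Y then 1 else 0
    have hgg : g ⬝ᵥ g = #Y := by simp [g, dotProduct]
    have hAg : ∀ x, (A *ᵥ g) x = K * (∑ y ∈ Y, sampleWeight L c x y -
        #Y / (Fintype.card V : ℝ)) := by
      intro x
      simp only [hw, Matrix.mulVec, dotProduct, g, mul_ite, mul_one, mul_zero, hA,
        Matrix.sum_apply, Matrix.sub_apply, Finset.sum_sub_distrib, avgMatrix, Matrix.of_apply]
      simp only [Finset.sum_ite_mem, Finset.univ_inter, Finset.sum_sub_distrib, mul_sub,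
        ← Finset.sum_div]
      simp
      field_simp
    have h1 := sq_norm_mulVec_pow_le_trace hAs g j
    have h2 : ((A *ᵥ g) ⬝ᵥ (A *ᵥ g)) ^ 2 ^ j ≤ (θ * K ^ 2 * #Y) ^ 2 ^ j := by
      rw [hgg] at h1
      refine h1.trans ?_
      rw [mul_pow]
      gcongr
      exact hc.trans hθ
    have h3 := le_of_pow_le_pow_left₀ (by positivity) (by positivity) h2
    have h4 : (A *ᵥ g) ⬝ᵥ (A *ᵥ g) = K ^ 2 * ∑ x, (∑ y ∈ Y, sampleWeight L c x y -
        #Y / (Fintype.card V : ℝ)) ^ 2 := by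
      simp only [dotProduct, hAg, Finset.mul_sum]
      exact Finset.sum_congr rfl fun x _ => by ring
    rw [h4] at h3
    refine le_of_mul_le_mul_left (h3.trans_eq ?_) (pow_pos hK' 2)
    ring

end Weight

section Rotation

variable {V : Type*}

/-- `b` comes immediately after `a` in the list `l`. -/
def List.Next (l : List V) (a b : V) : Prop :=
  ∃ i, l[i]? = some a ∧ l[i + 1]? = some b

/-- `a` and `b` are consecutive, in either order, in the list `l`. -/
def List.Nbr (l : List V) (a b : V) : Prop :=
  l.Next a b ∨ l.Next b a

theorem List.Nbr.symm {l : List V} {a b : V} (h : l.Nbr a b) : l.Nbr b a := Or.symm h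

theorem List.next_reverse {l : List V} {a b : V} : l.reverse.Next a b ↔ l.Next b a := by
  have key : ∀ {l : List V} {a b : V}, l.Next b a → l.reverse.Next a b := by
    rintro l a b ⟨i, hi, hi'⟩
    refine ⟨l.length - 2 - i, ?_, ?_⟩ <;> grind
  exact ⟨fun h => by simpa using key h, key⟩

theorem List.nbr_reverse {l : List V} {a b : V} : l.reverse.Nbr a b ↔ l.Nbr a b := by
  simp only [List.Nbr, List.next_reverse]; tauto

theorem List.next_append {l₁ l₂ : List V} {a b : V} : (l₁ ++ l₂).Next a b ↔
    l₁.Next a b ∨ l₂.Next a b ∨ (l₁.getLast? = some a ∧ l₂.head? = some b) := by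
  constructor
  · rintro ⟨i, hi, hi'⟩
    rcases lt_trichotomy (i + 1) l₁.length with h | h | h
    · exact Or.inl ⟨i, by grind, by grind⟩
    · refine Or.inr (Or.inr ⟨by grind, ?_⟩)
      rwa [h, List.getElem?_append_right le_rfl, Nat.sub_self, ← List.head?_eq_getElem?] at hi'
    · exact Or.inr (Or.inl ⟨i - l₁.length, by grind, by grind⟩)
  · rintro (⟨i, hi, hi'⟩ | ⟨i, hi, hi'⟩ | ⟨h, h'⟩)
    · exact ⟨i, by grind, by grind⟩
    · exact ⟨i + l₁.length, by grind, by grind⟩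
    · have hpos : 0 < l₁.length := by
        cases l₁ <;> simp_all
      refine ⟨l₁.length - 1, by grind, ?_⟩
      rwa [Nat.sub_add_cancel hpos, List.getElem?_append_right le_rfl, Nat.sub_self,
        ← List.head?_eq_getElem?]

theorem List.nbr_append {l₁ l₂ : List V} {a b : V} : (l₁ ++ l₂).Nbr a b ↔
    l₁.Nbr a b ∨ l₂.Nbr a b ∨ (l₁.getLast? = some a ∧ l₂.head? = some b) ∨
      (l₁.getLast? = some b ∧ l₂.head? = some a) := by
  simp only [List.Nbr, List.next_append]; tauto

theorem List.Next.mem_left {l : List V} {a b : V} (h : l.Next a b) : a ∈ l := by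
  obtain ⟨i, hi, -⟩ := h; exact List.mem_of_getElem? hi

theorem List.Next.mem_right {l : List V} {a b : V} (h : l.Next a b) : b ∈ l := by
  obtain ⟨i, -, hi⟩ := h; exact List.mem_of_getElem? hi

theorem List.Nbr.mem_left {l : List V} {a b : V} (h : l.Nbr a b) : a ∈ l :=
  h.elim List.Next.mem_left List.Next.mem_right

theorem List.Nbr.mem_right {l : List V} {a b : V} (h : l.Nbr a b) : b ∈ l :=
  h.symm.mem_left

theorem List.Next.right_unique {l : List V} (hl : l.Nodup) {a b c : V} (h : l.Next a b)
    (h' : l.Next a c) : b = c := by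
  obtain ⟨i, hi, hi'⟩ := h
  obtain ⟨j, hj, hj'⟩ := h'
  have : i = j := by
    apply (List.getElem?_inj (by grind) hl).1; rw [hi, hj]
  subst this
  simpa [hi'] using hj'

theorem List.Next.left_unique {l : List V} (hl : l.Nodup) {a b c : V} (h : l.Next b a)
    (h' : l.Next c a) : b = c :=
  List.Next.right_unique (List.nodup_reverse.2 hl) (List.next_reverse.2 h) (List.next_reverse.2 h')

theorem List.Nbr.eq_or_eq {l : List V} (hl : l.Nodup) {p q t y : V} (hpq : p ≠ q)
    (hp : l.Nbr p y) (hq : l.Nbr q y) (ht : l.Nbr t y) : t = p ∨ t = q := by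
  rcases hp with hp | hp <;> rcases hq with hq | hq <;> rcases ht with ht | ht
  · exact absurd (hp.left_unique hl hq) hpq
  · exact absurd (hp.left_unique hl hq) hpq
  · exact Or.inl (ht.left_unique hl hp)
  · exact Or.inr (ht.right_unique hl hq)
  · exact Or.inr (ht.left_unique hl hq)
  · exact Or.inl (ht.right_unique hl hp)
  · exact absurd (hp.right_unique hl hq) hpq
  · exact absurd (hp.right_unique hl hq) hpq

open Classical in
/-- The closed neighbourhood of the set `S` along the list `l`. -/
noncomputable def List.closedNbr [Fintype V] (l : List V) (S : Finset V) : Finset V :=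
  {y | y ∈ S ∨ ∃ p ∈ S, l.Nbr p y}

theorem List.mem_closedNbr [Fintype V] {l : List V} {S : Finset V} {y : V} :
    y ∈ l.closedNbr S ↔ y ∈ S ∨ ∃ p ∈ S, l.Nbr p y := by
  simp [List.closedNbr]

theorem List.closedNbr_mono [Fintype V] (l : List V) {S T : Finset V} (h : S ⊆ T) :
    l.closedNbr S ⊆ l.closedNbr T := by
  intro y
  simp only [List.mem_closedNbr]
  rintro (hy | ⟨p, hp, hy⟩)
  · exact Or.inl (h hy)
  · exact Or.inr ⟨p, h hp, hy⟩

theorem List.card_closedNbr_le [Fintype V] {l : List V} (hl : l.Nodup) (S : Finset V) :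
    #(l.closedNbr S) ≤ 3 * #S := by
  classical
  have hsub : l.closedNbr S ⊆
      S.biUnion fun p => {p} ∪ (univ.filter (l.Next p) ∪ univ.filter (l.Next · p)) := by
    intro y hy
    simp only [List.mem_closedNbr, List.Nbr] at hy
    simp only [mem_biUnion, mem_union]
    grind
  refine (card_le_card hsub).trans ((card_biUnion_le_card_mul _ _ 3 fun p _ => ?_).trans_eq
    (mul_comm _ _))
  have h1 : #(univ.filter (l.Next p)) ≤ 1 := card_le_one.2 fun a ha b hb =>
    List.Next.right_unique hl (by simpa using ha) (by simpa using hb)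
  have h2 : #(univ.filter (l.Next · p)) ≤ 1 := card_le_one.2 fun a ha b hb =>
    List.Next.left_unique hl (by simpa using ha) (by simpa using hb)
  have h3 := card_union_le {p} (univ.filter (l.Next p) ∪ univ.filter (l.Next · p))
  have h4 := card_union_le (univ.filter (l.Next p)) (univ.filter (l.Next · p))
  simp only [card_singleton] at h3
  omega

/-- `Rotates r B P t Q` means that the list `Q` arises from `P` by `t` rotations of the initial
segment along pairs related by `r`, each of which creates a first vertex outside of `B`. -/
inductive Rotates (r : V → V → Prop) (B : Set V) (P : List V) : ℕ → List V → Prop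
  | refl : Rotates r B P 0 P
  | step {t : ℕ} {l₁ l₂ : List V} {x y z : V} (h : Rotates r B P t (l₁ ++ l₂))
      (hx : l₁.head? = some x) (hz : l₁.getLast? = some z) (hy : l₂.head? = some y)
      (hxy : r x y) (hB : z ∉ B) : Rotates r B P (t + 1) (l₁.reverse ++ l₂)

variable {r : V → V → Prop} {B : Set V} {P Q : List V} {t : ℕ}

theorem Rotates.perm (h : Rotates r B P t Q) : Q.Perm P := by
  induction h with
  | refl => exact .refl _
  | step h _ _ _ _ _ ih => exact ((List.reverse_perm _).append_right _).trans ih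

theorem Rotates.isChain (hr : ∀ x y, r x y → r y x) (h : Rotates r B P t Q)
    (hP : P.IsChain r) : Q.IsChain r := by
  induction h with
  | refl => exact hP
  | step h hx hz hy hxy hB ih =>
    rw [List.isChain_append] at ih ⊢
    refine ⟨?_, ih.2.1, ?_⟩
    · rw [List.isChain_reverse]
      exact ih.1.imp fun a b => hr a b
    · intro a ha b hb
      simp [hx, hy] at ha hb
      subst ha hb
      exact hxy

theorem Rotates.getLast? (h : Rotates r B P t Q) : Q.getLast? = P.getLast? := by
  induction h with
  | refl => rfl
  | @step t l₁ l₂ x y z h hx hz hy hxy hB ih =>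
    rw [← ih]
    cases l₂ with
    | nil => simp at hy
    | cons b l => simp [List.getLast?_append, List.getLast?_cons]

theorem Rotates.head?_notMem (h : Rotates r B P t Q) (hP : ∀ x ∈ P.head?, x ∉ B) :
    ∀ x ∈ Q.head?, x ∉ B := by
  induction h with
  | refl => exact hP
  | step h hx hz hy hxy hB ih =>
    intro x hx
    simp [List.head?_append, hz] at hx
    exact hx ▸ hB

theorem Rotates.exists_broken (h : Rotates r B P t Q) [DecidableEq V] :
    ∃ D : Finset (Sym2 V), #D ≤ t ∧ ∀ a b, P.Nbr a b → s(a, b) ∈ D ∨ Q.Nbr a b := by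
  induction h with
  | refl => exact ⟨∅, by simp, fun a b h => Or.inr h⟩
  | @step t l₁ l₂ x y z h hx hz hy hxy hB ih =>
    obtain ⟨D, hD, hD'⟩ := ih
    refine ⟨insert s(z, y) D, (card_insert_le _ _).trans (by omega), fun a b hab => ?_⟩
    rcases hD' a b hab with h1 | h1
    · exact Or.inl (mem_insert_of_mem h1)
    · rw [List.nbr_append] at h1 ⊢
      rw [List.nbr_reverse]
      rcases h1 with h1 | h1 | ⟨h1, h2⟩ | ⟨h1, h2⟩
      · exact Or.inr (Or.inl h1)
      · exact Or.inr (Or.inr (Or.inl h1))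
      · left; grind
      · left; simp_all [Sym2.eq_swap]

open Classical in
/-- The first vertices of the lists obtained from `P` by at most `t` rotations. -/
noncomputable def rotationHeads [Fintype V] (r : V → V → Prop) (B : Set V) (P : List V) (t : ℕ) :
    Finset V :=
  {x | ∃ s ≤ t, ∃ Q, Rotates r B P s Q ∧ Q.head? = some x}

theorem mem_rotationHeads [Fintype V] {x : V} : x ∈ rotationHeads r B P t ↔
    ∃ s ≤ t, ∃ Q, Rotates r B P s Q ∧ Q.head? = some x := by
  simp [rotationHeads]

theorem rotationHeads_mono [Fintype V] {s t : ℕ} (h : s ≤ t) :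
    rotationHeads r B P s ⊆ rotationHeads r B P t := by
  intro x
  simp only [mem_rotationHeads]
  rintro ⟨u, hu, hQ⟩
  exact ⟨u, hu.trans h, hQ⟩

theorem Rotates.nbr [Fintype V] (h : Rotates r B P t Q) {p y : V} (hpy : Q.Nbr p y) :
    P.Nbr p y ∨ y ∈ P.closedNbr (rotationHeads r B P t) := by
  induction h generalizing p y with
  | refl => exact Or.inl hpy
  | @step t l₁ l₂ x y' z h hx hz hy hxy hB ih =>
    have hmono := P.closedNbr_mono (rotationHeads_mono (r := r) (B := B) (P := P) t.le_succ)
    have hold : (l₁ ++ l₂).Nbr p y →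
        P.Nbr p y ∨ y ∈ P.closedNbr (rotationHeads r B P (t + 1)) := fun h' =>
      (ih h').imp_right fun h'' => hmono h''
    have hxmem : x ∈ rotationHeads r B P (t + 1) :=
      mem_rotationHeads.2 ⟨t, t.le_succ, _, h, by simp [List.head?_append, hx]⟩
    have hzmem : z ∈ rotationHeads r B P (t + 1) :=
      mem_rotationHeads.2 ⟨t + 1, le_rfl, _, .step h hx hz hy hxy hB, by
        simp [List.head?_append, hz]⟩
    have hymem : y' ∈ P.closedNbr (rotationHeads r B P (t + 1)) := by
      rcases ih (p := z) (y := y') (by rw [List.nbr_append]; simp [hz, hy]) with h' | h'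
      · exact List.mem_closedNbr.2 (Or.inr ⟨z, hzmem, h'⟩)
      · exact hmono h'
    rw [List.nbr_append, List.nbr_reverse] at hpy
    simp only [List.getLast?_reverse, hx, hy, Option.some.injEq] at hpy
    rcases hpy with h' | h' | ⟨h', h''⟩ | ⟨h', h''⟩
    · exact hold (List.nbr_append.2 (Or.inl h'))
    · exact hold (List.nbr_append.2 (Or.inr (Or.inl h')))
    · exact Or.inr (h'' ▸ hymem)
    · exact Or.inr (h' ▸ List.mem_closedNbr.2 (Or.inl hxmem))

/-- Pósa's lemma: every neighbour of a rotation head is close to a rotation head, or next to a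
forbidden vertex. -/
theorem mem_closedNbr_of_mem_rotationHeads [Fintype V] {x y : V}
    (hx : x ∈ rotationHeads r B P t) (hy : y ∈ P) (hxy : r x y) :
    y ∈ P.closedNbr (rotationHeads r B P (t + 1)) ∨ ∃ z ∈ B, P.Nbr z y := by
  obtain ⟨s, hs, Q, hQ, hQx⟩ := mem_rotationHeads.1 hx
  have hyQ : y ∈ Q := hQ.perm.mem_iff.2 hy
  obtain ⟨l₁, l₂, rfl⟩ := List.append_of_mem hyQ
  have hmono := P.closedNbr_mono (rotationHeads_mono (r := r) (B := B) (P := P)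
    (hs.trans t.le_succ))
  rcases l₁.eq_nil_or_concat with rfl | ⟨l, z, rfl⟩
  · simp at hQx
    subst hQx
    exact Or.inl (List.mem_closedNbr.2 (Or.inl (rotationHeads_mono t.le_succ hx)))
  · have hzy : (l.concat z ++ y :: l₂).Nbr z y := by
      rw [List.nbr_append]; simp
    rcases hQ.nbr hzy with h' | h'
    · by_cases hzB : z ∈ B
      · exact Or.inr ⟨z, hzB, h'⟩
      · refine Or.inl (List.mem_closedNbr.2 (Or.inr ⟨z, ?_, h'⟩))
        have hx' : (l.concat z).head? = some x := by
          simpa [List.head?_append] using hQx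
        refine mem_rotationHeads.2 ⟨s + 1, by omega, _,
          .step hQ hx' (by simp) (by simp) hxy hzB, by simp⟩
    · exact Or.inl (hmono h')

end Rotation

section Expansion

variable {V : Type*} [Fintype V] {w : V → V → ℝ} {θ : ℝ}

theorem IsPseudorandom.sq_sum_sub_le (hw : IsPseudorandom w θ) (X Y : Finset V) :
    (∑ x ∈ X, ∑ y ∈ Y, w x y - #X * #Y / (Fintype.card V : ℝ)) ^ 2 ≤ θ * (#X * #Y) := by
  have h1 : ∑ x ∈ X, ∑ y ∈ Y, w x y - #X * #Y / (Fintype.card V : ℝ) =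
      ∑ x ∈ X, (∑ y ∈ Y, w x y - #Y / (Fintype.card V : ℝ)) := by
    rw [sum_sub_distrib, sum_const, nsmul_eq_mul, mul_div_assoc]
  rw [h1]
  refine (sq_sum_le_card_mul_sum_sq).trans ?_
  have h2 := (sum_le_sum_of_subset_of_nonneg (subset_univ X) fun x _ _ =>
    sq_nonneg (∑ y ∈ Y, w x y - #Y / (Fintype.card V : ℝ))).trans (hw.sum_sq_le Y)
  calc _ ≤ (#X : ℝ) * (θ * #Y) := by gcongr
    _ = _ := by ring

theorem IsPseudorandom.nonneg_of_nonempty [Nonempty V] (hw : IsPseudorandom w θ) : 0 ≤ θ := by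
  have h := hw.sum_sq_le {Classical.arbitrary V}
  simpa using (sum_nonneg fun x _ => sq_nonneg _).trans h

theorem IsPseudorandom.sum_le_sum_of_imp (hw : IsPseudorandom w θ) {x : V} {Y Z : Finset V}
    (h : ∀ y ∈ Y, 0 < w x y → y ∈ Z) : ∑ y ∈ Y, w x y ≤ ∑ y ∈ Z, w x y := by
  classical
  have h1 : ∑ y ∈ Y ∩ Z, w x y = ∑ y ∈ Y, w x y := by
    refine sum_subset inter_subset_left fun y hy hy' => ?_
    by_contra hne
    exact hy' (mem_inter.2 ⟨hy, h y hy ((hw.nonneg x y).lt_of_ne' hne)⟩)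
  rw [← h1]
  exact sum_le_sum_of_subset_of_nonneg inter_subset_right fun y _ _ => hw.nonneg x y

/-- A small set cannot receive a positive proportion of the weight of a much larger set. -/
theorem IsPseudorandom.sq_mul_card_le [Nonempty V] (hw : IsPseudorandom w θ) {X Y : Finset V}
    {κ : ℝ} (hκ : 0 < κ) (hX : ∀ x ∈ X, κ ≤ ∑ y ∈ Y, w x y)
    (hY : 2 * #Y ≤ κ * Fintype.card V) : κ ^ 2 * #X ≤ 4 * θ * #Y := by
  have hθ := hw.nonneg_of_nonempty
  rcases X.eq_empty_or_nonempty with rfl | hXne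
  · simp; positivity
  have hXpos : (0 : ℝ) < #X := by exact_mod_cast hXne.card_pos
  have hn : (0 : ℝ) < Fintype.card V := by exact_mod_cast Fintype.card_pos
  have h1 : κ * #X ≤ ∑ x ∈ X, ∑ y ∈ Y, w x y := by
    have := card_nsmul_le_sum X _ κ hX
    rw [nsmul_eq_mul] at this
    linarith
  have h2 : #X * #Y / (Fintype.card V : ℝ) ≤ κ / 2 * #X := by
    rw [div_le_iff₀ hn]
    nlinarith
  have h3 := hw.sq_sum_sub_le X Y
  have h4 : (κ / 2 * #X) ^ 2 ≤ θ * (#X * #Y) := by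
    refine le_trans ?_ h3
    have : 0 ≤ κ / 2 * #X := by positivity
    gcongr
    linarith
  have h5 : #X * (κ ^ 2 * #X) ≤ #X * (4 * θ * #Y) := by nlinarith
  exact le_of_mul_le_mul_left h5 hXpos

theorem IsPseudorandom.card_mul_card_le [Nonempty V] (hw : IsPseudorandom w θ) {X Y : Finset V}
    (h : ∀ x ∈ X, ∀ y ∈ Y, ¬ 0 < w x y) : (#X * #Y : ℝ) ≤ θ * Fintype.card V ^ 2 := by
  have hθ := hw.nonneg_of_nonempty
  have hn : (0 : ℝ) < Fintype.card V := by exact_mod_cast Fintype.card_pos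
  have h0 : ∑ x ∈ X, ∑ y ∈ Y, w x y = 0 := sum_eq_zero fun x hx => sum_eq_zero fun y hy =>
    le_antisymm (not_lt.1 (h x hx y hy)) (hw.nonneg x y)
  have h1 := hw.sq_sum_sub_le X Y
  rw [h0, zero_sub, neg_sq, div_pow, div_le_iff₀ (by positivity)] at h1
  rcases (show (0 : ℝ) ≤ #X * #Y by positivity).eq_or_lt with h2 | h2
  · rw [← h2]; positivity
  · refine le_of_mul_le_mul_left ?_ h2
    nlinarith

/-- Expansion: the neighbourhood of a set that is not too large is much larger. -/
theorem IsPseudorandom.card_le_mul_card [Nonempty V] (hw : IsPseudorandom w θ) {X Y : Finset V}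
    (h : ∀ x ∈ X, ∀ y, 0 < w x y → y ∈ Y) (hY : 2 * #Y ≤ Fintype.card V) :
    (#X : ℝ) ≤ 4 * θ * #Y := by
  have := hw.sq_mul_card_le (X := X) (Y := Y) one_pos (fun x hx => by
    rw [← hw.sum_eq_one x]
    exact hw.sum_le_sum_of_imp fun y _ hy => h x hx y hy) (by rw [one_mul]; exact_mod_cast hY)
  simpa using this

end Expansion

section LongestPath

variable {V : Type*}

/-- `P` is a path in the graph with adjacency relation `r`, and no path is longer. -/
structure IsLongestPath (r : V → V → Prop) (P : List V) : Prop where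
  nodup : P.Nodup
  isChain : P.IsChain r
  length_le : ∀ Q : List V, Q.Nodup → Q.IsChain r → Q.length ≤ P.length

variable {r : V → V → Prop} {P Q : List V}

theorem exists_isLongestPath [Fintype V] (r : V → V → Prop) : ∃ P, IsLongestPath r P := by
  classical
  let p : ℕ → Prop := fun m => ∃ Q : List V, Q.Nodup ∧ Q.IsChain r ∧ Q.length = m
  have h0 : p 0 := ⟨[], by simp⟩
  obtain ⟨P, hP, hP', hlen⟩ := Nat.findGreatest_spec (Nat.zero_le (Fintype.card V)) h0
  exact ⟨P, hP, hP', fun Q hQ hQ' =>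
    hlen ▸ Nat.le_findGreatest hQ.length_le_card ⟨Q, hQ, hQ', rfl⟩⟩

theorem IsLongestPath.of_perm (h : IsLongestPath r P) (hQ : Q.Perm P) (hQ' : Q.IsChain r) :
    IsLongestPath r Q :=
  ⟨hQ.nodup_iff.2 h.nodup, hQ', hQ.length_eq ▸ h.length_le⟩

theorem IsLongestPath.reverse (hr : ∀ x y, r x y → r y x) (h : IsLongestPath r P) :
    IsLongestPath r P.reverse :=
  h.of_perm P.reverse_perm (List.isChain_reverse.2 (h.isChain.imp fun a b => hr a b))

theorem IsLongestPath.mem_of_rel (h : IsLongestPath r P) {x y : V} (hx : P.head? = some x)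
    (hxy : r y x) : y ∈ P := by
  by_contra hy
  have := h.length_le (y :: P) (List.nodup_cons.2 ⟨hy, h.nodup⟩)
    (List.isChain_cons.2 ⟨by simpa [hx] using hxy, h.isChain⟩)
  simp at this

theorem IsLongestPath.ne_nil [Nonempty V] (h : IsLongestPath r P) : P ≠ [] := by
  rintro rfl
  simpa using h.length_le [Classical.arbitrary V] (by simp) (by simp)

theorem IsLongestPath.mem_of_mem_rotationHeads [Fintype V] (hr : ∀ x y, r x y → r y x)
    (h : IsLongestPath r P) {B : Set V} {t : ℕ} {x y : V} (hx : x ∈ rotationHeads r B P t)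
    (hxy : r x y) : y ∈ P := by
  obtain ⟨s, -, Q, hQ, hQx⟩ := mem_rotationHeads.1 hx
  exact hQ.perm.mem_iff.1
    ((h.of_perm hQ.perm (hQ.isChain hr h.isChain)).mem_of_rel hQx (hr _ _ hxy))

/-- If the ends of a longest path are adjacent, then no edge leaves its vertex set. -/
theorem IsLongestPath.not_rel_of_cycle (hr : ∀ x y, r x y → r y x) (h : IsLongestPath r P)
    (hcyc : ∀ x ∈ P.head?, ∀ z ∈ P.getLast?, r z x) {x y : V} (hx : x ∈ P) (hy : y ∉ P) :
    ¬ r x y := by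
  intro hxy
  obtain ⟨l₁, l₂, rfl⟩ := List.append_of_mem hx
  have hperm : ((x :: l₂) ++ l₁).Perm (l₁ ++ x :: l₂) := List.perm_append_comm
  have hch := List.isChain_append.1 h.isChain
  refine hy (hperm.mem_iff.1 ((h.of_perm hperm ?_).mem_of_rel (x := x) (by simp) (hr _ _ hxy)))
  rw [List.isChain_append]
  refine ⟨hch.2.1, hch.1, fun a ha b hb => hcyc b ?_ a ?_⟩
  · simp_all [List.head?_append]
  · simp_all [List.getLast?_append]

end LongestPath

section Heads

variable {V : Type*} [Fintype V] [Nonempty V] {w : V → V → ℝ} {θ : ℝ} {P : List V}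

theorem card_le_mul_card_rotationHeads (hw : IsPseudorandom w θ) (hθ : θ ≤ 1 / 24)
    (hP : IsLongestPath (fun x y => 0 < w x y) P) {ℓ : ℕ} (hℓ : Fintype.card V ≤ 2 ^ ℓ) :
    Fintype.card V ≤ 6 * #(rotationHeads (fun x y => 0 < w x y) ∅ P ℓ) := by
  set S := rotationHeads (fun x y => 0 < w x y) ∅ P
  have hr : ∀ x y, 0 < w x y → 0 < w y x := fun x y h => hw.symm x y ▸ h
  have key : ∀ t, 2 ^ t ≤ #(S t) ∨ Fintype.card V ≤ 6 * #(S t) := by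
    intro t
    induction t with
    | zero =>
      left
      obtain ⟨x, l, rfl⟩ := List.exists_cons_of_ne_nil hP.ne_nil
      exact card_pos.2 ⟨x, mem_rotationHeads.2 ⟨0, le_rfl, _, .refl, rfl⟩⟩
    | succ t ih =>
      have hY := List.card_closedNbr_le hP.nodup (S (t + 1))
      have hmono : #(S t) ≤ #(S (t + 1)) := card_le_card (rotationHeads_mono t.le_succ)
      rcases ih with ih | ih
      · by_cases hc : 2 * #(P.closedNbr (S (t + 1))) ≤ Fintype.card V
        · left
          have h1 := hw.card_le_mul_card (X := S t) (fun x hx y hxy => by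
            simpa using mem_closedNbr_of_mem_rotationHeads hx
              (hP.mem_of_mem_rotationHeads hr hx hxy) hxy) hc
          have h2 : (#(S t) : ℝ) ≤ 1 / 6 * (3 * #(S (t + 1))) := by
            refine h1.trans (mul_le_mul (by linarith) (by exact_mod_cast hY) (by positivity)
              (by norm_num))
          have h3 : (2 * #(S t) : ℝ) ≤ #(S (t + 1)) := by linarith
          have h4 : 2 * #(S t) ≤ #(S (t + 1)) := by exact_mod_cast h3
          rw [pow_succ]
          omega
        · right
          omega
      · right
        omega
  rcases key ℓ with h | h <;> omega

theorem card_compl_le [DecidableEq V] (hw : IsPseudorandom w θ) (hθ : θ ≤ 1 / 24)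
    (hP : IsLongestPath (fun x y => 0 < w x y) P) :
    (#P.toFinsetᶜ : ℝ) ≤ 6 * θ * Fintype.card V := by
  have hr : ∀ x y, 0 < w x y → 0 < w y x := fun x y h => hw.symm x y ▸ h
  have h1 := card_le_mul_card_rotationHeads hw hθ hP Nat.lt_two_pow_self.le
  set S := rotationHeads (fun x y => 0 < w x y) ∅ P (Fintype.card V) with hS
  have h2 := hw.card_mul_card_le (X := S) (Y := P.toFinsetᶜ) fun x hx y hy hxy => by
    simp only [mem_compl, List.mem_toFinset] at hy
    exact hy (hP.mem_of_mem_rotationHeads hr hx hxy)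
  have hn : (0 : ℝ) < Fintype.card V := by exact_mod_cast Fintype.card_pos
  have h3 : (Fintype.card V : ℝ) ≤ 6 * #S := by exact_mod_cast h1
  refine le_of_mul_le_mul_left ?_ hn
  nlinarith [show (0 : ℝ) ≤ #P.toFinsetᶜ by positivity]

/-- If the vertices of a longest path form a cycle, then this cycle is Hamiltonian. -/
theorem mem_of_cycle (hw : IsPseudorandom w θ) (hθ : θ ≤ 1 / 24)
    (hP : IsLongestPath (fun x y => 0 < w x y) P)
    (hcyc : ∀ x ∈ P.head?, ∀ z ∈ P.getLast?, 0 < w z x) (v : V) : v ∈ P := by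
  classical
  have hr : ∀ x y, 0 < w x y → 0 < w y x := fun x y h => hw.symm x y ▸ h
  have h1 := card_compl_le hw hθ hP
  have hn : (0 : ℝ) < Fintype.card V := by exact_mod_cast Fintype.card_pos
  have h2 : (2 * #P.toFinsetᶜ : ℝ) ≤ Fintype.card V := by nlinarith
  have h3 := hw.card_le_mul_card (X := P.toFinsetᶜ) (Y := P.toFinsetᶜ) (fun x hx y hxy => by
    simp only [mem_compl, List.mem_toFinset] at hx ⊢
    exact fun hy => hP.not_rel_of_cycle hr hcyc hy hx (hr _ _ hxy)) (by exact_mod_cast h2)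
  have h4 : (#P.toFinsetᶜ : ℝ) = 0 := by
    nlinarith [show (0 : ℝ) ≤ #P.toFinsetᶜ by positivity]
  have h5 : P.toFinsetᶜ = ∅ := by simpa using h4
  exact List.mem_toFinset.1 ((compl_eq_empty_iff _).1 h5 ▸ mem_univ v)

end Heads

section Core

variable {V : Type*} [Fintype V] [Nonempty V] {w : V → V → ℝ} {θ : ℝ} {P Q : List V}

/-- A small set `B₀` can be enlarged to a small set `B` such that the vertices outside of `B` send
little weight to the closed neighbourhood of `B` along the path `P`. -/
theorem exists_core (hw : IsPseudorandom w θ) (hθ : θ ≤ 1 / 2400) (hP : P.Nodup) {B₀ : Finset V}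
    (hB₀ : 120 * #B₀ + 60 ≤ Fintype.card V) :
    ∃ B, B₀ ⊆ B ∧ 60 * #B ≤ Fintype.card V ∧
      ∀ x ∉ B, ∑ y ∈ P.closedNbr B, w x y ≤ 1 / 10 := by
  classical
  have hθ0 := hw.nonneg_of_nonempty
  let F : Finset (Finset V) := univ.filter fun B => B₀ ⊆ B ∧ 60 * #B ≤ Fintype.card V ∧
    ∀ x ∈ B \ B₀, 1 / 10 ≤ ∑ y ∈ P.closedNbr B, w x y
  have hF : B₀ ∈ F := by
    simp only [F, mem_filter, mem_univ, true_and, subset_rfl, sdiff_self]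
    exact ⟨by omega, by simp⟩
  obtain ⟨B, hB, hmax⟩ := F.exists_max_image card ⟨B₀, hF⟩
  simp only [F, mem_filter, mem_univ, true_and] at hB hmax
  obtain ⟨hsub, hcard, hx⟩ := hB
  refine ⟨B, hsub, hcard, fun x hxB => ?_⟩
  have hY := List.card_closedNbr_le hP B
  have h1 := hw.sq_mul_card_le (by norm_num) hx (by
    have : (60 * #B : ℝ) ≤ Fintype.card V := by exact_mod_cast hcard
    have : (#(P.closedNbr B) : ℝ) ≤ 3 * #B := by exact_mod_cast hY
    linarith)
  have h2 : (2 * #(B \ B₀) : ℝ) ≤ #B := by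
    have h3 : 4 * θ * #(P.closedNbr B) ≤ 4 * (1 / 2400) * (3 * #B) := by
      gcongr; exact_mod_cast hY
    linarith
  have h4 : 2 * #(B \ B₀) ≤ #B := by exact_mod_cast h2
  have h5 : #B ≤ #(B \ B₀) + #B₀ := by rw [card_sdiff_add_card_eq_card hsub]
  by_contra! hlt
  have h6 := hmax (insert x B) ⟨hsub.trans (subset_insert _ _), by
    rw [card_insert_of_notMem hxB]; omega, fun y hy => ?_⟩
  · rw [card_insert_of_notMem hxB] at h6; omega
  · have hmono : ∑ z ∈ P.closedNbr B, w y z ≤ ∑ z ∈ P.closedNbr (insert x B), w y z :=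
      sum_le_sum_of_subset_of_nonneg (P.closedNbr_mono (subset_insert _ _))
        fun z _ _ => hw.nonneg y z
    refine le_trans ?_ hmono
    rw [mem_sdiff, mem_insert] at hy
    rcases hy.1 with rfl | hy'
    · exact hlt.le
    · exact hx y (mem_sdiff.2 ⟨hy', hy.2⟩)

/-- If the vertices outside of `B` send weight to vertices which are not close to `B`, then
rotations avoiding `B` produce linearly many heads. -/
theorem exists_card_le_mul_card_rotationHeads (hw : IsPseudorandom w θ) (hθ : θ < 1 / 1200)
    (hQ : Q.Nodup) {B T : Finset V} (hhead : ∃ x ∉ B, Q.head? = some x)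
    (hTQ : ∀ y ∈ T, y ∈ Q) (hT : ∀ y ∈ T, ∀ z, Q.Nbr z y → z ∉ B)
    (hw' : ∀ x ∉ B, 1 / 10 ≤ ∑ y ∈ T, w x y) :
    ∃ t, Fintype.card V ≤ 60 * #(rotationHeads (fun x y => 0 < w x y) B Q t) := by
  classical
  have hθ0 := hw.nonneg_of_nonempty
  set S := rotationHeads (fun x y => 0 < w x y) B Q with hS
  have hSB : ∀ t, ∀ x ∈ S t, x ∉ B := by
    intro t x hx
    obtain ⟨s, -, Q', hQ', hx'⟩ := mem_rotationHeads.1 hx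
    obtain ⟨x₀, hx₀, hx₀'⟩ := hhead
    exact hQ'.head?_notMem (by simpa [hx₀'] using hx₀) x hx'
  by_contra! hlt
  obtain ⟨t, ht⟩ : ∃ t, #(S (t + 1)) ≤ #(S t) := by
    by_contra! hinc
    have := (strictMono_nat_of_lt_succ hinc).id_le (Fintype.card V + 1)
    have h' := card_le_univ (S (Fintype.card V + 1))
    simp only [id] at this
    omega
  have hSS : S t = S (t + 1) := eq_of_subset_of_card_le (rotationHeads_mono t.le_succ) ht
  have hY := List.card_closedNbr_le hQ (S t)
  have h1 := hw.sq_mul_card_le (X := S t) (Y := Q.closedNbr (S t)) (κ := 1 / 10) (by norm_num)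
    (fun x hx => (hw' x (hSB t x hx)).trans (hw.sum_le_sum_of_imp fun y hy hxy => by
      rcases mem_closedNbr_of_mem_rotationHeads hx (hTQ y hy) hxy with h | ⟨z, hz, h⟩
      · rw [hSS]; exact h
      · exact absurd hz (hT y hy z h))) (by
    have h2 : (60 * #(S t) : ℝ) ≤ Fintype.card V := by exact_mod_cast (hlt t).le
    have h3 : (#(Q.closedNbr (S t)) : ℝ) ≤ 3 * #(S t) := by exact_mod_cast hY
    linarith)
  obtain ⟨x₀, -, hx₀⟩ := hhead
  have hpos : (0 : ℝ) < #(S t) := by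
    exact_mod_cast card_pos.2 ⟨x₀, mem_rotationHeads.2 ⟨0, by omega, _, .refl, hx₀⟩⟩
  have h3 : 4 * θ * #(Q.closedNbr (S t)) ≤ 4 * θ * (3 * #(S t)) := by
    gcongr; exact_mod_cast hY
  nlinarith

/-- The ends of a longest path can be moved out of a small set while breaking few of the pairs of
consecutive vertices. -/
theorem exists_longestPath_ends_notMem [DecidableEq V] (hw : IsPseudorandom w θ) (hθ : θ ≤ 1 / 24)
    (hP : IsLongestPath (fun x y => 0 < w x y) P) {ℓ : ℕ} (hℓ : Fintype.card V ≤ 2 ^ ℓ)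
    {B : Finset V} (hB : 6 * #B < Fintype.card V) :
    ∃ Q, IsLongestPath (fun x y => 0 < w x y) Q ∧ Q.Perm P ∧ (∃ x ∉ B, Q.head? = some x) ∧
      (∃ x ∉ B, Q.getLast? = some x) ∧ ∃ D : Finset (Sym2 V), #D ≤ 2 * ℓ ∧
        ∀ a b, P.Nbr a b → s(a, b) ∈ D ∨ Q.Nbr a b := by
  have hr : ∀ x y, 0 < w x y → 0 < w y x := fun x y h => hw.symm x y ▸ h
  have key : ∀ P, IsLongestPath (fun x y => 0 < w x y) P →
      ∃ Q, IsLongestPath (fun x y => 0 < w x y) Q ∧ Q.Perm P ∧ (∃ x ∉ B, Q.head? = some x) ∧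
      Q.getLast? = P.getLast? ∧ ∃ D : Finset (Sym2 V), #D ≤ ℓ ∧
        ∀ a b, P.Nbr a b → s(a, b) ∈ D ∨ Q.Nbr a b := by
    intro P hP
    have h1 := card_le_mul_card_rotationHeads hw hθ hP hℓ
    obtain ⟨x, hx, hxB⟩ := exists_mem_notMem_of_card_lt_card (s := B)
      (t := rotationHeads (fun x y => 0 < w x y) ∅ P ℓ) (by omega)
    obtain ⟨s, hs, Q, hQ, hQx⟩ := mem_rotationHeads.1 hx
    obtain ⟨D, hD, hD'⟩ := hQ.exists_broken
    exact ⟨Q, hP.of_perm hQ.perm (hQ.isChain hr hP.isChain), hQ.perm, ⟨x, hxB, hQx⟩,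
      hQ.getLast?, D, hD.trans hs, hD'⟩
  obtain ⟨Q₁, hQ₁, hp₁, ⟨x, hx, hx'⟩, -, D₁, hD₁, hD₁'⟩ := key P hP
  obtain ⟨Q₂, hQ₂, hp₂, hy, hl, D₂, hD₂, hD₂'⟩ := key Q₁.reverse (hQ₁.reverse hr)
  refine ⟨Q₂, hQ₂, hp₂.trans (Q₁.reverse_perm.trans hp₁), hy, ⟨x, hx, by simpa [hl] using hx'⟩,
    D₁ ∪ D₂, (card_union_le _ _).trans (by omega), fun a b hab => ?_⟩
  rcases hD₁' a b hab with h | h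
  · exact Or.inl (mem_union_left _ h)
  · exact (hD₂' a b (List.nbr_reverse.2 h)).imp_left fun h => mem_union_right _ h

/-- If the rotations of the two halves of a path have linearly many heads each, then the path can
be closed to a cycle. -/
theorem exists_cycle_of_rotationHeads (hw : IsPseudorandom w θ) (hθ : θ < 1 / 3600) {l₁ l₂ : List V}
    (hch : (l₁ ++ l₂).IsChain fun x y => 0 < w x y) {B : Set V} {s t : ℕ}
    (h₁ : Fintype.card V ≤ 60 * #(rotationHeads (fun x y => 0 < w x y) B l₁ s))
    (h₂ : Fintype.card V ≤ 60 * #(rotationHeads (fun x y => 0 < w x y) B l₂.reverse t)) :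
    ∃ l : List V, l.Perm (l₁ ++ l₂) ∧ l.IsChain (fun x y => 0 < w x y) ∧
      ∀ x ∈ l.head?, ∀ z ∈ l.getLast?, 0 < w z x := by
  have hr : ∀ x y, 0 < w x y → 0 < w y x := fun x y h => hw.symm x y ▸ h
  have hn : (0 : ℝ) < Fintype.card V := by exact_mod_cast Fintype.card_pos
  obtain ⟨x, hx, z, hz, hxz⟩ : ∃ x ∈ rotationHeads (fun x y => 0 < w x y) B l₁ s,
      ∃ z ∈ rotationHeads (fun x y => 0 < w x y) B l₂.reverse t, 0 < w x z := by
    by_contra! hno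
    have h3 := hw.card_mul_card_le fun x hx y hy => not_lt.2 (hno x hx y hy)
    have h4 := (Nat.cast_le (α := ℝ)).2 h₁
    have h5 := (Nat.cast_le (α := ℝ)).2 h₂
    push_cast at h4 h5
    have h6 := mul_le_mul h4 h5 hn.le (by positivity)
    nlinarith [pow_pos hn 2]
  obtain ⟨_, -, A₁, hA₁, hx'⟩ := mem_rotationHeads.1 hx
  obtain ⟨_, -, A₂, hA₂, hz'⟩ := mem_rotationHeads.1 hz
  rw [List.isChain_append] at hch
  have hrev : l₂.reverse.IsChain fun x y => 0 < w x y :=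
    List.isChain_reverse.2 (hch.2.1.imp fun a b => hr a b)
  refine ⟨A₁ ++ A₂.reverse, hA₁.perm.append
    (A₂.reverse_perm.trans (hA₂.perm.trans l₂.reverse_perm)), ?_, ?_⟩
  · rw [List.isChain_append]
    refine ⟨hA₁.isChain hr hch.1, List.isChain_reverse.2
      ((hA₂.isChain hr hrev).imp fun a b => hr a b), fun a ha b hb => hch.2.2 a ?_ b ?_⟩
    · rwa [← hA₁.getLast?]
    · rwa [List.head?_reverse, hA₂.getLast?, List.getLast?_reverse] at hb
  · intro a ha b hb
    simp [List.head?_append, List.getLast?_append, hx', hz'] at ha hb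
    subst ha hb
    exact hr _ _ hxz

end Core

section Arcs

variable {V : Type*} [DecidableEq V]

/-- The `j`-th arc of `s` consecutive vertices of the list `P`, not counting the first vertex. -/
def List.arc (P : List V) (s j : ℕ) : Finset V :=
  ((P.drop (s * j + 1)).take s).toFinset

variable {P : List V} {s j : ℕ}

theorem List.mem_arc {x : V} :
    x ∈ P.arc s j ↔ ∃ i, s * j ≤ i ∧ i < s * j + s ∧ P[i + 1]? = some x := by
  simp only [List.arc, List.mem_toFinset, List.mem_iff_getElem?, List.getElem?_take,
    List.getElem?_drop]
  constructor
  · rintro ⟨i, hi⟩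
    split_ifs at hi with h
    exact ⟨s * j + i, by omega, by omega, by rw [← hi]; congr 1; omega⟩
  · rintro ⟨i, h1, h2, h3⟩
    refine ⟨i - s * j, ?_⟩
    rw [if_pos (by omega), ← h3]
    congr 1; omega

theorem List.card_arc (hP : P.Nodup) {k : ℕ} (hk : s * k + 1 ≤ P.length) (hj : j < k) :
    #(P.arc s j) = s := by
  rw [List.arc, List.toFinset_card_of_nodup ((hP.sublist (List.drop_sublist _ _)).sublist
    (List.take_sublist _ _)), List.length_take, List.length_drop]
  have : s * (j + 1) ≤ s * k := Nat.mul_le_mul_left s hj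
  rw [mul_add] at this
  omega

theorem List.arc_disjoint (hP : P.Nodup) {i j : ℕ} (hij : i ≠ j) :
    _root_.Disjoint (P.arc s i) (P.arc s j) := by
  rw [Finset.disjoint_left]
  intro x hx hx'
  obtain ⟨a, ha, ha', hax⟩ := List.mem_arc.1 hx
  obtain ⟨b, hb, hb', hbx⟩ := List.mem_arc.1 hx'
  have hab : a + 1 = b + 1 := by
    apply (List.getElem?_inj (by grind) hP).1; rw [hax, hbx]
  rcases lt_or_gt_of_ne hij with h | h
  · have : s * (i + 1) ≤ s * j := Nat.mul_le_mul_left s h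
    rw [mul_add] at this
    omega
  · have : s * (j + 1) ≤ s * i := Nat.mul_le_mul_left s h
    rw [mul_add] at this
    omega

theorem List.exists_nbr_nbr_of_mem_arc (hP : P.Nodup) {k : ℕ} (hk : s * k + 2 ≤ P.length)
    (hj : j < k) {y : V} (hy : y ∈ P.arc s j) : ∃ p q, p ≠ q ∧ P.Nbr p y ∧ P.Nbr q y := by
  obtain ⟨i, hi, hi', hiy⟩ := List.mem_arc.1 hy
  have : s * (j + 1) ≤ s * k := Nat.mul_le_mul_left s hj
  rw [mul_add] at this
  refine ⟨P[i]'(by omega), P[i + 2]'(by omega), fun h => ?_, ?_, ?_⟩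
  · have := (hP.getElem_inj_iff).1 h
    omega
  · exact Or.inl ⟨i, by simp, hiy⟩
  · exact Or.inr ⟨i + 1, hiy, by simp⟩

/-- An arc none of whose pairs of consecutive vertices has been broken stays in one piece. -/
theorem List.arc_subset_or_subset {A A' : List V} (hA : A.Disjoint A') {k : ℕ}
    (hk : s * k + 2 ≤ P.length) (hj : j < k)
    (h : ∀ a ∈ P.arc s j, ∀ b, P.Nbr a b → A.Nbr a b ∨ A'.Nbr a b) :
    P.arc s j ⊆ A.toFinset ∨ P.arc s j ⊆ A'.toFinset := by
  have hlt : s * (j + 1) ≤ s * k := Nat.mul_le_mul_left s hj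
  rw [mul_add] at hlt
  have key : ∀ A A' : List V, A.Disjoint A' →
      (∀ a ∈ P.arc s j, ∀ b, P.Nbr a b → A.Nbr a b ∨ A'.Nbr a b) →
      (∀ a, P[s * j + 1]? = some a → a ∈ A) → P.arc s j ⊆ A.toFinset := by
    intro A A' hA h h0
    have hall : ∀ i < s, ∀ a, P[s * j + i + 1]? = some a → a ∈ A := by
      intro i
      induction i with
      | zero => exact fun _ => h0
      | succ i ih =>
        intro hi a ha
        have hb : P[s * j + i + 1]? = some (P[s * j + i + 1]'(by omega)) := by simp
        have hbA := ih (by omega) _ hb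
        rcases h _ (List.mem_arc.2 ⟨s * j + i, by omega, by omega, hb⟩) a
          (Or.inl ⟨_, hb, ha⟩) with h' | h'
        · exact h'.mem_right
        · exact absurd h'.mem_left (hA hbA)
    intro a ha
    obtain ⟨i, hi, hi', hia⟩ := List.mem_arc.1 ha
    exact List.mem_toFinset.2 (hall (i - s * j) (by omega) a
      (by rw [← hia]; congr 1; omega))
  rcases Nat.eq_zero_or_pos s with rfl | hs
  · left
    intro a ha
    obtain ⟨i, hi, hi', -⟩ := List.mem_arc.1 ha
    omega
  have hb : P[s * j + 1]? = some (P[s * j + 1]'(by omega)) := by simp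
  have hbn : P.Nbr (P[s * j + 1]'(by omega)) (P[s * j + 2]'(by omega)) :=
    Or.inl ⟨s * j + 1, hb, by simp⟩
  rcases h _ (List.mem_arc.2 ⟨s * j, le_rfl, by omega, hb⟩) _ hbn with h' | h'
  · exact Or.inl (key A A' hA h fun a ha => by
      rw [hb, Option.some.injEq] at ha; exact ha ▸ h'.mem_left)
  · exact Or.inr (key A' A hA.symm (fun a ha b hab => (h a ha b hab).symm) fun a ha => by
      rw [hb, Option.some.injEq] at ha; exact ha ▸ h'.mem_left)

end Arcs

section Uniform

variable {V : Type*} [Fintype V] [DecidableEq V] [Nonempty V] {w : V → V → ℝ} {θ : ℝ}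

/-- Most vertices distribute their weight uniformly among a family of disjoint sets of equal
size. -/
theorem exists_uniform (hw : IsPseudorandom w θ) {I : ℕ → Finset V} {k s : ℕ}
    (hI : ∀ j < k, #(I j) = s) (hdisj : ∀ i j, i ≠ j → Disjoint (I i) (I j)) :
    ∃ B₀ : Finset V, (#B₀ : ℝ) ≤ 400 * k * θ * Fintype.card V ∧ ∀ x ∉ B₀, ∀ J ⊆ range k,
      (#J * s : ℝ) / Fintype.card V - 1 / 20 ≤ ∑ y ∈ J.biUnion I, w x y := by
  have hθ := hw.nonneg_of_nonempty
  set n := (Fintype.card V : ℝ) with hn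
  let f : V → ℝ := fun x => ∑ j ∈ range k, (∑ y ∈ I j, w x y - s / n) ^ 2
  refine ⟨univ.filter fun x => 1 / 400 < k * f x, ?_, fun x hx J hJ => ?_⟩
  · have hks : (k * s : ℝ) ≤ n := by
      have h1 := card_le_univ ((range k).biUnion I)
      rw [card_biUnion fun i _ j _ hij => hdisj i j hij, sum_congr rfl fun j hj =>
        hI j (mem_range.1 hj), sum_const, card_range, smul_eq_mul] at h1
      rw [hn]
      exact_mod_cast h1
    have h2 : ∑ x, f x ≤ k * (θ * s) := by
      rw [sum_comm]
      refine (sum_le_card_nsmul _ _ (θ * s) fun j hj => ?_).trans_eq (by simp)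
      have := hw.sum_sq_le (I j)
      rwa [hI j (mem_range.1 hj)] at this
    have h3 : #(univ.filter fun x => 1 / 400 < k * f x) • (1 / 400 : ℝ) ≤ ∑ x, k * f x := by
      refine (card_nsmul_le_sum _ (fun x => k * f x) _ fun x hx => (mem_filter.1 hx).2.le).trans ?_
      exact sum_le_sum_of_subset_of_nonneg (filter_subset _ _) fun x _ _ =>
        mul_nonneg (by positivity) (sum_nonneg fun _ _ => sq_nonneg _)
    rw [← mul_sum, nsmul_eq_mul] at h3
    have h4 : (k : ℝ) * ∑ x, f x ≤ k * (θ * n) := by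
      refine mul_le_mul_of_nonneg_left (h2.trans ?_) (by positivity)
      nlinarith
    linarith
  · have hx' : k * f x ≤ 1 / 400 := by simpa using hx
    rw [sum_biUnion fun i _ j _ hij => hdisj i j hij]
    have h1 : ∑ j ∈ J, ∑ y ∈ I j, w x y - #J * s / n = ∑ j ∈ J, (∑ y ∈ I j, w x y - s / n) := by
      rw [sum_sub_distrib, sum_const, nsmul_eq_mul, mul_div_assoc]
    have h2 : (∑ j ∈ J, (∑ y ∈ I j, w x y - s / n)) ^ 2 ≤ (1 / 20) ^ 2 := by
      calc _ ≤ #J * ∑ j ∈ J, (∑ y ∈ I j, w x y - s / n) ^ 2 := sq_sum_le_card_mul_sum_sq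
        _ ≤ k * f x := by
          have : #J ≤ k := by simpa using card_le_card hJ
          gcongr
          exact sum_le_sum_of_subset_of_nonneg hJ fun _ _ _ => sq_nonneg _
        _ ≤ _ := by linarith
    have h3 := (abs_le_of_sq_le_sq' h2 (by norm_num)).1
    linarith

end Uniform

section Cycle

variable {V : Type*} [DecidableEq V] {P A A' : List V}

/-- If `A` and `A'` arise by cutting a path that differs from `P` only near a small set `W`, then
about half of the arcs of `P` are intact in `A`. -/
theorem le_card_arcs_mul (hP : P.Nodup) (hA' : A'.Nodup) (hAA' : A.Disjoint A')
    {k s : ℕ} (hk : s * k + 2 ≤ P.length) {W : Finset V}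
    (hW : ∀ a ∉ W, ∀ b, P.Nbr a b → A.Nbr a b ∨ A'.Nbr a b) :
    s * k ≤ #{j ∈ range k | Disjoint (P.arc s j) W ∧ P.arc s j ⊆ A.toFinset} * s + A'.length +
      #W * s := by
  set J := {j ∈ range k | Disjoint (P.arc s j) W ∧ P.arc s j ⊆ A.toFinset}
  set J' := {j ∈ range k | P.arc s j ⊆ A'.toFinset} with hJ'
  set J'' := {j ∈ range k | ¬ Disjoint (P.arc s j) W} with hJ''
  have hcover : range k ⊆ J ∪ J' ∪ J'' := by
    intro j hj
    by_cases hd : Disjoint (P.arc s j) W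
    · have := List.arc_subset_or_subset hAA' hk (mem_range.1 hj) fun a ha b hab =>
        hW a (disjoint_left.1 hd ha) b hab
      grind
    · grind
  have h1 : k ≤ #J + #J' + #J'' := by
    have h := card_le_card hcover
    rw [card_range] at h
    exact h.trans ((card_union_le _ _).trans (Nat.add_le_add_right (card_union_le _ _) _))
  have h2 : #J' * s ≤ A'.length := by
    have hsub : J'.biUnion (P.arc s) ⊆ A'.toFinset := biUnion_subset.2 fun j hj =>
      (mem_filter.1 hj).2
    have h := card_le_card hsub
    rw [card_biUnion fun i _ j _ hij => List.arc_disjoint hP hij, sum_congr rfl fun j hj =>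
      List.card_arc hP (by omega) (mem_range.1 (mem_filter.1 hj).1), sum_const, smul_eq_mul,
      List.toFinset_card_of_nodup hA'] at h
    exact h
  have h3 : #J'' ≤ #W := by
    refine card_le_card_of_forall_subsingleton (fun j x => x ∈ P.arc s j) (fun j hj => ?_)
      fun x _ i hi j hj => ?_
    · obtain ⟨x, hx, hxW⟩ := not_disjoint_iff.1 (mem_filter.1 hj).2
      exact ⟨x, hxW, hx⟩
    · by_contra hij
      exact disjoint_left.1 (List.arc_disjoint hP hij) hi.2 hj.2
  calc s * k ≤ s * (#J + #J' + #J'') := Nat.mul_le_mul_left s h1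
    _ = #J * s + #J' * s + #J'' * s := by ring
    _ ≤ _ := by gcongr

variable [Fintype V] [Nonempty V] {w : V → V → ℝ} {θ : ℝ}

/-- If `A` and `A'` arise by cutting a path that differs from `P` only near a small set `W`, then
the rotations of `A` have linearly many heads. -/
theorem exists_heads_of_half (hw : IsPseudorandom w θ) (hθ : θ < 1 / 1200) (hP : P.Nodup)
    (hA : A.Nodup) (hA' : A'.Nodup) (hAA' : A.Disjoint A') {k s : ℕ} (hk : s * k + 2 ≤ P.length)
    {W B : Finset V} (hW : ∀ a ∉ W, ∀ b, P.Nbr a b → A.Nbr a b ∨ A'.Nbr a b)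
    (hunif : ∀ x ∉ B, ∀ J ⊆ range k,
      (#J * s : ℝ) / Fintype.card V - 1 / 20 ≤ ∑ y ∈ J.biUnion (P.arc s), w x y)
    (hB : ∀ x ∉ B, ∑ y ∈ P.closedNbr B, w x y ≤ 1 / 10) (hhead : ∃ x ∉ B, A.head? = some x)
    (hcard : Fintype.card V + 4 * (A'.length + #W * s) ≤ 4 * (s * k)) :
    ∃ t, Fintype.card V ≤ 60 * #(rotationHeads (fun x y => 0 < w x y) B A t) := by
  have hn : (0 : ℝ) < Fintype.card V := by exact_mod_cast Fintype.card_pos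
  have hJ := le_card_arcs_mul hP hA' hAA' hk hW
  set J := {j ∈ range k | Disjoint (P.arc s j) W ∧ P.arc s j ⊆ A.toFinset} with hJdef
  have hJmem : ∀ y ∈ J.biUnion (P.arc s), ∃ j < k, y ∈ P.arc s j ∧ y ∉ W ∧ y ∈ A := by
    intro y hy
    obtain ⟨j, hj, hyj⟩ := mem_biUnion.1 hy
    simp only [hJdef, mem_filter, mem_range] at hj
    exact ⟨j, hj.1, hyj, disjoint_left.1 hj.2.1 hyj, List.mem_toFinset.1 (hj.2.2 hyj)⟩
  refine exists_card_le_mul_card_rotationHeads (T := J.biUnion (P.arc s) \ P.closedNbr B) hw hθ hA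
    hhead (fun y hy => ?_) (fun y hy z hzy hzB => ?_) (fun x hx => ?_)
  · obtain ⟨j, -, -, -, h⟩ := hJmem y (mem_sdiff.1 hy).1
    exact h
  · obtain ⟨hy, hyB⟩ := mem_sdiff.1 hy
    obtain ⟨j, hj, hyj, hyW, hyA⟩ := hJmem y hy
    obtain ⟨p, q, hpq, hp, hq⟩ := List.exists_nbr_nbr_of_mem_arc hP hk hj hyj
    have hloc : ∀ p, P.Nbr p y → A.Nbr p y := fun p hp =>
      ((hW y hyW p hp.symm).resolve_right fun h => hAA' hyA h.mem_left).symm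
    refine hyB (List.mem_closedNbr.2 (Or.inr ⟨z, hzB, ?_⟩))
    rcases List.Nbr.eq_or_eq hA hpq (hloc p hp) (hloc q hq) hzy with rfl | rfl
    · exact hp
    · exact hq
  · have h1 := hunif x hx J (filter_subset _ _)
    have h2 : ∑ y ∈ J.biUnion (P.arc s), w x y ≤
        ∑ y ∈ J.biUnion (P.arc s) \ P.closedNbr B, w x y + ∑ y ∈ P.closedNbr B, w x y := by
      rw [← sum_inter_add_sum_sdiff _ (P.closedNbr B), add_comm]
      refine add_le_add_right (sum_le_sum_of_subset_of_nonneg inter_subset_right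
        fun y _ _ => hw.nonneg x y) _
    have h3 : (1 / 4 : ℝ) ≤ #J * s / Fintype.card V := by
      rw [le_div_iff₀ hn]
      have h4 : Fintype.card V ≤ 4 * (#J * s) := by omega
      have h5 : (Fintype.card V : ℝ) ≤ 4 * (#J * s) := by exact_mod_cast h4
      linarith
    have h4 := hB x hx
    linarith

end Cycle

section Hamilton

variable {V : Type*} [Fintype V] [Nonempty V] {w : V → V → ℝ} {θ : ℝ}

/-- The support of a sufficiently pseudorandom weight contains a Hamiltonian cycle. -/
theorem IsPseudorandom.exists_hamiltonian (hw : IsPseudorandom w θ) {ℓ : ℕ} (hℓ : 1 ≤ ℓ)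
    (hn : Fintype.card V ≤ 2 ^ ℓ) (hθ : 6000000 * (ℓ * θ) ≤ 1)
    (hn' : 1000 * ℓ ≤ Fintype.card V) :
    ∃ l : List V, l.Nodup ∧ (∀ v, v ∈ l) ∧ l.IsChain (fun x y => 0 < w x y) ∧
      ∀ x ∈ l.head?, ∀ z ∈ l.getLast?, 0 < w z x := by
  classical
  have hr : ∀ x y, 0 < w x y → 0 < w y x := fun x y h => hw.symm x y ▸ h
  have hθ0 := hw.nonneg_of_nonempty
  have hθ' : θ ≤ 1 / 6000000 := by
    have : (1 : ℝ) ≤ ℓ := by exact_mod_cast hℓ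
    nlinarith
  have hnpos : (0 : ℝ) < Fintype.card V := by exact_mod_cast Fintype.card_pos
  obtain ⟨P, hP⟩ := exists_isLongestPath fun x y => 0 < w x y
  have hlen : 99 * Fintype.card V ≤ 100 * P.length := by
    have h1 := card_compl_le hw (by linarith) hP
    have h2 := card_add_card_compl P.toFinset
    rw [List.toFinset_card_of_nodup hP.nodup] at h2
    have h3 : (100 * #P.toFinsetᶜ : ℝ) ≤ Fintype.card V := by nlinarith
    have h4 : 100 * #P.toFinsetᶜ ≤ Fintype.card V := by exact_mod_cast h3
    omega
  set k := 60 * ℓ with hk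
  set s := (P.length - 2) / k with hs
  have hsk : s * k + 2 ≤ P.length := by
    have := Nat.div_mul_le_self (P.length - 2) k
    rw [← hs] at this
    omega
  have hsk' : P.length - 2 < s * k + k := Nat.lt_div_mul_add (by omega)
  obtain ⟨B₀, hB₀, hunif⟩ := exists_uniform (k := k) (s := s) hw
    (fun j hj => List.card_arc hP.nodup (by omega) hj) fun i j => List.arc_disjoint hP.nodup
  have hB₀' : 120 * #B₀ + 60 ≤ Fintype.card V := by
    have h1 : (250 * #B₀ : ℝ) ≤ Fintype.card V := by
      rw [hk] at hB₀
      push_cast at hB₀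
      nlinarith
    have h2 : 250 * #B₀ ≤ Fintype.card V := by exact_mod_cast h1
    omega
  obtain ⟨B, hBB₀, hB, hBP⟩ := exists_core hw (by linarith) hP.nodup hB₀'
  obtain ⟨Q, hQ, hQP, hhead, hlast, D, hD, hDQ⟩ := exists_longestPath_ends_notMem hw (by linarith)
    hP hn (B := B) (by omega)
  obtain ⟨A, A', rfl, hAlen, hAlen'⟩ : ∃ A A', Q = A ++ A' ∧ A.length = P.length / 2 ∧
      A'.length = P.length - P.length / 2 :=
    ⟨Q.take (P.length / 2), Q.drop (P.length / 2), by simp, by simp [hQP.length_eq]; omega,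
      by simp [hQP.length_eq]⟩
  obtain ⟨hA, hA', hAA'⟩ := List.nodup_append'.1 hQ.nodup
  have hAne : A ≠ [] := List.ne_nil_of_length_pos (by omega)
  have hAne' : A' ≠ [] := List.ne_nil_of_length_pos (by omega)
  set W : Finset V := D.biUnion Sym2.toFinset ∪ {A.getLast hAne, A'.head hAne'} with hWdef
  have hWcard : #W ≤ 6 * ℓ := by
    have h2 := card_le_two (a := A.getLast hAne) (b := A'.head hAne')
    have h3 := card_biUnion_le_card_mul D Sym2.toFinset 2 fun e _ => by
      rw [Sym2.card_toFinset]; split_ifs <;> simp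
    exact (card_union_le _ _).trans (by omega)
  have hW : ∀ a ∉ W, ∀ b, P.Nbr a b → A.Nbr a b ∨ A'.Nbr a b := by
    intro a ha b hab
    simp only [hWdef, mem_union, mem_biUnion, Sym2.mem_toFinset, mem_insert, mem_singleton,
      not_or, not_exists, not_and] at ha
    rcases hDQ a b hab with h | h
    · exact absurd (Sym2.mem_mk_left a b) (ha.1 _ h)
    · rw [List.nbr_append] at h
      rcases h with h | h | ⟨h, -⟩ | ⟨-, h⟩
      · exact Or.inl h
      · exact Or.inr h
      · exact absurd (List.getLast_eq_iff_getLast?_eq_some hAne |>.2 h).symm ha.2.1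
      · exact absurd ((List.head_eq_iff_head?_eq_some hAne').2 h).symm ha.2.2
  have hcard : Fintype.card V + 4 * (P.length - P.length / 2 + #W * s) ≤ 4 * (s * k) := by
    have h1 : #W * s ≤ 6 * ℓ * s := Nat.mul_le_mul_right s hWcard
    have h2 : s * k = 10 * (6 * ℓ * s) := by rw [hk]; ring
    omega
  have hunif' : ∀ x ∉ B, ∀ J ⊆ range k, (#J * s : ℝ) / Fintype.card V - 1 / 20 ≤
      ∑ y ∈ J.biUnion (P.arc s), w x y := fun x hx => hunif x fun h => hx (hBB₀ h)
  obtain ⟨t, ht⟩ := exists_heads_of_half hw (by linarith) hP.nodup hA hA' hAA' hsk hW hunif' hBP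
    (by simpa [List.head?_append_of_ne_nil _ hAne] using hhead) (by rw [hAlen']; exact hcard)
  obtain ⟨t', ht'⟩ := exists_heads_of_half (A := A'.reverse) (A' := A) hw (by linarith) hP.nodup
    (List.nodup_reverse.2 hA') hA (by simpa using hAA'.symm) hsk
    (fun a ha b hab => by rw [List.nbr_reverse]; exact (hW a ha b hab).symm) hunif' hBP
    (by simpa [List.getLast?_append_of_ne_nil _ hAne'] using hlast) (by rw [hAlen]; omega)
  obtain ⟨l, hlQ, hl, hcyc⟩ := exists_cycle_of_rotationHeads hw (by linarith) hQ.isChain ht ht'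
  have hl' := hQ.of_perm hlQ hl
  exact ⟨l, hl'.nodup, mem_of_cycle hw (by linarith) hl' hcyc, hl, hcyc⟩

end Hamilton

section LatinSquare

theorem exists_isHamiltonianCycle_of_list {V : Type*} [Fintype V] [DecidableEq V]
    {G : SimpleGraph V} {l : List V} (hl : l.Nodup) (hmem : ∀ v, v ∈ l) (hch : l.IsChain G.Adj)
    (hcyc : ∀ x ∈ l.head?, ∀ z ∈ l.getLast?, G.Adj z x) (hV : 3 ≤ Fintype.card V) :
    ∃ (v : V) (p : G.Walk v v), p.IsHamiltonianCycle := by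
  have hlen : l.length = Fintype.card V := by
    rw [← List.toFinset_card_of_nodup hl, ← card_univ]
    exact congrArg card (eq_univ_iff_forall.2 fun v => List.mem_toFinset.2 (hmem v))
  have hne : l ≠ [] := List.ne_nil_of_length_pos (by omega)
  have hpath : (SimpleGraph.Walk.ofSupport l hne hch).IsPath :=
    .mk' (by rwa [SimpleGraph.Walk.support_ofSupport])
  have hadj : G.Adj (l.getLast hne) (l.head hne) :=
    hcyc _ (List.head_mem_head? hne) _ (List.getLast_mem_getLast? hne)
  refine ⟨_, .cons hadj (SimpleGraph.Walk.ofSupport l hne hch),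
    SimpleGraph.Walk.isCycle_iff_isPath_tail_and_le_length.2 ⟨?_, ?_⟩, ?_⟩
  · simpa using hpath
  · rw [SimpleGraph.Walk.length_cons, SimpleGraph.Walk.length_ofSupport]
    omega
  · have := hpath.isHamiltonian_of_mem (by simpa [SimpleGraph.Walk.support_ofSupport] using hmem)
    intro v
    simpa using this v

/-- A proper edge colouring of a complete graph with few colours extends to a symmetric Latin
square. -/
theorem IsProperEdgeColoring.exists_latinSquare {n : ℕ} {c : Sym2 (Fin n) → ℕ}
    (hc : IsProperEdgeColoring c) (hcard : #((⊤ : SimpleGraph (Fin n)).edgeFinset.image c) ≤ n) :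
    ∃ (F : Finset ℕ) (L : Fin n → Fin n → F), (∀ x y, L x y = L y x) ∧
      (∀ x, Function.Bijective (L x)) ∧ ∀ x y, x ≠ y → (L x y : ℕ) = c s(x, y) := by
  obtain ⟨F, hF, hFn⟩ := Infinite.exists_superset_card_eq _ n hcard
  have hmem : ∀ x y, x ≠ y → c s(x, y) ∈ F := fun x y hxy =>
    hF (mem_image_of_mem c (by simpa using hxy))
  have hinj : ∀ x y z, x ≠ y → x ≠ z → c s(x, y) = c s(x, z) → y = z := by
    intro x y z hxy hxz h
    by_contra hyz
    exact hc s(x, y) s(x, z) (by simpa using hxy) (by simpa using hxz)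
      (by simpa [Sym2.eq_iff, hyz] using fun h => absurd h hxz) ⟨x, by simp, by simp⟩ h
  have hmiss : ∀ x : Fin n, ∃ q ∈ F, q ∉ (univ.erase x).image fun y => c s(x, y) := by
    intro x
    refine exists_mem_notMem_of_card_lt_card (card_image_le.trans_lt ?_)
    rw [card_erase_of_mem (mem_univ x), card_univ, Fintype.card_fin, hFn]
    have := x.pos
    omega
  choose m hmF hm using hmiss
  have hm' : ∀ x y, x ≠ y → c s(x, y) ≠ m x := fun x y hxy h =>
    hm x (mem_image.2 ⟨y, mem_erase.2 ⟨hxy.symm, mem_univ y⟩, h⟩)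
  let L : Fin n → Fin n → F := fun x y =>
    if h : x = y then ⟨m x, hmF x⟩ else ⟨c s(x, y), hmem x y h⟩
  have hdiag : ∀ x, (L x x : ℕ) = m x := fun x => by simp [L]
  have hoff : ∀ x y, x ≠ y → (L x y : ℕ) = c s(x, y) := fun x y h => by simp [L, h]
  refine ⟨F, L, fun x y => ?_, fun x => ?_, hoff⟩
  · rcases eq_or_ne x y with rfl | h
    · rfl
    · rw [← Subtype.coe_inj, hoff x y h, hoff y x h.symm, Sym2.eq_swap]
  · refine (Fintype.bijective_iff_injective_and_card _).2 ⟨fun y z hyz => ?_, by simp [hFn]⟩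
    rw [← Subtype.coe_inj] at hyz
    rcases eq_or_ne x y with rfl | hy <;> rcases eq_or_ne x z with rfl | hz
    · rfl
    · rw [hdiag, hoff x z hz] at hyz
      exact absurd hyz.symm (hm' x z hz)
    · rw [hdiag, hoff x y hy] at hyz
      exact absurd hyz (hm' x y hy)
    · rw [hoff x y hy, hoff x z hz] at hyz
      exact hinj x y z hy hz hyz

/-- Every symmetric Latin square of order `n` has a Hamiltonian cycle that uses few symbols. -/
theorem exists_isHamiltonianCycle_card_le {V Q : Type*} [Fintype V] [DecidableEq V] [Fintype Q]
    [DecidableEq Q] {L : V → V → Q} (hsymm : ∀ x y, L x y = L y x)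
    (hbij : ∀ x, Function.Bijective (L x)) {ℓ : ℕ} (hℓ : 2 ≤ ℓ) (hV : Fintype.card V ≤ 2 ^ ℓ)
    (hV' : 1000 * ℓ ≤ Fintype.card V) :
    ∃ S : Finset Q, #S ≤ 48000000 * ℓ ^ 3 ∧ ∃ (v : V) (p : (⊤ : SimpleGraph V).Walk v v),
      p.IsHamiltonianCycle ∧ ∀ x y, s(x, y) ∈ p.edges → L x y ∈ S := by
  have : Nonempty V := Fintype.card_pos_iff.1 (by omega)
  have hℓ' : (0 : ℝ) < ℓ := by exact_mod_cast (by omega : 0 < ℓ)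
  set K := 48000000 * ℓ ^ 3 with hK
  have hK0 : 0 < K := by positivity
  set j := Nat.clog 2 ℓ with hj
  have hj₁ : ℓ ≤ 2 ^ j := Nat.le_pow_clog one_lt_two ℓ
  have hj₂ : 2 ^ j ≤ 2 * ℓ := by
    have h1 := Nat.pow_pred_clog_lt_self one_lt_two hℓ
    have h2 : 0 < Nat.clog 2 ℓ := Nat.clog_pos one_lt_two hℓ
    rw [hj, ← Nat.succ_pred_eq_of_pos h2, pow_succ]
    omega
  have hKr : (K : ℝ) = 48000000 * ℓ ^ 3 := by rw [hK]; push_cast; ring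
  set θ : ℝ := 8 * ℓ ^ 2 / K with hθ
  have hθK : θ * K ^ 2 = 8 * ℓ ^ 2 * K := by
    rw [hθ]
    have : (K : ℝ) ≠ 0 := by positivity
    field_simp
  obtain ⟨col, hcol⟩ := exists_isPseudorandom_sampleWeight (θ := θ) (j := j) L hsymm hbij hK0
    (by positivity) (by
      rw [hθK]
      have h1 : (Fintype.card V : ℝ) ≤ 2 ^ 2 ^ j := by
        exact_mod_cast hV.trans (Nat.pow_le_pow_right two_pos hj₁)
      have h2 : ((2 ^ j : ℕ) : ℝ) ≤ 2 * ℓ := by exact_mod_cast hj₂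
      calc _ ≤ (2 : ℝ) ^ 2 ^ j * (K ^ 2 ^ j * (2 * ℓ) ^ (2 ^ j + 2 ^ j)) := by gcongr
        _ = (8 * ℓ ^ 2 * K) ^ 2 ^ j := by
          rw [pow_add, ← mul_pow, ← mul_pow, ← mul_pow]
          congr 1
          ring)
  obtain ⟨l, hl, hmem, hch, hcyc⟩ := hcol.exists_hamiltonian (by omega) hV (by
    rw [hθ, hKr]
    apply le_of_eq
    field_simp
    norm_num) hV'
  have hpos : ∀ x y, 0 < sampleWeight L col x y → L x y ∈ univ.image col := by
    intro x y h
    by_contra hno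
    have : #{i | col i = L x y} = 0 := by simpa [filter_eq_empty_iff] using hno
    simp [sampleWeight, this] at h
  let G : SimpleGraph V :=
    { Adj := fun x y => x ≠ y ∧ 0 < sampleWeight L col x y
      symm := ⟨fun x y h => ⟨h.1.symm, hcol.symm x y ▸ h.2⟩⟩
      loopless := ⟨fun x h => h.1 rfl⟩ }
  have hchG : l.IsChain G.Adj := by
    have hne := List.isChain_iff_getElem.1 (List.Pairwise.isChain hl)
    rw [List.isChain_iff_getElem] at hch ⊢
    exact fun i hi => ⟨hne i hi, hch i hi⟩
  obtain ⟨v, p, hp⟩ := exists_isHamiltonianCycle_of_list (G := G) hl hmem hchG (fun x hx z hz => by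
    refine ⟨?_, hcyc x hx z hz⟩
    rintro rfl
    cases l with
    | nil => simp at hx
    | cons a t =>
      cases t with
      | nil =>
        have : #(univ : Finset V) ≤ 1 := card_le_one.2 fun b _ d _ => by
          rw [List.mem_singleton.1 (hmem b), List.mem_singleton.1 (hmem d)]
        rw [card_univ] at this
        omega
      | cons b t =>
        rw [List.getLast?_cons_cons] at hz
        have : a = z := by simpa using hx
        exact (List.nodup_cons.1 hl).1 (this ▸ List.mem_of_getLast? hz)) (by omega)
  refine ⟨univ.image col, card_image_le.trans (by simp), v, p.map (.ofLE le_top),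
    hp.map Function.bijective_id, fun x y hxy => hpos x y ?_⟩
  rw [SimpleGraph.Walk.edges_map] at hxy
  have : s(x, y) ∈ p.edges := by simpa using hxy
  exact (p.adj_of_mem_edges this).2

end LatinSquare

end HamiltonianCycle

/-- Every proper edge colouring of `K_n` with at most `χ'(K_n)` colours
(`n - 1` for even `n`, `n` for odd `n`) has a Hamilton cycle with at most
`C · (log n)^3` colours, for `n` large enough. -/
theorem statement0 :
    ∃ C : ℝ, 0 < C ∧ ∃ N : ℕ, ∀ n : ℕ, N ≤ n →
      ∀ c : Sym2 (Fin n) → ℕ,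
        IsProperEdgeColoring c →
        ((((⊤ : SimpleGraph (Fin n)).edgeFinset).image c).card ≤
          if Even n then n - 1 else n) →
        ∃ (v : Fin n) (p : (⊤ : SimpleGraph (Fin n)).Walk v v),
          p.IsHamiltonianCycle ∧
          (((p.edges.map c).toFinset.card : ℝ) ≤ C * Real.log n ^ 3) := by
  refine ⟨48000000 * 27, by norm_num, 2 ^ 15, fun n hn c hc hcard => ?_⟩
  obtain ⟨F, L, hsymm, hbij, hL⟩ := hc.exists_latinSquare (hcard.trans (by split_ifs <;> omega))
  set ℓ := Nat.clog 2 n with hℓdef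
  have hnℓ : n ≤ 2 ^ ℓ := Nat.le_pow_clog one_lt_two n
  have hℓ : 15 ≤ ℓ := (Nat.pow_le_pow_iff_right one_lt_two).1 (hn.trans hnℓ)
  have hℓn : 2 ^ (ℓ - 1) < n := Nat.pow_pred_clog_lt_self one_lt_two (by omega)
  have h1000 : ∀ i, 14 ≤ i → 1000 * (i + 1) ≤ 2 ^ i := by
    intro i hi
    induction i, hi using Nat.le_induction with
    | base => norm_num
    | succ i hi ih => rw [pow_succ]; omega
  have hℓn' : 1000 * ℓ ≤ n := by
    have := h1000 (ℓ - 1) (by omega)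
    rw [Nat.sub_add_cancel (by omega)] at this
    omega
  obtain ⟨S, hS, v, p, hp, hpS⟩ := exists_isHamiltonianCycle_card_le hsymm hbij (ℓ := ℓ)
    (by omega) (by simpa using hnℓ) (by simpa using hℓn')
  refine ⟨v, p, hp, ?_⟩
  have hsub : (p.edges.map c).toFinset ⊆ S.image (↑) := by
    intro q hq
    obtain ⟨e, he, rfl⟩ := List.mem_map.1 (List.mem_toFinset.1 hq)
    induction e with
    | _ x y => exact Finset.mem_image.2 ⟨L x y, hpS x y he, hL x y (p.adj_of_mem_edges he).ne⟩
  have hlog : (ℓ : ℝ) ≤ 3 * Real.log n := by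
    have h1 : (ℓ - 1 : ℝ) * Real.log 2 ≤ Real.log n := by
      have h2 : ((2 : ℝ) ^ (ℓ - 1)) ≤ n := by exact_mod_cast hℓn.le
      have h3 := Real.log_le_log (by positivity) h2
      rwa [Real.log_pow, Nat.cast_sub (by omega), Nat.cast_one] at h3
    have h4 : (15 : ℝ) ≤ ℓ := by exact_mod_cast hℓ
    nlinarith [Real.log_two_gt_d9]
  have hcardS : ((p.edges.map c).toFinset.card : ℝ) ≤ 48000000 * ℓ ^ 3 := by
    exact_mod_cast (Finset.card_le_card hsub).trans (Finset.card_image_le.trans hS)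
  calc _ ≤ 48000000 * (ℓ : ℝ) ^ 3 := hcardS
    _ ≤ 48000000 * (3 * Real.log n) ^ 3 := by gcongr
    _ = _ := by ring
end

section
/- There exists N such that for every even n ≥ N, every proper edge colouring of the complete graph K_n on n vertices using at most n - 1 colours contains a Hamiltonian cycle whose edges use at most (log n)^3 distinct colours. -/
namespace HamiltonFewColours

open Finset

section Lists

variable {V : Type*}

theorem pair_infix_append {a b : V} {l₁ l₂ : List V} (h : [a, b] <:+: l₁ ++ l₂) :
    [a, b] <:+: l₁ ∨ [a, b] <:+: l₂ ∨ (l₁.getLast? = some a ∧ l₂.head? = some b) := by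
  rcases List.infix_append_iff_ne_nil.1 h with h | h | ⟨p, q, hp, hq, hpq, ⟨s, hs⟩, ⟨t, ht⟩⟩
  · exact Or.inl h
  · exact Or.inr (Or.inl h)
  · right; right
    rcases p with _ | ⟨p0, _ | ⟨p1, p⟩⟩
    · exact absurd rfl hp
    · simp only [List.cons_append, List.nil_append, List.cons.injEq] at hpq
      obtain ⟨rfl, rfl⟩ := hpq
      subst hs ht
      simp
    · simp only [List.cons_append, List.cons.injEq] at hpq
      obtain ⟨-, -, h⟩ := hpq
      simp at h
      exact absurd h.2 hq

theorem infix_append_cons_of_notMem {B l₁ l₂ : List V} {y : V} (h : B <:+: l₁ ++ y :: l₂)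
    (hy : y ∉ B) : B <:+: l₁ ∨ B <:+: l₂ := by
  rcases List.infix_append_iff_ne_nil.1 h with h | h | ⟨p, q, hp, hq, rfl, -, ⟨t, ht⟩⟩
  · exact Or.inl h
  · rcases List.infix_cons_iff.1 h with ⟨t, ht⟩ | h
    · rcases B with _ | ⟨b, B⟩
      · exact Or.inl (List.nil_infix)
      · simp only [List.cons_append, List.cons.injEq] at ht
        exact absurd (ht.1 ▸ List.mem_cons_self) hy
    · exact Or.inr h
  · rcases q with _ | ⟨b, q⟩
    · exact absurd rfl hq
    · simp only [List.cons_append, List.cons.injEq] at ht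
      exact absurd (by simp [ht.1]) hy

theorem infix_append_of_disjoint {B C s t : List V} (h : B <:+: s ++ C ++ t)
    (hC : C ≠ []) (hBC : B.Disjoint C) : B <:+: s ∨ B <:+: t := by
  induction C generalizing s with
  | nil => exact absurd rfl hC
  | cons y C ih =>
    have hy : y ∉ B := fun hy => hBC hy List.mem_cons_self
    have h' : B <:+: s ++ y :: (C ++ t) := by simpa using h
    rcases infix_append_cons_of_notMem h' hy with h | h
    · exact Or.inl h
    · rcases C with _ | ⟨z, C⟩
      · exact Or.inr (by simpa using h)
      · rcases ih (s := []) (by simpa using h) (by simp)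
          (fun x hx hx' => hBC hx (List.mem_cons_of_mem _ hx')) with h | h
        · rw [List.infix_nil.1 h]
          exact Or.inl List.nil_infix
        · exact Or.inr h

/-- Two disjoint nonempty contiguous blocks of a list appear in one of the two orders. -/
theorem exists_order_of_infix {B C l : List V} (hB : B <:+: l) (hC : C <:+: l) (hne : C ≠ [])
    (hBC : B.Disjoint C) :
    (∃ X Y Z, l = X ++ B ++ Y ++ C ++ Z) ∨ (∃ X Y Z, l = X ++ C ++ Y ++ B ++ Z) := by
  obtain ⟨s, t, rfl⟩ := hC
  rcases infix_append_of_disjoint hB hne hBC with ⟨X, Y, rfl⟩ | ⟨X, Y, rfl⟩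
  · exact Or.inl ⟨X, Y, t, rfl⟩
  · exact Or.inr ⟨s, X, Y, by simp⟩

theorem eq_getLast?_of_pair_infix {a y : V} {l₁ l₂ : List V} (hn : (l₁ ++ y :: l₂).Nodup)
    (h : [a, y] <:+: l₁ ++ y :: l₂) : l₁.getLast? = some a := by
  have hn' := List.nodup_append'.1 hn
  have h1 : y ∉ l₁ := fun hy => hn'.2.2 hy List.mem_cons_self
  have h2 : y ∉ l₂ := (List.nodup_cons.1 hn'.2.1).1
  rcases pair_infix_append h with h | h | h
  · exact absurd (h.subset (by simp)) h1
  · rcases pair_infix_append (l₁ := [y]) (by simpa using h) with h | h | h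
    · simpa using h.length_le
    · exact absurd (h.subset (by simp)) h2
    · obtain ⟨-, h⟩ := h
      exact absurd (List.mem_of_mem_head? h) h2
  · exact h.1

theorem eq_head?_of_pair_infix {a y : V} {l₁ l₂ : List V} (hn : (l₁ ++ y :: l₂).Nodup)
    (h : [y, a] <:+: l₁ ++ y :: l₂) : l₂.head? = some a := by
  have := eq_getLast?_of_pair_infix (a := a) (y := y) (l₁ := l₂.reverse) (l₂ := l₁.reverse)
    (by simpa using (List.nodup_reverse.2 hn))
    (by simpa using h.reverse)
  simpa using this

theorem pred_unique {a a' y : V} {l : List V} (hn : l.Nodup) (h : [a, y] <:+: l)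
    (h' : [a', y] <:+: l) : a = a' := by
  obtain ⟨s, t, hst⟩ := h
  have hl : l = (s ++ [a]) ++ y :: t := by simp [← hst]
  rw [hl] at hn h'
  simpa using eq_getLast?_of_pair_infix hn h'

theorem succ_unique {a a' y : V} {l : List V} (hn : l.Nodup) (h : [y, a] <:+: l)
    (h' : [y, a'] <:+: l) : a = a' := by
  refine pred_unique (y := y) (l := l.reverse) (List.nodup_reverse.2 hn) ?_ ?_
  · simpa using h.reverse
  · simpa using h'.reverse

end Lists

section Rotation

variable {V : Type*} (G : SimpleGraph V) (Y : Finset V)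

/-- `l'` arises from the path `l` by a rotation of its head with pivot in `Y`. -/
def Rotates (l l' : List V) : Prop :=
  ∃ l₁ y l₂, y ∈ Y ∧ (∃ a, l₁.head? = some a ∧ G.Adj a y) ∧
    l = l₁ ++ y :: l₂ ∧ l' = l₁.reverse ++ y :: l₂

/-- `RotReach G Y P t l`: the path `l` arises from `P` by at most `t` rotations
of the head with pivots in `Y`. -/
inductive RotReach (P : List V) : ℕ → List V → Prop
  | refl : RotReach P 0 P
  | keep {t : ℕ} {l : List V} : RotReach P t l → RotReach P (t + 1) l
  | rotate {t : ℕ} {l l' : List V} : RotReach P t l → Rotates G Y l l' → RotReach P (t + 1) l'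

variable {G Y} {P : List V}

theorem Rotates.perm {l l' : List V} (h : Rotates G Y l l') : l'.Perm l := by
  obtain ⟨l₁, y, l₂, -, -, rfl, rfl⟩ := h
  exact (List.reverse_perm l₁).append_right _

theorem Rotates.getLast? {l l' : List V} (h : Rotates G Y l l') :
    l'.getLast? = l.getLast? := by
  obtain ⟨l₁, y, l₂, -, -, rfl, rfl⟩ := h
  simp [List.getLast?_append, List.getLast?_cons]

theorem isChain_adj_reverse {l : List V} : l.reverse.IsChain G.Adj ↔ l.IsChain G.Adj := by
  rw [List.isChain_reverse]
  simp only [G.adj_comm]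

theorem Rotates.isChain {l l' : List V} (h : Rotates G Y l l') (hl : l.IsChain G.Adj) :
    l'.IsChain G.Adj := by
  obtain ⟨l₁, y, l₂, -, ⟨a, ha, hay⟩, rfl, rfl⟩ := h
  rw [List.isChain_append] at hl ⊢
  refine ⟨isChain_adj_reverse.2 hl.1, hl.2.1, ?_⟩
  intro x hx z hz
  simp only [List.getLast?_reverse, ha, List.head?_cons, Option.mem_def,
    Option.some.injEq] at hx hz
  rwa [← hx, ← hz]

namespace RotReach

variable {t : ℕ} {l : List V}

theorem perm (h : RotReach G Y P t l) : l.Perm P := by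
  induction h with
  | refl => rfl
  | keep _ ih => exact ih
  | rotate _ h ih => exact h.perm.trans ih

theorem getLast? (h : RotReach G Y P t l) : l.getLast? = P.getLast? := by
  induction h with
  | refl => rfl
  | keep _ ih => exact ih
  | rotate _ h ih => exact h.getLast?.trans ih

theorem isChain (h : RotReach G Y P t l) (hP : P.IsChain G.Adj) : l.IsChain G.Adj := by
  induction h with
  | refl => exact hP
  | keep _ ih => exact ih
  | rotate _ h ih => exact h.isChain ih

end RotReach

/-- A block survives in a list if it or its reversal is contiguous there. -/
def Survives (B l : List V) : Prop := B <:+: l ∨ B.reverse <:+: l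

theorem survives_reverse {B l : List V} : Survives B l.reverse ↔ Survives B l := by
  unfold Survives
  rw [← List.reverse_infix (l₁ := B.reverse), List.reverse_reverse, List.reverse_reverse,
    ← List.reverse_infix (l₁ := B), List.reverse_reverse, or_comm]

theorem Survives.rotate {B l₁ l₂ : List V} {y : V} (h : Survives B (l₁ ++ y :: l₂))
    (hy : y ∉ B) : Survives B (l₁.reverse ++ y :: l₂) := by
  have key : ∀ C : List V, y ∉ C → C <:+: l₁ ++ y :: l₂ →
      Survives C (l₁.reverse ++ y :: l₂) := by
    intro C hC h
    rcases infix_append_cons_of_notMem h hC with h | h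
    · exact Or.inr (h.reverse.trans List.infix_append_left)
    · exact Or.inl (h.trans ((List.suffix_cons y l₂).isInfix.trans List.infix_append_right))
  rcases h with h | h
  · exact key B hy h
  · have := key B.reverse (by simpa using hy) h
    rcases this with h | h
    · exact Or.inr h
    · exact Or.inl (by simpa using h)

open Classical in
theorem RotReach.card_not_survives {ι : Type*} [Fintype ι] {B : ι → List V}
    (hB : Pairwise fun i j => (B i).Disjoint (B j)) {t : ℕ} {l : List V}
    (h : RotReach G Y P t l) :
    #{i | ¬ Survives (B i) l} ≤ #{i | ¬ Survives (B i) P} + t := by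
  induction h with
  | refl => simp
  | keep _ ih => omega
  | @rotate t l l' _ h ih =>
    obtain ⟨l₁, y, l₂, -, -, rfl, rfl⟩ := h
    have hsub : ({i | ¬ Survives (B i) (l₁.reverse ++ y :: l₂)} : Finset ι) ⊆
        ({i | ¬ Survives (B i) (l₁ ++ y :: l₂)} : Finset ι) ∪ ({i | y ∈ B i} : Finset ι) := by
      intro i hi
      simp only [mem_filter_univ, mem_union] at hi ⊢
      by_contra! hcon
      exact hi (hcon.1.rotate hcon.2)
    have hone : #{i | y ∈ B i} ≤ 1 := by
      rw [Finset.card_le_one]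
      intro i hi j hj
      simp only [mem_filter_univ] at hi hj
      by_contra hij
      exact hB hij hi hj
    have := (card_le_card hsub).trans (card_union_le _ _)
    omega

open Classical in
/-- The heads of the paths reachable by at most `t` rotations. -/
noncomputable def heads [Fintype V] (G : SimpleGraph V) (Y : Finset V) (P : List V) (t : ℕ) :
    Finset V :=
  {x | ∃ l, RotReach G Y P t l ∧ l.head? = some x}

variable [Fintype V]

theorem mem_heads {t : ℕ} {x : V} :
    x ∈ heads G Y P t ↔ ∃ l, RotReach G Y P t l ∧ l.head? = some x := by
  simp [heads]

theorem heads_subset_succ (t : ℕ) : heads G Y P t ⊆ heads G Y P (t + 1) := by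
  intro x hx
  obtain ⟨l, hl, hx⟩ := mem_heads.1 hx
  exact mem_heads.2 ⟨l, hl.keep, hx⟩

/-- Edges of `P` between vertices that never were heads are still present. -/
theorem RotReach.pair_infix {t : ℕ} {l : List V} (h : RotReach G Y P t l) {a b : V}
    (hab : [a, b] <:+: P) (ha : a ∉ heads G Y P t) (hb : b ∉ heads G Y P t) :
    [a, b] <:+: l ∨ [b, a] <:+: l := by
  induction h with
  | refl => exact Or.inl hab
  | @keep t l _ ih =>
    exact ih (fun h => ha (heads_subset_succ _ h)) (fun h => hb (heads_subset_succ _ h))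
  | @rotate t l l' hl h ih =>
    have h' := ih (fun h => ha (heads_subset_succ _ h)) (fun h => hb (heads_subset_succ _ h))
    have hr := hl.rotate h
    obtain ⟨l₁, y, l₂, -, -, rfl, rfl⟩ := h
    have key : ∀ c d : V, c ∉ heads G Y P (t + 1) → [c, d] <:+: l₁ ++ y :: l₂ →
        [c, d] <:+: l₁.reverse ++ y :: l₂ ∨ [d, c] <:+: l₁.reverse ++ y :: l₂ := by
      intro c d hc h
      rcases pair_infix_append h with h | h | h
      · exact Or.inr ((by simpa using h.reverse : [d, c] <:+: l₁.reverse).trans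
          List.infix_append_left)
      · exact Or.inl (h.trans List.infix_append_right)
      · refine absurd (mem_heads.2 ⟨_, hr, ?_⟩) hc
        simp [List.head?_append, h.1]
    rcases h' with hinf | hinf
    · exact key a b ha hinf
    · exact (key b a hb hinf).symm

/-- **Pósa's lemma**: a neighbour of a reachable head that is a legal pivot is, up to a shift
along `P`, again a reachable head. -/
theorem exists_mem_heads_succ (hP : P.Nodup) {t : ℕ} {x a b y : V} (hx : x ∈ heads G Y P t)
    (hxy : G.Adj x y) (hy : y ∈ Y) (hay : [a, y, b] <:+: P) :
    a ∈ heads G Y P (t + 1) ∨ y ∈ heads G Y P (t + 1) ∨ b ∈ heads G Y P (t + 1) := by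
  by_contra! hcon
  obtain ⟨ha, hy', hb⟩ := hcon
  have ha' := fun h => ha (heads_subset_succ _ h)
  have hy'' := fun h => hy' (heads_subset_succ _ h)
  have hb' := fun h => hb (heads_subset_succ _ h)
  obtain ⟨l, hl, hlx⟩ := mem_heads.1 hx
  have h1 : [a, y] <:+: P := List.IsInfix.trans ⟨[], [b], by simp⟩ hay
  have h2 : [y, b] <:+: P := List.IsInfix.trans ⟨[a], [], by simp⟩ hay
  have hab : a ≠ b := by
    have := hay.sublist.nodup hP
    simp at this
    tauto
  have hyl : y ∈ l := hl.perm.mem_iff.2 (hay.subset (by simp))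
  have hln : l.Nodup := hl.perm.nodup_iff.2 hP
  obtain ⟨l₁, l₂, rfl⟩ := List.append_of_mem hyl
  rcases l₁ with _ | ⟨c, l₁⟩
  · simp only [List.nil_append, List.head?_cons, Option.some.injEq] at hlx
    exact G.loopless.irrefl _ (hlx ▸ hxy)
  have hr : RotReach G Y P (t + 1) ((c :: l₁).reverse ++ y :: l₂) :=
    hl.rotate ⟨c :: l₁, y, l₂, hy, ⟨x, by simpa using hlx, hxy⟩, rfl, rfl⟩
  obtain ⟨z, hz⟩ : ∃ z, (c :: l₁).getLast? = some z := by
    simp [List.getLast?_cons]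
  have hzh : z ∈ heads G Y P (t + 1) :=
    mem_heads.2 ⟨_, hr, by rw [List.head?_append, List.head?_reverse, hz]; rfl⟩
  have hza : a ≠ z := fun h => ha (h ▸ hzh)
  have hzb : b ≠ z := fun h => hb (h ▸ hzh)
  have haN : l₂.head? = some a := by
    rcases hl.pair_infix h1 ha' hy'' with h | h
    · rw [eq_getLast?_of_pair_infix hln h] at hz
      exact absurd (Option.some.inj hz) hza
    · exact eq_head?_of_pair_infix hln h
  have hbN : l₂.head? = some b := by
    rcases hl.pair_infix h2 hy'' hb' with h | h
    · exact eq_head?_of_pair_infix hln h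
    · rw [eq_getLast?_of_pair_infix hln h] at hz
      exact absurd (Option.some.inj hz) hzb
  rw [haN] at hbN
  exact hab (Option.some.inj hbN)

theorem card_le_of_unique {α : Type*} [DecidableEq α] {r : α → α → Prop} {N R : Finset α}
    (hr : ∀ z y y', r z y → r z y' → y = y') (h : ∀ y ∈ N, ∃ z ∈ R, r z y) : #N ≤ #R := by
  choose! f hf using h
  exact card_le_card_of_injOn f (fun y hy => (hf y hy).1)
    (fun y hy y' hy' he => hr (f y) y y' (hf y hy).2 (he ▸ (hf y' hy').2))

/-- The set of vertices with a neighbour in `S`. -/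
noncomputable def nbrs (G : SimpleGraph V) (S : Finset V) : Finset V :=
  open Classical in {y | ∃ x ∈ S, G.Adj x y}

theorem mem_nbrs {S : Finset V} {y : V} : y ∈ nbrs G S ↔ ∃ x ∈ S, G.Adj x y := by
  simp [nbrs]

@[simp]
theorem nbrs_empty : nbrs G ∅ = ∅ := by
  simp [nbrs]

theorem nbrs_mono {S T : Finset V} (h : S ⊆ T) : nbrs G S ⊆ nbrs G T := by
  intro y hy
  obtain ⟨x, hx, hxy⟩ := mem_nbrs.1 hy
  exact mem_nbrs.2 ⟨x, h hx, hxy⟩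

theorem card_pivots_le [DecidableEq V] (hP : P.Nodup) (Z : Finset V)
    (hY : ∀ y ∈ Y, ∃ a b, [a, y, b] <:+: P ∧ a ∈ Z ∧ y ∈ Z ∧ b ∈ Z) (t : ℕ) :
    #(nbrs G (heads G Y P t) ∩ Y) ≤ 3 * #(heads G Y P (t + 1) ∩ Z) := by
  classical
  set R := heads G Y P (t + 1) ∩ Z with hR
  have hsub : nbrs G (heads G Y P t) ∩ Y ⊆
      R ∪ ({y | ∃ z ∈ R, [z, y] <:+: P} : Finset V) ∪
        ({y | ∃ z ∈ R, [y, z] <:+: P} : Finset V) := by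
    intro y hy
    obtain ⟨⟨x, hx, hxy⟩, hyY⟩ := (mem_inter.1 hy).imp_left mem_nbrs.1
    obtain ⟨a, b, hab, ha, hyZ, hb⟩ := hY y hyY
    simp only [mem_union, mem_filter_univ, hR, mem_inter]
    rcases exists_mem_heads_succ hP hx hxy hyY hab with h | h | h
    · exact Or.inl (Or.inr ⟨a, ⟨h, ha⟩, List.IsInfix.trans ⟨[], [b], by simp⟩ hab⟩)
    · exact Or.inl (Or.inl ⟨h, hyZ⟩)
    · exact Or.inr ⟨b, ⟨h, hb⟩, List.IsInfix.trans ⟨[a], [], by simp⟩ hab⟩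
  have h1 : #({y | ∃ z ∈ R, [z, y] <:+: P} : Finset V) ≤ #R :=
    card_le_of_unique (r := fun z y => [z, y] <:+: P)
      (fun z y y' h h' => succ_unique hP h h') (by simp)
  have h2 : #({y | ∃ z ∈ R, [y, z] <:+: P} : Finset V) ≤ #R :=
    card_le_of_unique (r := fun z y => [y, z] <:+: P)
      (fun z y y' h h' => pred_unique hP h h') (by simp)
  have h3 := card_le_card hsub
  have h4 := card_union_le (R ∪ ({y | ∃ z ∈ R, [z, y] <:+: P} : Finset V))
    ({y | ∃ z ∈ R, [y, z] <:+: P} : Finset V)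
  have h5 := card_union_le R ({y | ∃ z ∈ R, [z, y] <:+: P} : Finset V)
  omega

end Rotation

theorem exists_triple_infix {V : Type*} {C : List V} {y : V} (hy : y ∈ C) :
    C.head? = some y ∨ C.getLast? = some y ∨ ∃ a b, [a, y, b] <:+: C := by
  obtain ⟨l₁, l₂, rfl⟩ := List.append_of_mem hy
  rcases l₂ with _ | ⟨b, l₂⟩
  · exact Or.inr (Or.inl (by simp))
  rcases List.eq_nil_or_concat l₁ with rfl | ⟨l₁, a, rfl⟩
  · exact Or.inl (by simp)
  · exact Or.inr (Or.inr ⟨a, b, l₁, l₂, by simp⟩)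

section Core

variable {V : Type*} [Fintype V] [DecidableEq V] {G : SimpleGraph V}

/-- The vertices of `Z` whose two neighbours along the list `C` exist and lie in `Z`. -/
noncomputable def interior (C : List V) (Z : Finset V) : Finset V :=
  open Classical in {y ∈ Z | ∃ a b, [a, y, b] <:+: C ∧ a ∈ Z ∧ b ∈ Z}

theorem mem_interior {C : List V} {Z : Finset V} {y : V} :
    y ∈ interior C Z ↔ y ∈ Z ∧ ∃ a b, [a, y, b] <:+: C ∧ a ∈ Z ∧ b ∈ Z := by
  simp [interior]

theorem interior_mono (C : List V) {Z Z' : Finset V} (h : Z ⊆ Z') :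
    interior C Z ⊆ interior C Z' := by
  intro y hy
  obtain ⟨hy, a, b, hab, ha, hb⟩ := mem_interior.1 hy
  exact mem_interior.2 ⟨h hy, a, b, hab, h ha, h hb⟩

theorem length_le_card_interior {C : List V} (hC : C.Nodup) (U : Finset V) :
    C.length ≤ #(interior C (C.toFinset \ U)) + 3 * #U + 2 := by
  classical
  have hsub : C.toFinset ⊆ (((interior C (C.toFinset \ U) ∪ U) ∪
      ({y | ∃ z ∈ U, [z, y] <:+: C} : Finset V)) ∪
      ({y | ∃ z ∈ U, [y, z] <:+: C} : Finset V)) ∪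
      (C.head?.toFinset ∪ C.getLast?.toFinset) := by
    intro y hy
    simp only [mem_union, mem_interior, mem_filter_univ, Option.mem_toFinset, Option.mem_def]
    rcases exists_triple_infix (List.mem_toFinset.1 hy) with h | h | ⟨a, b, h⟩
    · exact Or.inr (Or.inl h)
    · exact Or.inr (Or.inr h)
    left
    have h1 : [a, y] <:+: C := List.IsInfix.trans ⟨[], [b], by simp⟩ h
    have h2 : [y, b] <:+: C := List.IsInfix.trans ⟨[a], [], by simp⟩ h
    by_cases hyU : y ∈ U
    · exact Or.inl (Or.inl (Or.inr hyU))
    by_cases haU : a ∈ U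
    · exact Or.inl (Or.inr ⟨a, haU, h1⟩)
    by_cases hbU : b ∈ U
    · exact Or.inr ⟨b, hbU, h2⟩
    refine Or.inl (Or.inl (Or.inl ⟨mem_sdiff.2 ⟨hy, hyU⟩, a, b, h, ?_, ?_⟩))
    · exact mem_sdiff.2 ⟨List.mem_toFinset.2 (h.subset (by simp)), haU⟩
    · exact mem_sdiff.2 ⟨List.mem_toFinset.2 (h.subset (by simp)), hbU⟩
  have h1 : #({y | ∃ z ∈ U, [z, y] <:+: C} : Finset V) ≤ #U :=
    card_le_of_unique (r := fun z y => [z, y] <:+: C)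
      (fun z y y' h h' => succ_unique hC h h') (by simp)
  have h2 : #({y | ∃ z ∈ U, [y, z] <:+: C} : Finset V) ≤ #U :=
    card_le_of_unique (r := fun z y => [y, z] <:+: C)
      (fun z y y' h h' => pred_unique hC h h') (by simp)
  have ho : ∀ o : Option V, #o.toFinset ≤ 1 := by rintro (_ | _) <;> simp
  have h3 := card_le_card hsub
  rw [List.toFinset_card_of_nodup hC] at h3
  refine h3.trans ((card_union_le _ _).trans ?_)
  have h4 := (card_union_le C.head?.toFinset C.getLast?.toFinset).trans
    (add_le_add (ho C.head?) (ho C.getLast?))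
  refine (add_le_add ((card_union_le _ _).trans (add_le_add ((card_union_le _ _).trans
    (add_le_add (card_union_le _ _) h1)) h2)) h4).trans ?_
  omega

/-- A long list in a graph with an edge between any two sets of size `m` contains a subset which
expands into its own interior. -/
theorem exists_core {m : ℕ}
    (hjoin : ∀ S T : Finset V, m ≤ #S → m ≤ #T → ∃ s ∈ S, ∃ t ∈ T, G.Adj s t)
    {C : List V} (hC : C.Nodup) (hlen : 21 * m ≤ C.length) :
    ∃ Z : Finset V, m ≤ #(interior C Z) ∧
      ∀ S ⊆ Z, #S ≤ m → 6 * #S ≤ #(nbrs G S ∩ interior C Z) := by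
  let F : Finset (Finset V) := {U ∈ C.toFinset.powerset | #U ≤ m ∧
    #(nbrs G U ∩ interior C (C.toFinset \ U)) ≤ 6 * #U}
  have hF : F.Nonempty := ⟨∅, by simp [F]⟩
  obtain ⟨U, hU, hmax⟩ := exists_max_image F card hF
  simp only [F, mem_filter, mem_powerset] at hU
  obtain ⟨hUC, hUm, hUN⟩ := hU
  refine ⟨C.toFinset \ U, ?_, fun S hS hSm => ?_⟩
  · have := length_le_card_interior hC U
    omega
  by_contra! hlt
  have hdisj : Disjoint U S := by
    rw [disjoint_right]
    exact fun x hx => (mem_sdiff.1 (hS hx)).2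
  have hcard : #(U ∪ S) = #U + #S := card_union_of_disjoint hdisj
  have hint : interior C (C.toFinset \ (U ∪ S)) ⊆ interior C (C.toFinset \ U) :=
    interior_mono C (sdiff_subset_sdiff subset_rfl subset_union_left)
  have hN : #(nbrs G (U ∪ S) ∩ interior C (C.toFinset \ (U ∪ S))) ≤
      6 * #(U ∪ S) := by
    have : (nbrs G (U ∪ S) ∩ interior C (C.toFinset \ (U ∪ S))) ⊆
        (nbrs G U ∩ interior C (C.toFinset \ U)) ∪
        (nbrs G S ∩ interior C (C.toFinset \ U)) := by
      intro y hy
      simp only [mem_inter, mem_nbrs, mem_union] at hy ⊢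
      obtain ⟨⟨x, hx | hx, hxy⟩, hy⟩ := hy
      · exact Or.inl ⟨⟨x, hx, hxy⟩, hint hy⟩
      · exact Or.inr ⟨⟨x, hx, hxy⟩, hint hy⟩
    have := (card_le_card this).trans (card_union_le _ _)
    omega
  by_cases hle : #(U ∪ S) ≤ m
  · have hmem : U ∪ S ∈ F := by
      simp only [F, mem_filter, mem_powerset]
      exact ⟨union_subset hUC (hS.trans sdiff_subset), hle, hN⟩
    have := hmax _ hmem
    omega
  · have hsplit := card_inter_add_card_sdiff (interior C (C.toFinset \ (U ∪ S))) (nbrs G (U ∪ S))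
    have hmiss : #(interior C (C.toFinset \ (U ∪ S)) \ nbrs G (U ∪ S)) < m := by
      by_contra h
      obtain ⟨s, hs, t, ht, hst⟩ := hjoin (U ∪ S) _ (by omega) (not_lt.1 h)
      exact (mem_sdiff.1 ht).2 (mem_nbrs.2 ⟨s, hs, hst⟩)
    rw [inter_comm] at hsplit
    have := length_le_card_interior hC (U ∪ S)
    omega

theorem exists_card_heads_ge {m : ℕ} {C P : List V} {Z : Finset V} (hP : P.Nodup)
    (hCP : C <:+: P)
    (hZ : ∀ S ⊆ Z, #S ≤ m → 6 * #S ≤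
      #(nbrs G S ∩ interior C Z))
    {r y : V} (hr : P.head? = some r) (hy : y ∈ interior C Z) (hry : G.Adj r y) :
    ∃ t, m ≤ #(heads G (interior C Z) P t ∩ Z) := by
  classical
  by_contra! hlt
  have hpiv := card_pivots_le (G := G) (Y := interior C Z) hP Z (fun y hy => by
    obtain ⟨hy, a, b, hab, ha, hb⟩ := mem_interior.1 hy
    exact ⟨a, b, hab.trans hCP, ha, hy, hb⟩)
  have hgrow : ∀ t, t + 1 ≤ #(heads G (interior C Z) P (t + 1) ∩ Z) := by
    intro t
    induction t with
    | zero =>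
      have h0 : 0 < #(nbrs G (heads G (interior C Z) P 0) ∩ interior C Z) :=
        card_pos.2 ⟨y, mem_inter.2 ⟨mem_nbrs.2 ⟨r, mem_heads.2 ⟨P, .refl, hr⟩, hry⟩, hy⟩⟩
      have := hpiv 0
      omega
    | succ t ih =>
      have h1 := hZ (heads G (interior C Z) P (t + 1) ∩ Z) inter_subset_right (hlt _).le
      have h2 : #(nbrs G (heads G (interior C Z) P (t + 1) ∩ Z) ∩ interior C Z) ≤
          #(nbrs G (heads G (interior C Z) P (t + 1)) ∩ interior C Z) :=
        card_le_card (inter_subset_inter (nbrs_mono inter_subset_left) subset_rfl)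
      have := hpiv (t + 1)
      omega
  have := hgrow m
  have := hlt (m + 1)
  omega

/-- Rotating both ends of a path inside two disjoint blocks closes it up to a cycle. -/
theorem exists_closed_path {m : ℕ}
    (hjoin : ∀ S T : Finset V, m ≤ #S → m ≤ #T → ∃ s ∈ S, ∃ t ∈ T, G.Adj s t)
    {P₁ P₂ C₁ C₂ : List V} {Z₁ Z₂ : Finset V} (hP : (P₁ ++ P₂.reverse).Nodup)
    (hchain : (P₁ ++ P₂.reverse).IsChain G.Adj)
    (hC₁ : C₁ <:+: P₁) (hC₂ : C₂ <:+: P₂)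
    (hZ₁ : ∀ S ⊆ Z₁, #S ≤ m → 6 * #S ≤
      #(nbrs G S ∩ interior C₁ Z₁))
    (hZ₂ : ∀ S ⊆ Z₂, #S ≤ m → 6 * #S ≤
      #(nbrs G S ∩ interior C₂ Z₂))
    {r₁ r₂ y₁ y₂ : V} (hr₁ : P₁.head? = some r₁) (hr₂ : P₂.head? = some r₂)
    (hy₁ : y₁ ∈ interior C₁ Z₁) (hy₂ : y₂ ∈ interior C₂ Z₂)
    (hry₁ : G.Adj r₁ y₁) (hry₂ : G.Adj r₂ y₂) :
    ∃ L : List V, L.Perm (P₁ ++ P₂.reverse) ∧ L.IsChain G.Adj ∧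
      ∃ s t, L.head? = some s ∧ L.getLast? = some t ∧ G.Adj t s := by
  have hn := List.nodup_append'.1 hP
  rw [List.isChain_append, isChain_adj_reverse] at hchain
  obtain ⟨hch₁, hch₂, hlink⟩ := hchain
  obtain ⟨t₁, ht₁⟩ := exists_card_heads_ge hn.1 hC₁ hZ₁ hr₁ hy₁ hry₁
  obtain ⟨t₂, ht₂⟩ := exists_card_heads_ge (List.nodup_reverse.1 hn.2.1) hC₂ hZ₂ hr₂ hy₂ hry₂
  obtain ⟨s, hs, s', hs', hadj⟩ := hjoin _ _ ht₁ ht₂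
  obtain ⟨L₁, hL₁, hs⟩ := mem_heads.1 (mem_inter.1 hs).1
  obtain ⟨L₂, hL₂, hs'⟩ := mem_heads.1 (mem_inter.1 hs').1
  refine ⟨L₁ ++ L₂.reverse, ?_, ?_, s, s', ?_, ?_, hadj.symm⟩
  · exact hL₁.perm.append (((List.reverse_perm _).trans hL₂.perm).trans
      (List.reverse_perm _).symm)
  · rw [List.isChain_append, isChain_adj_reverse]
    refine ⟨hL₁.isChain hch₁, hL₂.isChain hch₂, ?_⟩
    rw [hL₁.getLast?, List.head?_reverse, hL₂.getLast?]
    rwa [List.head?_reverse] at hlink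
  · rw [List.head?_append, hs]; rfl
  · rw [List.getLast?_append, List.getLast?_reverse, hs']; rfl

end Core

section Blocks

variable {V : Type*}

theorem drop_take_infix (P : List V) (a s : ℕ) : (P.drop a).take s <:+: P :=
  (List.take_prefix _ _).isInfix.trans (List.drop_suffix _ _).isInfix

theorem disjoint_blocks {P : List V} (hP : P.Nodup) (s : ℕ) {i j : ℕ} (hij : i < j) :
    ((P.drop (i * s)).take s).Disjoint ((P.drop (j * s)).take s) := by
  have h : i * s + s ≤ j * s := by
    calc i * s + s = (i + 1) * s := by ring
      _ ≤ j * s := Nat.mul_le_mul_right _ hij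
  have hd := List.disjoint_take_drop hP h
  intro x hx hx'
  refine hd ?_ (List.mem_of_mem_take hx')
  rw [List.take_drop] at hx
  exact List.mem_of_mem_drop hx

end Blocks

section Longest

variable {V : Type*} {G : SimpleGraph V}

/-- `P` is the vertex sequence of a path of `G` of maximum length. -/
structure IsLongestPath (G : SimpleGraph V) (P : List V) : Prop where
  nodup : P.Nodup
  isChain : P.IsChain G.Adj
  length_le : ∀ Q : List V, Q.Nodup → Q.IsChain G.Adj → Q.length ≤ P.length

theorem exists_isLongestPath [Fintype V] (G : SimpleGraph V) : ∃ P, IsLongestPath G P := by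
  let s : Set ℕ := {k | ∃ Q : List V, Q.Nodup ∧ Q.IsChain G.Adj ∧ Q.length = k}
  have hs : s.Nonempty := ⟨0, [], by simp⟩
  have hb : BddAbove s := ⟨Fintype.card V, by
    rintro k ⟨Q, hQ, -, rfl⟩
    exact hQ.length_le_card⟩
  obtain ⟨P, hP, hPc, hk⟩ := Nat.sSup_mem hs hb
  exact ⟨P, hP, hPc, fun Q hQ hQc => hk ▸ le_csSup hb ⟨Q, hQ, hQc, rfl⟩⟩

namespace IsLongestPath

variable {P : List V}

theorem of_perm (hP : IsLongestPath G P) {l : List V} (h : l.Perm P) (hl : l.IsChain G.Adj) :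
    IsLongestPath G l :=
  ⟨h.nodup_iff.2 hP.nodup, hl, fun Q hQ hQc => h.length_eq ▸ hP.length_le Q hQ hQc⟩

theorem reverse (hP : IsLongestPath G P) : IsLongestPath G P.reverse :=
  hP.of_perm (List.reverse_perm P) (isChain_adj_reverse.2 hP.isChain)

theorem mem_of_adj_head (hP : IsLongestPath G P) {x y : V} (hx : P.head? = some x)
    (hxy : G.Adj x y) : y ∈ P := by
  by_contra hy
  have := hP.length_le (y :: P) (List.nodup_cons.2 ⟨hy, hP.nodup⟩)
    (List.isChain_cons.2 ⟨fun z hz => by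
      rw [hx, Option.mem_some_iff] at hz
      exact hz ▸ hxy.symm, hP.isChain⟩)
  simp at this

theorem ne_nil [Nonempty V] (hP : IsLongestPath G P) : P ≠ [] := by
  rintro rfl
  have := hP.length_le [Classical.arbitrary V] (by simp) (by simp)
  simp at this

/-- A closed path that is a longest path visits every vertex, provided the graph has
a crossing edge. -/
theorem mem_of_closed {L : List V} (hL : IsLongestPath G L) {s t : V}
    (hs : L.head? = some s) (ht : L.getLast? = some t) (hts : G.Adj t s)
    {u w : V} (hw : w ∈ L) (huw : G.Adj u w) : u ∈ L := by
  obtain ⟨A, B, rfl⟩ := List.append_of_mem hw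
  have hperm : ((w :: B) ++ A).Perm (A ++ w :: B) := List.perm_append_comm
  have hch : ((w :: B) ++ A).IsChain G.Adj := by
    have h := List.isChain_append.1 hL.isChain
    refine List.isChain_append.2 ⟨h.2.1, h.1, fun x hx y hy => ?_⟩
    rw [List.getLast?_append, Option.mem_def.1 hx] at ht
    rw [List.head?_append, Option.mem_def.1 hy] at hs
    simp only [Option.some_or, Option.some.injEq] at hs ht
    rwa [hs, ht]
  exact hperm.mem_iff.1 ((hL.of_perm hperm hch).mem_of_adj_head (by simp) huw.symm)

variable [Fintype V] [DecidableEq V]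

theorem card_nbrs_heads_le (hP : IsLongestPath G P) (t : ℕ) :
    #(nbrs G (heads G (interior P univ) P t)) ≤
      3 * #(heads G (interior P univ) P (t + 1)) + 2 := by
  have hpiv := card_pivots_le (G := G) (Y := interior P univ) hP.nodup univ
    (fun y hy => by
      obtain ⟨-, a, b, hab, -, -⟩ := mem_interior.1 hy
      exact ⟨a, b, hab, mem_univ _, mem_univ _, mem_univ _⟩) t
  rw [inter_univ] at hpiv
  have ho : ∀ o : Option V, #o.toFinset ≤ 1 := by rintro (_ | _) <;> simp
  have hsub : nbrs G (heads G (interior P univ) P t) ⊆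
      (nbrs G (heads G (interior P univ) P t) ∩ interior P univ) ∪
        (P.head?.toFinset ∪ P.getLast?.toFinset) := by
    intro y hy
    obtain ⟨x, hx, hxy⟩ := mem_nbrs.1 hy
    obtain ⟨l, hl, hlx⟩ := mem_heads.1 hx
    have hyl := (hP.of_perm hl.perm (hl.isChain hP.isChain)).mem_of_adj_head hlx hxy
    simp only [mem_union, mem_inter, mem_interior, Option.mem_toFinset, Option.mem_def]
    rcases exists_triple_infix (hl.perm.mem_iff.1 hyl) with h | h | ⟨a, b, h⟩
    · exact Or.inr (Or.inl h)
    · exact Or.inr (Or.inr h)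
    · exact Or.inl ⟨hy, mem_univ _, a, b, h, mem_univ _, mem_univ _⟩
  have h1 := (card_le_card hsub).trans (card_union_le _ _)
  have h2 := card_union_le P.head?.toFinset P.getLast?.toFinset
  have h3 := ho P.head?
  have h4 := ho P.getLast?
  omega

theorem card_le_heads [Nonempty V] (hP : IsLongestPath G P) {E T : ℕ}
    (hexp : ∀ S : Finset V, 5 * E * #S ≤ #(nbrs G S) ∨ Fintype.card V ≤ 3 * #(nbrs G S))
    (hT : Fintype.card V ≤ E ^ T) :
    Fintype.card V ≤ 15 * #(heads G (interior P univ) P T) := by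
  have hpos : ∀ t, 1 ≤ #(heads G (interior P univ) P t) := by
    intro t
    induction t with
    | zero =>
      obtain ⟨x, hx⟩ := Option.ne_none_iff_exists'.1
        (mt List.head?_eq_none_iff.1 hP.ne_nil)
      exact card_pos.2 ⟨x, mem_heads.2 ⟨P, .refl, hx⟩⟩
    | succ t ih => exact ih.trans (card_le_card (heads_subset_succ t))
  have hgrow : ∀ t, E ^ t ≤ #(heads G (interior P univ) P t) ∨
      Fintype.card V ≤ 15 * #(heads G (interior P univ) P t) := by
    intro t
    induction t with
    | zero => exact Or.inl (by simpa using hpos 0)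
    | succ t ih =>
      have h1 := hP.card_nbrs_heads_le t
      have h2 := hpos (t + 1)
      have h3 := card_le_card (heads_subset_succ (G := G) (Y := interior P univ) (P := P) t)
      rcases ih with ih | ih
      · rcases hexp (heads G (interior P univ) P t) with h | h
        · left
          rw [pow_succ]
          nlinarith [Nat.mul_le_mul_right E ih]
        · right
          omega
      · right
        omega
  rcases hgrow T with h | h
  · omega
  · exact h

open Classical in
theorem exists_endpoint_pairs [Nonempty V] (hP : IsLongestPath G P) {E T : ℕ}
    (hexp : ∀ S : Finset V, 5 * E * #S ≤ #(nbrs G S) ∨ Fintype.card V ≤ 3 * #(nbrs G S))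
    (hT : Fintype.card V ≤ E ^ T) {ι : Type*} [Fintype ι] {B : ι → List V}
    (hB : Pairwise fun i j => (B i).Disjoint (B j)) (hBP : ∀ i, B i <:+: P) :
    ∃ F : Finset (V × V), Fintype.card V ^ 2 ≤ 225 * #F ∧ ∀ p ∈ F, ∃ l : List V,
      l.Perm P ∧ l.IsChain G.Adj ∧ l.head? = some p.1 ∧ l.getLast? = some p.2 ∧
      #{i | ¬ Survives (B i) l} ≤ 2 * T := by
  let F : Finset (V × V) := {p | ∃ l : List V,
      l.Perm P ∧ l.IsChain G.Adj ∧ l.head? = some p.1 ∧ l.getLast? = some p.2 ∧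
      #{i | ¬ Survives (B i) l} ≤ 2 * T}
  refine ⟨F, ?_, fun p hp => (mem_filter.1 hp).2⟩
  have hsP : #{i | ¬ Survives (B i) P} = 0 := by
    simp [Survives, hBP]
  set R := heads G (interior P univ) P T with hR
  have hfib : ∀ r ∈ R, Fintype.card V ≤ 15 * #{p ∈ F | p.1 = r} := by
    intro r hr
    obtain ⟨l, hl, hlr⟩ := mem_heads.1 hr
    have hlong := (hP.of_perm hl.perm (hl.isChain hP.isChain)).reverse
    refine (hlong.card_le_heads hexp hT).trans (Nat.mul_le_mul_left _ ?_)
    refine card_le_card_of_injOn (fun r' => (r, r')) ?_ (fun _ _ _ _ h => (Prod.mk.inj h).2)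
    intro r' hr'
    obtain ⟨l', hl', hlr'⟩ := mem_heads.1 hr'
    simp only [coe_filter, Set.mem_ofPred_eq, and_true]
    refine mem_filter.2 ⟨mem_univ _, l'.reverse, ?_, ?_, ?_, ?_, ?_⟩
    · exact ((List.reverse_perm _).trans hl'.perm).trans ((List.reverse_perm _).trans hl.perm)
    · exact isChain_adj_reverse.2 (hl'.isChain hlong.isChain)
    · rw [List.head?_reverse, hl'.getLast?, List.getLast?_reverse, hlr]
    · rw [List.getLast?_reverse, hlr']
    · have h1 := hl.card_not_survives hB
      have h2 := hl'.card_not_survives hB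
      simp only [survives_reverse] at h2 ⊢
      omega
  have hsum : #R * Fintype.card V ≤ 15 * #F := by
    calc #R * Fintype.card V = ∑ r ∈ R, Fintype.card V := by simp
      _ ≤ ∑ r ∈ R, 15 * #{p ∈ F | p.1 = r} := sum_le_sum hfib
      _ = 15 * ∑ r ∈ R, #{p ∈ F | p.1 = r} := by rw [mul_sum]
      _ ≤ 15 * ∑ r, #{p ∈ F | p.1 = r} :=
        Nat.mul_le_mul_left _ (sum_le_sum_of_subset (subset_univ _))
      _ = 15 * #F := by
        rw [← card_eq_sum_card_fiberwise (f := Prod.fst) (t := univ) (by simp)]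
  have := hP.card_le_heads hexp hT
  nlinarith [Nat.mul_le_mul_right (Fintype.card V) this]

end IsLongestPath

end Longest

theorem exists_two_le_of_sum_le {ι : Type*} [Fintype ι] {f : ι → ℕ} {a b k : ℕ}
    (hk : Fintype.card ι = k + 2) (hsum : ∑ i, f i ≤ a) (hab : a < (k + 1) * (b + 1)) :
    ∃ i j, i ≠ j ∧ f i ≤ b ∧ f j ≤ b := by
  classical
  have h1 : 1 < #{i | f i ≤ b} := by
    by_contra! h
    have hsplit := card_filter_add_card_filter_not (s := (univ : Finset ι)) (fun i => f i ≤ b)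
    rw [card_univ, hk] at hsplit
    have h2 : #{i | ¬ f i ≤ b} * (b + 1) ≤ ∑ i, f i := by
      calc #{i | ¬ f i ≤ b} * (b + 1) = ∑ i with ¬ f i ≤ b, (b + 1) := by simp
        _ ≤ ∑ i with ¬ f i ≤ b, f i := sum_le_sum fun i hi => by
          have := (mem_filter.1 hi).2
          omega
        _ ≤ ∑ i, f i := sum_le_sum_of_subset (subset_univ _)
    have h3 : (k + 1) * (b + 1) ≤ #{i | ¬ f i ≤ b} * (b + 1) :=
      Nat.mul_le_mul_right _ (by omega)
    omega
  obtain ⟨i, hi, j, hj, hij⟩ := one_lt_card.1 h1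
  exact ⟨i, j, hij, (mem_filter.1 hi).2, (mem_filter.1 hj).2⟩

section Graph

variable {V : Type*} [Fintype V] {G : SimpleGraph V}

theorem exists_pair_in_nbrs [DecidableEq V] {m a : ℕ}
    (hjoin : ∀ S T : Finset V, m ≤ #S → m ≤ #T → ∃ s ∈ S, ∃ t ∈ T, G.Adj s t)
    {I₁ I₂ : Finset V} (hI₁ : m ≤ #I₁) (hI₂ : m ≤ #I₂) {F : Finset (V × V)}
    (hF : Fintype.card V ^ 2 ≤ a * #F) (hm : 2 * a * m < Fintype.card V) :
    ∃ p ∈ F, p.1 ∈ nbrs G I₁ ∧ p.2 ∈ nbrs G I₂ := by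
  have hmiss : ∀ I : Finset V, m ≤ #I → #(nbrs G I)ᶜ ≤ m := by
    intro I hI
    by_contra! h
    obtain ⟨s, hs, t, ht, hst⟩ := hjoin I _ hI h.le
    exact (mem_compl.1 ht) (mem_nbrs.2 ⟨s, hs, hst⟩)
  by_contra! hno
  have hsub : F ⊆ (nbrs G I₁)ᶜ ×ˢ univ ∪ univ ×ˢ (nbrs G I₂)ᶜ := by
    intro p hp
    have := hno p hp
    simp only [mem_union, mem_product, mem_compl, mem_univ, and_true, true_and]
    tauto
  have h1 := (card_le_card hsub).trans (card_union_le _ _)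
  simp only [card_product, card_univ] at h1
  have h2 := Nat.mul_le_mul_right (Fintype.card V) (hmiss I₁ hI₁)
  have h3 := Nat.mul_le_mul_left (Fintype.card V) (hmiss I₂ hI₂)
  have h4 : #F ≤ 2 * m * Fintype.card V := by nlinarith
  have h5 := Nat.mul_le_mul_left a h4
  have h6 := Nat.mul_lt_mul_of_pos_right hm (Nat.zero_lt_of_lt hm)
  nlinarith

/-- Two of the blocks of a longest path survive, in the same order and with the same orientations,
on the way to quadratically many pairs of end vertices. -/
theorem IsLongestPath.exists_two_blocks [Nonempty V] {P : List V} (hP : IsLongestPath G P)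
    {E T : ℕ}
    (hexp : ∀ S : Finset V, 5 * E * #S ≤ #(nbrs G S) ∨ Fintype.card V ≤ 3 * #(nbrs G S))
    (hT : Fintype.card V ≤ E ^ T) {s : ℕ} (hs : 0 < s) (hsP : (8 * T + 2) * s ≤ P.length) :
    ∃ (C₁ C₂ : List V) (F : Finset (V × V)), C₁.length = s ∧ C₂.length = s ∧
      Fintype.card V ^ 2 ≤ 3600 * #F ∧ ∀ p ∈ F, ∃ X Y Z : List V,
        (X ++ C₁ ++ Y ++ C₂ ++ Z).Perm P ∧ (X ++ C₁ ++ Y ++ C₂ ++ Z).IsChain G.Adj ∧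
        (X ++ C₁ ++ Y ++ C₂ ++ Z).head? = some p.1 ∧
        (X ++ C₁ ++ Y ++ C₂ ++ Z).getLast? = some p.2 := by
  classical
  let B : Fin (8 * T + 2) → List V := fun i => (P.drop (i * s)).take s
  have hB : Pairwise fun i j => (B i).Disjoint (B j) := by
    intro i j hij
    rcases lt_or_gt_of_ne hij with h | h
    · exact disjoint_blocks hP.nodup s h
    · exact (disjoint_blocks hP.nodup s h).symm
  have hBlen : ∀ i, (B i).length = s := by
    intro i
    have : ((i : ℕ) + 1) * s ≤ (8 * T + 2) * s := Nat.mul_le_mul_right _ i.2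
    simp only [B, List.length_take, List.length_drop]
    rw [add_mul, one_mul] at this
    omega
  obtain ⟨F, hF, hFP⟩ := hP.exists_endpoint_pairs hexp hT hB (fun i => drop_take_infix P _ _)
  choose! l hlP hlc hlh hll hlB using hFP
  have hFpos : 0 < #F := by
    have := Fintype.card_pos (α := V)
    have := pow_pos this 2
    omega
  let bad : Fin (8 * T + 2) → ℕ := fun i => 4 * #{p ∈ F | ¬ Survives (B i) (l p)}
  have hsum : ∑ i, bad i ≤ 8 * T * #F := by
    calc ∑ i, bad i = 4 * ∑ i, ∑ p ∈ F, if ¬ Survives (B i) (l p) then 1 else 0 := by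
          simp only [bad, ← mul_sum, card_filter]
      _ = 4 * ∑ p ∈ F, #{i | ¬ Survives (B i) (l p)} := by
          rw [sum_comm]
          simp only [card_filter]
      _ ≤ 4 * ∑ p ∈ F, 2 * T := Nat.mul_le_mul_left _ (sum_le_sum fun p hp => hlB p hp)
      _ = 8 * T * #F := by
          rw [sum_const, smul_eq_mul]
          ring
  obtain ⟨i, j, hij, hi, hj⟩ := exists_two_le_of_sum_le (k := 8 * T) (b := #F) (by simp) hsum
    (by nlinarith)
  let F' : Finset (V × V) := {p ∈ F | Survives (B i) (l p) ∧ Survives (B j) (l p)}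
  have hF' : #F ≤ 2 * #F' := by
    have hsub : F ⊆ F' ∪ ({p ∈ F | ¬ Survives (B i) (l p)} ∪
        {p ∈ F | ¬ Survives (B j) (l p)}) := by
      intro p hp
      simp only [F', mem_union, mem_filter]
      tauto
    have h1 := (card_le_card hsub).trans (card_union_le _ _)
    have h2 := card_union_le {p ∈ F | ¬ Survives (B i) (l p)} {p ∈ F | ¬ Survives (B j) (l p)}
    simp only [bad] at hi hj
    omega
  let O : List V → Finset (List V) := fun C => {C, C.reverse}
  have hO : ∀ C, #(O C) ≤ 2 := fun C => card_le_two
  let Cand : Finset (List V × List V) := O (B i) ×ˢ O (B j) ∪ O (B j) ×ˢ O (B i)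
  have hCand : #Cand ≤ 8 := by
    refine (card_union_le _ _).trans ?_
    simp only [card_product]
    have := Nat.mul_le_mul (hO (B i)) (hO (B j))
    have := Nat.mul_le_mul (hO (B j)) (hO (B i))
    omega
  have hOlen : ∀ k, ∀ C ∈ O (B k), C.length = s := by
    intro k C hC
    rcases mem_insert.1 hC with rfl | hC
    · exact hBlen k
    · rw [mem_singleton.1 hC, List.length_reverse, hBlen]
  have hOmem : ∀ k, ∀ C ∈ O (B k), ∀ x ∈ C, x ∈ B k := by
    intro k C hC x hx
    rcases mem_insert.1 hC with rfl | hC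
    · exact hx
    · rw [mem_singleton.1 hC] at hx
      exact List.mem_reverse.1 hx
  have hOinf : ∀ k p, Survives (B k) (l p) → ∃ C ∈ O (B k), C <:+: l p := by
    rintro k p (h | h)
    · exact ⟨_, mem_insert_self _ _, h⟩
    · exact ⟨_, mem_insert_of_mem (mem_singleton_self _), h⟩
  have hex : ∀ p ∈ F', ∃ q ∈ Cand, ∃ X Y Z, l p = X ++ q.1 ++ Y ++ q.2 ++ Z := by
    intro p hp
    obtain ⟨-, hpi, hpj⟩ := mem_filter.1 hp
    obtain ⟨C, hC, hCl⟩ := hOinf i p hpi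
    obtain ⟨D, hD, hDl⟩ := hOinf j p hpj
    have hDne : D ≠ [] := by
      rw [← List.length_pos_iff, hOlen j D hD]
      exact hs
    rcases exists_order_of_infix hCl hDl hDne
      (fun x hx hx' => hB hij (hOmem i C hC x hx) (hOmem j D hD x hx')) with h | h
    · exact ⟨(C, D), mem_union_left _ (mem_product.2 ⟨hC, hD⟩), h⟩
    · exact ⟨(D, C), mem_union_right _ (mem_product.2 ⟨hD, hC⟩), h⟩
  choose! q hq hqe using hex
  have hCne : Cand.Nonempty :=
    ⟨(B i, B j), mem_union_left _ (mem_product.2 ⟨mem_insert_self _ _, mem_insert_self _ _⟩)⟩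
  obtain ⟨⟨C₁, C₂⟩, hC, hcard⟩ := exists_le_of_sum_le hCne
    (f := fun _ => #F') (g := fun y => 8 * #{p ∈ F' | q p = y}) (by
      rw [sum_const, ← mul_sum, ← card_eq_sum_card_fiberwise hq]
      exact Nat.mul_le_mul_right _ hCand)
  refine ⟨C₁, C₂, {p ∈ F' | q p = (C₁, C₂)}, ?_, ?_, by omega, ?_⟩
  · rcases mem_union.1 hC with h | h
    · exact hOlen i _ (mem_product.1 h).1
    · exact hOlen j _ (mem_product.1 h).1
  · rcases mem_union.1 hC with h | h
    · exact hOlen j _ (mem_product.1 h).2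
    · exact hOlen i _ (mem_product.1 h).2
  · intro p hp
    obtain ⟨hp, hpq⟩ := mem_filter.1 hp
    obtain ⟨X, Y, Z, h⟩ := hqe p hp
    have hpF := (mem_filter.1 hp).1
    rw [hpq] at h
    refine ⟨X, Y, Z, ?_⟩
    rw [← h]
    exact ⟨hlP p hpF, hlc p hpF, hlh p hpF, hll p hpF⟩

/-- A graph in which small sets expand by a large factor and any two moderately large sets are
joined by an edge has a Hamiltonian cycle. -/
theorem exists_hamiltonian_list {m E T : ℕ} (hm : 1 ≤ m) (hT₁ : 1 ≤ T)
    (hjoin : ∀ S T : Finset V, m ≤ #S → m ≤ #T → ∃ s ∈ S, ∃ t ∈ T, G.Adj s t)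
    (hexp : ∀ S : Finset V, 5 * E * #S ≤ #(nbrs G S) ∨ Fintype.card V ≤ 3 * #(nbrs G S))
    (hT : Fintype.card V ≤ E ^ T) (hmT : 7201 * m * T ≤ Fintype.card V) :
    ∃ L : List V, L.Nodup ∧ (∀ v, v ∈ L) ∧ L.IsChain G.Adj ∧
      ∃ s t, L.head? = some s ∧ L.getLast? = some t ∧ G.Adj t s := by
  classical
  have hmm : 7201 * m ≤ Fintype.card V := by nlinarith
  have : Nonempty V := Fintype.card_pos_iff.1 (by omega)
  obtain ⟨P, hP⟩ := exists_isLongestPath G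
  have hPlen : Fintype.card V ≤ 15 * P.length := by
    refine (hP.card_le_heads hexp hT).trans (Nat.mul_le_mul_left _ ?_)
    rw [← List.toFinset_card_of_nodup hP.nodup]
    refine card_le_card fun x hx => ?_
    obtain ⟨l, hl, hlx⟩ := mem_heads.1 hx
    exact List.mem_toFinset.2 (hl.perm.mem_iff.1 (List.mem_of_mem_head? hlx))
  have hblk : (8 * T + 2) * (21 * m) ≤ P.length := by nlinarith
  obtain ⟨C₁, C₂, F, hl₁, hl₂, hF, hFP⟩ := hP.exists_two_blocks hexp hT (by omega) hblk
  have hFne : F.Nonempty := by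
    rw [← card_pos]
    have := pow_pos (Fintype.card_pos (α := V)) 2
    omega
  have hnd : C₁.Nodup ∧ C₂.reverse.Nodup := by
    obtain ⟨p, hp⟩ := hFne
    obtain ⟨X, Y, Z, hperm, -⟩ := hFP p hp
    have hn := hperm.nodup_iff.2 hP.nodup
    refine ⟨?_, List.nodup_reverse.2 ?_⟩
    · exact List.Sublist.nodup (List.IsInfix.sublist ⟨X, Y ++ C₂ ++ Z, by simp⟩) hn
    · exact List.Sublist.nodup (List.IsInfix.sublist ⟨X ++ C₁ ++ Y, Z, by simp⟩) hn
  obtain ⟨Z₁, hI₁, hZ₁⟩ := exists_core hjoin hnd.1 hl₁.ge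
  obtain ⟨Z₂, hI₂, hZ₂⟩ := exists_core hjoin hnd.2 (by rw [List.length_reverse, hl₂])
  obtain ⟨⟨r₁, r₂⟩, hp, hr₁, hr₂⟩ := exists_pair_in_nbrs hjoin hI₁ hI₂ hF (by omega)
  obtain ⟨y₁, hy₁, hyr₁⟩ := mem_nbrs.1 hr₁
  obtain ⟨y₂, hy₂, hyr₂⟩ := mem_nbrs.1 hr₂
  obtain ⟨X, Y, Z, hperm, hch, hh, hlast⟩ := hFP _ hp
  have hC₁ne : C₁ ≠ [] := by
    rw [← List.length_pos_iff]
    omega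
  have hC₂ne : C₂ ≠ [] := by
    rw [← List.length_pos_iff]
    omega
  have hsplit : X ++ C₁ ++ Y ++ C₂ ++ Z = (X ++ C₁ ++ Y) ++ (C₂ ++ Z).reverse.reverse := by simp
  rw [hsplit] at hperm hch hh hlast
  rw [List.head?_append_of_ne_nil _ (by simp [hC₁ne])] at hh
  rw [List.getLast?_append_of_ne_nil _ (by simp [hC₂ne]), List.getLast?_reverse] at hlast
  obtain ⟨L, hLp, hLc, s, t, hs, ht, hts⟩ := exists_closed_path hjoin
    (hperm.nodup_iff.2 hP.nodup) hch (C₁ := C₁) (C₂ := C₂.reverse) ⟨X, Y, rfl⟩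
    ⟨Z.reverse, [], by simp⟩ hZ₁ hZ₂ hh hlast hy₁ hy₂ hyr₁.symm hyr₂.symm
  have hL := hP.of_perm (hLp.trans hperm) hLc
  refine ⟨L, hL.nodup, ?_, hLc, s, t, hs, ht, hts⟩
  by_contra! hcov
  obtain ⟨v, hv⟩ := hcov
  let W := (L.toFinset)ᶜ
  have hWN : nbrs G W ⊆ W := by
    intro x hx
    obtain ⟨u, hu, hux⟩ := mem_nbrs.1 hx
    simp only [W, mem_compl, List.mem_toFinset] at hu ⊢
    exact fun hxL => hu (hL.mem_of_closed hs ht hts hxL hux)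
  have hWm : m ≤ #W := by
    have hWpos : 0 < #W := card_pos.2 ⟨v, by simpa [W] using hv⟩
    have hE : 0 < E := by
      rcases Nat.eq_zero_or_pos E with rfl | h
      · rw [zero_pow (by omega)] at hT
        omega
      · exact h
    have hle := card_le_card hWN
    rcases hexp W with h | h
    · nlinarith [Nat.mul_le_mul_right #W hE]
    · omega
  obtain ⟨x, hx, y, hy, hxy⟩ := hjoin W L.toFinset hWm (by
    rw [List.toFinset_card_of_nodup hL.nodup, (hLp.trans hperm).length_eq]
    omega)
  exact mem_compl.1 (hWN (mem_nbrs.2 ⟨x, hx, hxy⟩)) hy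

end Graph

theorem exists_isHamiltonianCycle_of_list {V : Type*} [Fintype V] [DecidableEq V]
    {G : SimpleGraph V} (hV : 3 ≤ Fintype.card V) {L : List V} (hL : L.Nodup)
    (hmem : ∀ v, v ∈ L) (hchain : L.IsChain G.Adj) {s t : V} (hs : L.head? = some s)
    (ht : L.getLast? = some t) (hts : G.Adj t s) :
    ∃ (v : V) (p : G.Walk v v), p.IsHamiltonianCycle := by
  have hne : L ≠ [] := by
    rintro rfl
    simp at hs
  have hlen : L.length = Fintype.card V := by
    rw [← List.toFinset_card_of_nodup hL, ← card_univ]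
    congr 1
    ext v
    simp [hmem]
  let q := SimpleGraph.Walk.ofSupport (G := G) L hne hchain
  have hq : q.IsPath := by
    rw [SimpleGraph.Walk.isPath_def, SimpleGraph.Walk.support_ofSupport]
    exact hL
  have hadj : G.Adj (L.getLast hne) (L.head hne) := by
    rw [List.head?_eq_some_head hne, Option.some.injEq] at hs
    rw [List.getLast?_eq_some_getLast hne, Option.some.injEq] at ht
    rwa [hs, ht]
  have hplen : (SimpleGraph.Walk.cons hadj q).length = Fintype.card V := by
    rw [SimpleGraph.Walk.length_cons, SimpleGraph.Walk.length_ofSupport, hlen]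
    omega
  refine ⟨_, .cons hadj q, SimpleGraph.Walk.isHamiltonianCycle_iff_isCycle_and_length_eq.2
    ⟨SimpleGraph.Walk.isCycle_iff_isPath_tail_and_le_length.2 ⟨?_, ?_⟩, hplen⟩⟩
  · simpa using hq
  · omega

section Moments

/-- The words in which no letter occurs exactly once. -/
def repeatingWords (k d : ℕ) : Finset (Fin k → Fin d) :=
  {w | ∀ j, ∃ j', j' ≠ j ∧ w j' = w j}

theorem card_repeatingWords_le {p d : ℕ} (hpd : p ≤ d) :
    #(repeatingWords (2 * p) d) ≤ d.choose p * p ^ (2 * p) := by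
  have hsub : repeatingWords (2 * p) d ⊆ (powersetCard p (univ : Finset (Fin d))).biUnion
      fun S => Fintype.piFinset fun _ : Fin (2 * p) => S := by
    intro w hw
    have hw : ∀ j, ∃ j', j' ≠ j ∧ w j' = w j := (mem_filter.1 hw).2
    have himg : 2 * #(univ.image w) ≤ 2 * p := by
      have hfib : ∀ i ∈ univ.image w, 2 ≤ #{j ∈ univ | w j = i} := by
        intro i hi
        obtain ⟨j, -, rfl⟩ := mem_image.1 hi
        obtain ⟨j', hne, hj'⟩ := hw j
        exact one_lt_card.2 ⟨j', by simpa using hj', j, by simp, hne⟩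
      simpa using mul_card_image_le_card univ 2 hfib
    obtain ⟨S, hS, hSp⟩ := exists_superset_card_eq (s := univ.image w) (n := p) (by omega)
      (by simpa using hpd)
    refine mem_biUnion.2 ⟨S, mem_powersetCard.2 ⟨subset_univ _, hSp⟩, ?_⟩
    exact Fintype.mem_piFinset.2 fun j => hS (mem_image_of_mem w (mem_univ j))
  refine (card_le_card hsub).trans ?_
  refine (card_biUnion_le_card_mul _ _ (p ^ (2 * p)) fun S hS => ?_).trans ?_
  · simp [(mem_powersetCard.1 hS).2]
  · simp

theorem choose_mul_pow_le {p d : ℕ} :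
    ((d.choose p * p ^ (2 * p) : ℕ) : ℝ) ≤ (Real.exp 1 * d * p) ^ p := by
  have h1 : (d.choose p : ℝ) ≤ (d : ℝ) ^ p / (p.factorial : ℝ) := Nat.choose_le_pow_div p d
  have h2 : (p : ℝ) ^ p / (p.factorial : ℝ) ≤ Real.exp p :=
    Real.pow_div_factorial_le_exp (p : ℝ) (by positivity) p
  rw [← Real.exp_one_pow p] at h2
  push_cast
  calc (d.choose p : ℝ) * (p : ℝ) ^ (2 * p)
      ≤ ((d : ℝ) ^ p / (p.factorial : ℝ)) * (p : ℝ) ^ (2 * p) := by gcongr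
    _ = (d : ℝ) ^ p * (p : ℝ) ^ p * ((p : ℝ) ^ p / (p.factorial : ℝ)) := by
        rw [two_mul, pow_add]
        ring
    _ ≤ (d : ℝ) ^ p * (p : ℝ) ^ p * Real.exp 1 ^ p := by gcongr
    _ = (Real.exp 1 * d * p) ^ p := by
        rw [mul_pow, mul_pow]
        ring

variable {ι W : Type*} [Fintype ι] [AddCommGroup W] [Module ℝ W]

theorem sum_multilinear_eq_zero {k d : ℕ} (Φ : MultilinearMap ℝ (fun _ : Fin k => W) ℝ)
    {X : ι → W} (hX : ∑ a, X a = 0) {w : Fin k → Fin d} (hw : w ∉ repeatingWords k d) :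
    ∑ f : Fin d → ι, Φ (fun j => X (f (w j))) = 0 := by
  simp only [repeatingWords, mem_filter_univ, not_forall, not_exists, not_and] at hw
  obtain ⟨j₀, hj₀⟩ := hw
  rw [← (Equiv.funSplitAt (w j₀) ι).symm.sum_comp, Fintype.sum_prod_type_right]
  refine sum_eq_zero fun g _ => ?_
  let m : Fin k → W := fun j => if h : w j = w j₀ then 0 else X (g ⟨w j, h⟩)
  have hm : ∀ a, (fun j => X ((Equiv.funSplitAt (w j₀) ι).symm (a, g) (w j))) =
      Function.update m j₀ (X a) := by
    intro a
    funext j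
    by_cases hj : j = j₀
    · subst hj
      simp [Equiv.funSplitAt, Equiv.piSplitAt]
    · simp [Function.update_of_ne hj, m, hj₀ j hj, Equiv.funSplitAt, Equiv.piSplitAt]
  simp only [hm]
  rw [← Φ.map_update_sum, hX, Φ.map_update_zero]

/-- The moment method: some choice of `d` indices has a `2 * p`-th moment that is at most the
contribution of the words in which every letter is repeated. -/
theorem exists_multilinear_le [Nonempty ι] {p d : ℕ} (hpd : p ≤ d)
    (Φ : MultilinearMap ℝ (fun _ : Fin (2 * p) => W) ℝ) {X : ι → W} (hX : ∑ a, X a = 0) {K : ℝ}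
    (hK : ∀ a : Fin (2 * p) → ι, Φ (fun j => X (a j)) ≤ K) (hK₀ : 0 ≤ K) :
    ∃ f : Fin d → ι, Φ (fun _ => ∑ i, X (f i)) ≤ (Real.exp 1 * d * p) ^ p * K := by
  have hsum : ∑ f : Fin d → ι, Φ (fun _ => ∑ i, X (f i)) ≤
      ∑ _f : Fin d → ι, (Real.exp 1 * d * p) ^ p * K := by
    calc ∑ f : Fin d → ι, Φ (fun _ => ∑ i, X (f i))
        = ∑ f : Fin d → ι, ∑ w : Fin (2 * p) → Fin d, Φ (fun j => X (f (w j))) :=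
          sum_congr rfl fun f _ => Φ.map_sum fun _ i => X (f i)
      _ = ∑ w : Fin (2 * p) → Fin d, ∑ f : Fin d → ι, Φ (fun j => X (f (w j))) := sum_comm
      _ = ∑ w ∈ repeatingWords (2 * p) d, ∑ f : Fin d → ι, Φ (fun j => X (f (w j))) :=
          (sum_subset (subset_univ _) fun w _ hw => sum_multilinear_eq_zero Φ hX hw).symm
      _ ≤ ∑ w ∈ repeatingWords (2 * p) d, ∑ f : Fin d → ι, K :=
          sum_le_sum fun w _ => sum_le_sum fun f _ => hK _
      _ = (#(repeatingWords (2 * p) d) : ℝ) * ∑ f : Fin d → ι, K := by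
          rw [sum_const, nsmul_eq_mul]
      _ ≤ (Real.exp 1 * d * p) ^ p * ∑ f : Fin d → ι, K := by
          refine mul_le_mul_of_nonneg_right ?_ (sum_nonneg fun _ _ => hK₀)
          exact (Nat.cast_le.2 (card_repeatingWords_le hpd)).trans choose_mul_pow_le
      _ = ∑ _f : Fin d → ι, (Real.exp 1 * d * p) ^ p * K := by rw [mul_sum]
  obtain ⟨f, -, hf⟩ := exists_le_of_sum_le univ_nonempty hsum
  exact ⟨f, hf⟩

end Moments

section Matrices

open Matrix

variable {V : Type*} [Fintype V]

theorem dotProduct_sq_le (x y : V → ℝ) : (x ⬝ᵥ y) ^ 2 ≤ (x ⬝ᵥ x) * (y ⬝ᵥ y) := by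
  simpa [dotProduct, sq] using sum_mul_sq_le_sq_mul_sq univ x y

theorem dotProduct_self_real_nonneg (x : V → ℝ) : 0 ≤ x ⬝ᵥ x :=
  sum_nonneg fun i _ => mul_self_nonneg (x i)

theorem sum_abs_mul_row_le {A B : Matrix V V ℝ} {a b : ℝ} (ha : ∀ u, ∑ v, |A u v| ≤ a)
    (hb : ∀ u, ∑ v, |B u v| ≤ b) (hb₀ : 0 ≤ b) (u : V) : ∑ v, |(A * B) u v| ≤ a * b := by
  calc ∑ v, |(A * B) u v| ≤ ∑ v, ∑ x, |A u x| * |B x v| := by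
        refine sum_le_sum fun v _ => ?_
        rw [Matrix.mul_apply]
        refine (abs_sum_le_sum_abs _ _).trans (sum_le_sum fun x _ => (abs_mul _ _).le)
    _ = ∑ x, |A u x| * ∑ v, |B x v| := by
        rw [sum_comm]
        simp only [mul_sum]
    _ ≤ ∑ x, |A u x| * b := sum_le_sum fun x _ => by gcongr; exact hb x
    _ = (∑ x, |A u x|) * b := by rw [sum_mul]
    _ ≤ a * b := by gcongr; exact ha u

variable [DecidableEq V]

theorem sum_abs_prod_row_le {b : ℝ} (hb₀ : 0 ≤ b) {l : List (Matrix V V ℝ)}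
    (hl : ∀ A ∈ l, ∀ u, ∑ v, |A u v| ≤ b) (u : V) : ∑ v, |l.prod u v| ≤ b ^ l.length := by
  induction l generalizing u with
  | nil => simp [Matrix.one_apply, apply_ite abs]
  | cons A l ih =>
    rw [List.prod_cons, List.length_cons, pow_succ']
    exact sum_abs_mul_row_le (hl A List.mem_cons_self)
      (fun u => ih (fun C hC => hl C (List.mem_cons_of_mem _ hC)) u) (by positivity) u

theorem trace_prod_le {b : ℝ} (hb₀ : 0 ≤ b) {l : List (Matrix V V ℝ)}
    (hl : ∀ A ∈ l, ∀ u, ∑ v, |A u v| ≤ b) :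
    l.prod.trace ≤ Fintype.card V * b ^ l.length := by
  calc l.prod.trace = ∑ u, l.prod u u := rfl
    _ ≤ ∑ _u : V, b ^ l.length := by
        refine sum_le_sum fun u _ => (le_abs_self _).trans ?_
        exact (single_le_sum (f := fun v => |l.prod u v|) (fun v _ => abs_nonneg _)
          (mem_univ u)).trans (sum_abs_prod_row_le hb₀ hl u)
    _ = Fintype.card V * b ^ l.length := by simp

theorem exists_trace_pow_le {ι : Type*} [Fintype ι] [Nonempty ι] {p d : ℕ} (hpd : p ≤ d)
    {X : ι → Matrix V V ℝ} (hX : ∑ a, X a = 0) {b : ℝ} (hb₀ : 0 ≤ b)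
    (hXb : ∀ a u, ∑ v, |X a u v| ≤ b) :
    ∃ f : Fin d → ι, ((∑ i, X (f i)) ^ (2 * p)).trace ≤
      Fintype.card V * (b ^ 2 * Real.exp 1 * d * p) ^ p := by
  let Φ : MultilinearMap ℝ (fun _ : Fin (2 * p) => Matrix V V ℝ) ℝ :=
    (Matrix.traceLinearMap V ℝ ℝ).compMultilinearMap
      (MultilinearMap.mkPiAlgebraFin ℝ (2 * p) (Matrix V V ℝ))
  have hΦ : ∀ m, Φ m = (List.ofFn m).prod.trace := fun m => by
    simp [Φ, MultilinearMap.mkPiAlgebraFin_apply]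
  obtain ⟨f, hf⟩ := exists_multilinear_le hpd Φ hX (K := Fintype.card V * b ^ (2 * p))
    (fun a => by
      rw [hΦ]
      refine (trace_prod_le hb₀ fun A hA => ?_).trans (by rw [List.length_ofFn])
      obtain ⟨j, rfl⟩ := List.mem_ofFn.1 hA
      exact hXb _) (by positivity)
  refine ⟨f, ?_⟩
  rw [hΦ, List.ofFn_const, List.prod_replicate] at hf
  refine hf.trans (le_of_eq ?_)
  rw [pow_mul, mul_left_comm, ← mul_pow]
  ring

theorem mulVec_dotProduct_self {A : Matrix V V ℝ} (hA : Aᵀ = A) (y : V → ℝ) :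
    (A *ᵥ y) ⬝ᵥ (A *ᵥ y) = y ⬝ᵥ ((A ^ 2) *ᵥ y) := by
  rw [sq, ← Matrix.mulVec_mulVec, Matrix.dotProduct_mulVec y, ← Matrix.mulVec_transpose, hA]

theorem mulVec_dotProduct_pow_le {A : Matrix V V ℝ} (hA : Aᵀ = A) (y : V → ℝ) (k : ℕ) :
    ((A *ᵥ y) ⬝ᵥ (A *ᵥ y)) ^ 2 ^ k ≤
      (y ⬝ᵥ y) ^ (2 ^ k - 1) * (((A ^ 2 ^ k) *ᵥ y) ⬝ᵥ ((A ^ 2 ^ k) *ᵥ y)) := by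
  induction k generalizing A with
  | zero => simp
  | succ k ih =>
    have hy := dotProduct_self_real_nonneg y
    have hA2 : (A ^ 2)ᵀ = A ^ 2 := by rw [Matrix.transpose_pow, hA]
    have h1 : ((A *ᵥ y) ⬝ᵥ (A *ᵥ y)) ^ 2 ≤
        (y ⬝ᵥ y) * (((A ^ 2) *ᵥ y) ⬝ᵥ ((A ^ 2) *ᵥ y)) := by
      rw [mulVec_dotProduct_self hA]
      exact dotProduct_sq_le _ _
    have hk : 1 ≤ 2 ^ k := Nat.one_le_two_pow
    calc ((A *ᵥ y) ⬝ᵥ (A *ᵥ y)) ^ 2 ^ (k + 1)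
        = (((A *ᵥ y) ⬝ᵥ (A *ᵥ y)) ^ 2) ^ 2 ^ k := by rw [← pow_mul, pow_succ']
      _ ≤ ((y ⬝ᵥ y) * (((A ^ 2) *ᵥ y) ⬝ᵥ ((A ^ 2) *ᵥ y))) ^ 2 ^ k := by gcongr
      _ = (y ⬝ᵥ y) ^ 2 ^ k * (((A ^ 2) *ᵥ y) ⬝ᵥ ((A ^ 2) *ᵥ y)) ^ 2 ^ k := mul_pow _ _ _
      _ ≤ (y ⬝ᵥ y) ^ 2 ^ k * ((y ⬝ᵥ y) ^ (2 ^ k - 1) *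
          ((((A ^ 2) ^ 2 ^ k) *ᵥ y) ⬝ᵥ (((A ^ 2) ^ 2 ^ k) *ᵥ y))) := by
          gcongr
          exact ih hA2
      _ = _ := by
          rw [← pow_mul, ← pow_succ', ← mul_assoc, ← pow_add]
          congr 2
          rw [pow_succ]
          omega

theorem mulVec_dotProduct_self_le_trace {A : Matrix V V ℝ} (hA : Aᵀ = A) (y : V → ℝ) :
    (A *ᵥ y) ⬝ᵥ (A *ᵥ y) ≤ (A ^ 2).trace * (y ⬝ᵥ y) := by
  calc (A *ᵥ y) ⬝ᵥ (A *ᵥ y) = ∑ u, (A u ⬝ᵥ y) ^ 2 := by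
        simp [dotProduct, mulVec, sq]
    _ ≤ ∑ u, (A u ⬝ᵥ A u) * (y ⬝ᵥ y) := sum_le_sum fun u _ => dotProduct_sq_le _ _
    _ = (A ^ 2).trace * (y ⬝ᵥ y) := by
        rw [← sum_mul, sq]
        nth_rewrite 4 [← hA]
        rfl

theorem mulVec_dotProduct_self_le {A : Matrix V V ℝ} (hA : Aᵀ = A) {k : ℕ} {c e : ℝ}
    (hc : 0 ≤ c) (he : 0 ≤ e) (hV : (Fintype.card V : ℝ) ≤ e ^ 2 ^ k)
    (htr : (A ^ (2 * 2 ^ k)).trace ≤ Fintype.card V * c ^ 2 ^ k) (y : V → ℝ) :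
    (A *ᵥ y) ⬝ᵥ (A *ᵥ y) ≤ e * c * (y ⬝ᵥ y) := by
  have hy := dotProduct_self_real_nonneg y
  have hk : 2 ^ k ≠ 0 := by positivity
  refine le_of_pow_le_pow_left₀ hk (by positivity) ?_
  have hAk : (A ^ 2 ^ k)ᵀ = A ^ 2 ^ k := by rw [Matrix.transpose_pow, hA]
  have h2 := mulVec_dotProduct_self_le_trace hAk y
  rw [← pow_mul, mul_comm (2 ^ k)] at h2
  calc ((A *ᵥ y) ⬝ᵥ (A *ᵥ y)) ^ 2 ^ k
      ≤ (y ⬝ᵥ y) ^ (2 ^ k - 1) * (((A ^ 2 ^ k) *ᵥ y) ⬝ᵥ ((A ^ 2 ^ k) *ᵥ y)) :=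
        mulVec_dotProduct_pow_le hA y k
    _ ≤ (y ⬝ᵥ y) ^ (2 ^ k - 1) * ((e ^ 2 ^ k * c ^ 2 ^ k) * (y ⬝ᵥ y)) := by
        gcongr
        exact h2.trans (mul_le_mul_of_nonneg_right (htr.trans (by gcongr)) hy)
    _ = (e * c) ^ 2 ^ k * ((y ⬝ᵥ y) ^ (2 ^ k - 1) * (y ⬝ᵥ y)) := by
        rw [mul_pow]
        ring
    _ = (e * c * (y ⬝ᵥ y)) ^ 2 ^ k := by
        rw [pow_sub_one_mul hk, mul_pow (e * c)]

end Matrices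

section Mixing

open Matrix

variable {V : Type*} [Fintype V]

theorem sum_block_sq_le {B : Matrix V V ℝ} {μ : ℝ}
    (hB : ∀ y : V → ℝ, (B *ᵥ y) ⬝ᵥ (B *ᵥ y) ≤ μ * (y ⬝ᵥ y)) (S T : Finset V) :
    (∑ u ∈ S, ∑ v ∈ T, B u v) ^ 2 ≤ μ * #S * #T := by
  classical
  let ind : Finset V → V → ℝ := fun S u => if u ∈ S then 1 else 0
  have hind : ∀ S, ind S ⬝ᵥ ind S = #S := fun S => by simp [ind, dotProduct]
  have hsum : ∑ u ∈ S, ∑ v ∈ T, B u v = ind S ⬝ᵥ (B *ᵥ ind T) := by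
    simp [ind, dotProduct, mulVec]
  rw [hsum]
  calc (ind S ⬝ᵥ (B *ᵥ ind T)) ^ 2
      ≤ (ind S ⬝ᵥ ind S) * ((B *ᵥ ind T) ⬝ᵥ (B *ᵥ ind T)) := dotProduct_sq_le _ _
    _ ≤ #S * (μ * #T) := by
        rw [hind, ← hind T]
        exact mul_le_mul_of_nonneg_left (hB _) (Nat.cast_nonneg _)
    _ = μ * #S * #T := by ring

variable [DecidableEq V] {G : SimpleGraph V} {A B : Matrix V V ℝ} {μ d : ℝ}

theorem exists_adj_of_mixing (hA : ∀ u v, ¬ G.Adj u v → A u v = 0)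
    (hAB : ∀ u v, B u v = A u v - if u ≠ v then d / (Fintype.card V - 1) else 0)
    (hB : ∀ y : V → ℝ, (B *ᵥ y) ⬝ᵥ (B *ᵥ y) ≤ μ * (y ⬝ᵥ y)) (hd : 0 ≤ d)
    {m : ℕ} (hm : 2 ≤ m) (hV : 2 ≤ Fintype.card V) (hμ : 0 ≤ μ)
    (hdm : 4 * μ * (Fintype.card V) ^ 2 < d ^ 2 * m ^ 2)
    (S T : Finset V) (hS : m ≤ #S) (hT : m ≤ #T) : ∃ s ∈ S, ∃ t ∈ T, G.Adj s t := by
  by_contra! hno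
  set n : ℝ := (Fintype.card V : ℝ) with hn
  have hn2 : (2 : ℝ) ≤ n := by rw [hn]; exact_mod_cast hV
  set δ : ℝ := d / (n - 1) with hδ
  have hδ0 : 0 ≤ δ := div_nonneg hd (by linarith)
  have hS' : (m : ℝ) ≤ #S := by exact_mod_cast hS
  have hT' : (m : ℝ) ≤ #T := by exact_mod_cast hT
  have hm' : (2 : ℝ) ≤ m := by exact_mod_cast hm
  have hrow : ∀ u ∈ S, ∑ v ∈ T, B u v ≤ -(δ * (#T / 2)) := by
    intro u hu
    have h1 : ∑ v ∈ T, B u v = -(δ * #{v ∈ T | u ≠ v}) := by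
      calc ∑ v ∈ T, B u v = ∑ v ∈ T, -(if u ≠ v then δ else 0) :=
            sum_congr rfl fun v hv => by rw [hAB, hA u v (hno u hu v hv), zero_sub]
        _ = -(δ * #{v ∈ T | u ≠ v}) := by
            rw [sum_neg_distrib, ← sum_filter, sum_const, nsmul_eq_mul, mul_comm]
    have h2 : (#T : ℝ) - 1 ≤ #{v ∈ T | u ≠ v} := by
      have : #T ≤ #{v ∈ T | u ≠ v} + 1 := by
        rw [filter_ne]
        have := T.pred_card_le_card_erase (a := u)
        omega
      have : (#T : ℝ) ≤ #{v ∈ T | u ≠ v} + 1 := by exact_mod_cast this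
      linarith
    rw [h1]
    have : δ * (#T / 2) ≤ δ * #{v ∈ T | u ≠ v} := mul_le_mul_of_nonneg_left (by linarith) hδ0
    linarith
  have hsum : δ * (#S * #T) / 2 ≤ -∑ u ∈ S, ∑ v ∈ T, B u v := by
    have := sum_le_sum hrow
    rw [sum_const, nsmul_eq_mul] at this
    nlinarith
  have hsq := sum_block_sq_le hB S T
  set s : ℝ := (#S : ℝ)
  set t : ℝ := (#T : ℝ)
  have hst : (m : ℝ) ^ 2 ≤ s * t := by nlinarith
  have hst0 : 0 < s * t := by nlinarith
  have h1 : (δ * (s * t) / 2) ^ 2 ≤ μ * (s * t) := by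
    calc (δ * (s * t) / 2) ^ 2 ≤ (-∑ u ∈ S, ∑ v ∈ T, B u v) ^ 2 := by
          gcongr
      _ ≤ μ * (s * t) := by rw [neg_sq, ← mul_assoc]; exact hsq
  have h2 : δ ^ 2 * (s * t) ≤ 4 * μ := by
    refine le_of_mul_le_mul_right ?_ hst0
    nlinarith
  have h3 : δ ^ 2 * m ^ 2 ≤ 4 * μ := (mul_le_mul_of_nonneg_left hst (sq_nonneg _)).trans h2
  have h4 : d ≤ δ * n := by
    rw [hδ, div_mul_eq_mul_div, le_div_iff₀ (by linarith)]
    nlinarith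
  have h5 : d ^ 2 * m ^ 2 ≤ (δ ^ 2 * m ^ 2) * n ^ 2 := by
    calc d ^ 2 * m ^ 2 ≤ (δ * n) ^ 2 * m ^ 2 := by gcongr
      _ = _ := by ring
  nlinarith [mul_le_mul_of_nonneg_right h3 (sq_nonneg n)]

theorem expansion_of_mixing (hA : ∀ u v, ¬ G.Adj u v → A u v = 0)
    (hrow : ∀ u, ∑ v, A u v = d)
    (hAB : ∀ u v, B u v = A u v - if u ≠ v then d / (Fintype.card V - 1) else 0)
    (hB : ∀ y : V → ℝ, (B *ᵥ y) ⬝ᵥ (B *ᵥ y) ≤ μ * (y ⬝ᵥ y)) (hd : 0 ≤ d)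
    (hV : 2 ≤ Fintype.card V) (hμ : 0 < μ)
    {E : ℕ} (hdE : 20 * E * μ ≤ d ^ 2) (S : Finset V) :
    5 * E * #S ≤ #(nbrs G S) ∨ Fintype.card V ≤ 3 * #(nbrs G S) := by
  by_contra! hcon
  obtain ⟨hlt, hN⟩ := hcon
  have hSpos : 0 < #S := by
    rcases Nat.eq_zero_or_pos #S with h | h
    · rw [h, mul_zero] at hlt
      exact absurd hlt (Nat.not_lt_zero _)
    · exact h
  have hN2 : 2 * #(nbrs G S) + 1 ≤ Fintype.card V := by omega
  replace hlt : (#(nbrs G S) : ℝ) < 5 * E * #S := by exact_mod_cast hlt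
  replace hN2 : 2 * (#(nbrs G S) : ℝ) + 1 ≤ Fintype.card V := by exact_mod_cast hN2
  set n : ℝ := (Fintype.card V : ℝ) with hn
  have hn2 : (2 : ℝ) ≤ n := by rw [hn]; exact_mod_cast hV
  set δ : ℝ := d / (n - 1) with hδ
  have hδ0 : 0 ≤ δ := div_nonneg hd (by linarith)
  have hδN : δ * #(nbrs G S) ≤ d / 2 := by
    rw [hδ, div_mul_eq_mul_div, div_le_iff₀ (by linarith)]
    nlinarith
  have hBrow : ∀ u ∈ S, d / 2 ≤ ∑ v ∈ nbrs G S, B u v := by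
    intro u hu
    have h1 : ∑ v ∈ nbrs G S, A u v = d := by
      rw [← hrow u]
      refine sum_subset (subset_univ _) fun v _ hv => hA u v fun h => hv ?_
      exact mem_nbrs.2 ⟨u, hu, h⟩
    have h2 : ∑ v ∈ nbrs G S, (if u ≠ v then δ else 0) ≤ δ * #(nbrs G S) := by
      calc ∑ v ∈ nbrs G S, (if u ≠ v then δ else 0) ≤ ∑ v ∈ nbrs G S, δ :=
            sum_le_sum fun v _ => by split_ifs <;> simp [hδ0]
        _ = δ * #(nbrs G S) := by rw [sum_const, nsmul_eq_mul, mul_comm]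
    simp only [hAB, sum_sub_distrib, h1]
    linarith
  have hsum : d * #S / 2 ≤ ∑ u ∈ S, ∑ v ∈ nbrs G S, B u v := by
    have := sum_le_sum hBrow
    rw [sum_const, nsmul_eq_mul] at this
    linarith
  have hsq := sum_block_sq_le hB S (nbrs G S)
  have hs : (0 : ℝ) < #S := by exact_mod_cast hSpos
  have h1 : (d * #S / 2) ^ 2 ≤ μ * #S * #(nbrs G S) :=
    (pow_le_pow_left₀ (by positivity) hsum 2).trans hsq
  have h2 : d ^ 2 * #S ≤ 4 * μ * #(nbrs G S) := by
    refine le_of_mul_le_mul_right ?_ hs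
    nlinarith
  have h3 := mul_le_mul_of_nonneg_right hdE hs.le
  have h4 := mul_lt_mul_of_pos_left hlt hμ
  nlinarith

end Mixing

section Colouring

open Matrix

variable {V : Type*} (c : Sym2 V → ℕ)

/-- The graph formed by the edges with a colour in the range of `f`. -/
def colourGraph {κ : Type*} (f : κ → ℕ) : SimpleGraph V where
  Adj u v := u ≠ v ∧ ∃ i, c s(u, v) = f i
  symm := ⟨fun u v h => ⟨h.1.symm, by rw [Sym2.eq_swap]; exact h.2⟩⟩
  loopless := ⟨fun _ h => h.1 rfl⟩

variable [DecidableEq V]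

/-- The adjacency matrix of a colour class. -/
def colourMatrix (a : ℕ) : Matrix V V ℝ := fun u v => if u ≠ v ∧ c s(u, v) = a then 1 else 0

theorem colourMatrix_symm (a : ℕ) (u v : V) :
    colourMatrix c a u v = colourMatrix c a v u := by
  simp only [colourMatrix, Sym2.eq_swap (a := u), ne_comm (a := u)]

variable [Fintype V]

/-- The colours used on the edges of the complete graph. -/
def colours : Finset ℕ := (⊤ : SimpleGraph V).edgeFinset.image c

/-- The adjacency matrix of a colour class, minus the average over all colours. -/
noncomputable def centredMatrix (a : ℕ) : Matrix V V ℝ :=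
  fun u v => colourMatrix c a u v - if u ≠ v then 1 / ((Fintype.card V : ℝ) - 1) else 0

variable {c}

theorem mem_colours {u v : V} (h : u ≠ v) : c s(u, v) ∈ colours c :=
  mem_image_of_mem c (by simpa using h)

theorem colour_injOn (hc : IsProperEdgeColoring c) (u : V) :
    Set.InjOn (fun v => c s(u, v)) (univ.erase u : Finset V) := by
  intro v hv v' hv' h
  simp only [coe_erase, coe_univ, Set.mem_sdiff, Set.mem_univ, Set.mem_singleton_iff,
    true_and] at hv hv'
  by_contra hne
  refine hc s(u, v) s(u, v') ?_ ?_ ?_ ⟨u, by simp, by simp⟩ h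
  · simpa using Ne.symm hv
  · simpa using Ne.symm hv'
  · rwa [ne_eq, Sym2.congr_right]

theorem image_colours (hc : IsProperEdgeColoring c)
    (hcard : #(colours c) ≤ Fintype.card V - 1) (u : V) :
    (univ.erase u).image (fun v => c s(u, v)) = colours c := by
  refine eq_of_subset_of_card_le ?_ ?_
  · intro a ha
    obtain ⟨v, hv, rfl⟩ := mem_image.1 ha
    exact mem_colours (ne_of_mem_erase hv).symm
  · rw [card_image_of_injOn (colour_injOn hc u), card_erase_of_mem (mem_univ u), card_univ]
    exact hcard

theorem card_colours [Nonempty V] (hc : IsProperEdgeColoring c)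
    (hcard : #(colours c) ≤ Fintype.card V - 1) : #(colours c) = Fintype.card V - 1 := by
  rw [← image_colours hc hcard (Classical.arbitrary V), card_image_of_injOn (colour_injOn hc _),
    card_erase_of_mem (mem_univ _), card_univ]

theorem sum_colourMatrix_row (hc : IsProperEdgeColoring c)
    (hcard : #(colours c) ≤ Fintype.card V - 1) {a : ℕ} (ha : a ∈ colours c) (u : V) :
    ∑ v, colourMatrix c a u v = 1 := by
  rw [← image_colours hc hcard u] at ha
  obtain ⟨v, hv, rfl⟩ := mem_image.1 ha
  rw [sum_eq_single v]
  · simp [colourMatrix, (ne_of_mem_erase hv).symm]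
  · intro w _ hwv
    refine if_neg fun h => hwv ?_
    exact colour_injOn hc u (by simpa using h.1.symm) (by simpa using hv) h.2
  · simp

theorem centredMatrix_transpose (a : ℕ) : (centredMatrix c a)ᵀ = centredMatrix c a := by
  ext u v
  simp only [transpose_apply, centredMatrix, colourMatrix_symm c a v u, ne_comm (a := v)]

theorem sum_centredMatrix (hV : 2 ≤ Fintype.card V) (hc : IsProperEdgeColoring c)
    (hcard : #(colours c) ≤ Fintype.card V - 1) :
    ∑ a : colours c, centredMatrix c a = 0 := by
  have : Nonempty V := Fintype.card_pos_iff.1 (by omega)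
  have hn : (2 : ℝ) ≤ Fintype.card V := by exact_mod_cast hV
  ext u v
  rw [Matrix.sum_apply, Matrix.zero_apply, sum_coe_sort (colours c) fun a => centredMatrix c a u v]
  by_cases huv : u = v
  · simp [centredMatrix, colourMatrix, huv]
  · have h1 : ∑ a ∈ colours c, colourMatrix c a u v = 1 := by
      rw [sum_eq_single (c s(u, v))]
      · simp [colourMatrix, huv]
      · intro a _ ha
        simp [colourMatrix, ha.symm]
      · exact fun h => absurd (mem_colours huv) h
    simp only [centredMatrix, sum_sub_distrib, h1, ne_eq, huv, not_false_eq_true, if_true,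
      sum_const, card_colours hc hcard, nsmul_eq_mul]
    rw [Nat.cast_sub (by omega), Nat.cast_one, mul_one_div_cancel (by linarith), sub_self]

theorem sum_abs_centredMatrix_row_le (hV : 2 ≤ Fintype.card V) (hc : IsProperEdgeColoring c)
    (hcard : #(colours c) ≤ Fintype.card V - 1) {a : ℕ} (ha : a ∈ colours c) (u : V) :
    ∑ v, |centredMatrix c a u v| ≤ 2 := by
  have hn : (2 : ℝ) ≤ Fintype.card V := by exact_mod_cast hV
  have h0 : 0 ≤ 1 / ((Fintype.card V : ℝ) - 1) := by
    apply div_nonneg <;> linarith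
  calc ∑ v, |centredMatrix c a u v|
      ≤ ∑ v, (colourMatrix c a u v + if u ≠ v then 1 / ((Fintype.card V : ℝ) - 1) else 0) := by
        refine sum_le_sum fun v _ => (abs_sub _ _).trans (le_of_eq ?_)
        rw [abs_of_nonneg, abs_of_nonneg]
        · split_ifs <;> simp_all
        · unfold colourMatrix
          split_ifs <;> simp
    _ = 1 + ((Fintype.card V : ℝ) - 1) * (1 / ((Fintype.card V : ℝ) - 1)) := by
        rw [sum_add_distrib, sum_colourMatrix_row hc hcard ha, ← sum_filter, filter_ne, sum_const,
          card_erase_of_mem (mem_univ u), nsmul_eq_mul, card_univ, Nat.cast_sub (by omega),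
          Nat.cast_one]
    _ = 2 := by
        rw [mul_one_div_cancel (by linarith)]
        norm_num

/-- Some choice of `d` colours yields a pseudo-random, hence strongly expanding, graph. -/
theorem exists_expanding_colourGraph (hV : 2 ≤ Fintype.card V) (hc : IsProperEdgeColoring c)
    (hcard : #(colours c) ≤ Fintype.card V - 1) {d k m E : ℕ} (hkd : 2 ^ k ≤ d)
    (hVk : (Fintype.card V : ℝ) ≤ Real.exp 1 ^ 2 ^ k) (hm : 2 ≤ m)
    (hE : 640 * E * 2 ^ k ≤ d) (hdm : 128 * 2 ^ k * Fintype.card V ^ 2 ≤ d * m ^ 2) :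
    ∃ f : Fin d → ℕ,
      (∀ S T : Finset V, m ≤ #S → m ≤ #T → ∃ s ∈ S, ∃ t ∈ T, (colourGraph c f).Adj s t) ∧
      ∀ S : Finset V, 5 * E * #S ≤ #(nbrs (colourGraph c f) S) ∨
        Fintype.card V ≤ 3 * #(nbrs (colourGraph c f) S) := by
  have : Nonempty V := Fintype.card_pos_iff.1 (by omega)
  have : Nonempty (colours c) := by
    rw [nonempty_coe_sort, ← card_pos, card_colours hc hcard]
    omega
  obtain ⟨f, hf⟩ := exists_trace_pow_le hkd (X := fun a : colours c => centredMatrix c a)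
    (sum_centredMatrix hV hc hcard) zero_le_two
    (fun a u => sum_abs_centredMatrix_row_le hV hc hcard a.2 u)
  set B : Matrix V V ℝ := ∑ i, centredMatrix c (f i) with hBdef
  have hBt : Bᵀ = B := by simp [hBdef, transpose_sum, centredMatrix_transpose]
  have hB := mulVec_dotProduct_self_le hBt (by positivity) (Real.exp_pos 1).le hVk hf
  set μ : ℝ := Real.exp 1 * (2 ^ 2 * Real.exp 1 * d * (2 ^ k : ℕ)) with hμ
  have hd : 0 < d := lt_of_lt_of_le (by positivity) hkd
  have hμ0 : 0 < μ := by positivity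
  have hμle : μ < 32 * d * 2 ^ k := by
    have he := Real.exp_one_lt_d9
    have he2 : Real.exp 1 * Real.exp 1 < 8 := by nlinarith [Real.exp_pos 1]
    have hpos : (0 : ℝ) < 4 * (d * 2 ^ k) := by positivity
    have := mul_lt_mul_of_pos_right he2 hpos
    rw [hμ]
    push_cast
    nlinarith
  let A : Matrix V V ℝ := fun u v => ∑ i, colourMatrix c (f i) u v
  have hA : ∀ u v, ¬ (colourGraph c fun i => (f i : ℕ)).Adj u v → A u v = 0 := by
    intro u v huv
    refine sum_eq_zero fun i _ => if_neg fun h => huv ⟨h.1, i, h.2⟩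
  have hrow : ∀ u, ∑ v, A u v = d := by
    intro u
    change ∑ v, ∑ i, colourMatrix c (f i) u v = d
    rw [sum_comm, sum_congr rfl fun i _ => sum_colourMatrix_row hc hcard (f i).2 u]
    simp
  have hAB : ∀ u v, B u v = A u v - if u ≠ v then (d : ℝ) / (Fintype.card V - 1) else 0 := by
    intro u v
    simp only [hBdef, Matrix.sum_apply, centredMatrix, sum_sub_distrib, A, sum_const, card_univ,
      Fintype.card_fin, nsmul_eq_mul, mul_ite, mul_one_div, mul_zero]
  refine ⟨fun i => f i, ?_, ?_⟩
  · refine exists_adj_of_mixing hA hAB hB (Nat.cast_nonneg d) hm hV hμ0.le ?_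
    have hdm' : 128 * (2 : ℝ) ^ k * (Fintype.card V : ℝ) ^ 2 ≤ d * (m : ℝ) ^ 2 := by
      exact_mod_cast hdm
    have hn : (0 : ℝ) < (Fintype.card V : ℝ) ^ 2 := by positivity
    have hd' : (0 : ℝ) < d := by exact_mod_cast hd
    calc 4 * μ * (Fintype.card V : ℝ) ^ 2 < 4 * (32 * d * 2 ^ k) * (Fintype.card V : ℝ) ^ 2 := by
          gcongr
      _ = d * (128 * 2 ^ k * (Fintype.card V : ℝ) ^ 2) := by ring
      _ ≤ d * (d * m ^ 2) := by gcongr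
      _ = (d : ℝ) ^ 2 * m ^ 2 := by ring
  · refine expansion_of_mixing hA hrow hAB hB (Nat.cast_nonneg d) hV hμ0 ?_
    have hE' : 640 * (E : ℝ) * 2 ^ k ≤ d := by exact_mod_cast hE
    calc 20 * E * μ ≤ 20 * E * (32 * d * 2 ^ k) := by gcongr
      _ = d * (640 * E * 2 ^ k) := by ring
      _ ≤ d * d := by gcongr
      _ = (d : ℝ) ^ 2 := by ring

end Colouring

theorem exists_parameters : ∃ N : ℕ, ∀ n : ℕ, N ≤ n → 3 ≤ n ∧ ∃ d k m E T : ℕ,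
    2 ^ k ≤ d ∧ (n : ℝ) ≤ Real.exp 1 ^ 2 ^ k ∧ 2 ≤ m ∧ 640 * E * 2 ^ k ≤ d ∧
      128 * 2 ^ k * n ^ 2 ≤ d * m ^ 2 ∧ 1 ≤ T ∧ n ≤ E ^ T ∧ 7201 * m * T ≤ n ∧
      (d : ℝ) ≤ Real.log n ^ 3 := by
  have hlog : Filter.Tendsto (fun n : ℕ => Real.log n) Filter.atTop Filter.atTop :=
    Real.tendsto_log_atTop.comp tendsto_natCast_atTop_atTop
  obtain ⟨E, hE⟩ := (hlog.eventually_ge_atTop 400000).exists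
  obtain ⟨N, hN⟩ := Filter.eventually_atTop.1
    (hlog.eventually_ge_atTop (2560 * E + 2 + Real.log E))
  refine ⟨max N 3, fun n hn => ⟨(le_max_right _ _).trans hn, ?_⟩⟩
  replace hN := hN n ((le_max_left _ _).trans hn)
  have hn3 : 3 ≤ n := (le_max_right _ _).trans hn
  have hn0 : (0 : ℝ) < n := by positivity
  have hE0 : (0 : ℝ) < E := by
    rcases E.eq_zero_or_pos with h | h
    · norm_num [h] at hE
    · exact_mod_cast h
  have hLn : Real.log n ≤ n := Real.log_le_self hn0.le
  have hexpL : Real.exp (Real.log n) = n := Real.exp_log hn0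
  have hexpE : Real.exp (Real.log E) = E := Real.exp_log hE0
  set L : ℝ := Real.log n
  set l : ℝ := Real.log E
  have hL : 2 ≤ L := by linarith
  have hL0 : 0 < L := by linarith
  have hl0 : 0 < l := by linarith
  obtain ⟨k, hk₁, hk₂⟩ := exists_nat_pow_near (by linarith : (1 : ℝ) ≤ L) one_lt_two
  replace hk₁ : (2 : ℝ) ^ (k + 1) ≤ 2 * L := by rw [pow_succ]; linarith
  have hL2 : L ≤ L ^ 2 := by nlinarith
  have hL3 : L ^ 3 / 2 ≤ ⌊L ^ 3⌋₊ := by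
    have := Nat.lt_floor_add_one (L ^ 3)
    nlinarith
  have hL1 : 4 * L ≤ L ^ 3 := by
    have : 4 ≤ L ^ 2 := by nlinarith
    nlinarith
  have hm₁ : 23 * n / L ≤ ⌈23 * n / L⌉₊ := Nat.le_ceil _
  have hnL : 1 ≤ n / L := (one_le_div hL0).2 hLn
  have hm₂ : (⌈23 * n / L⌉₊ : ℝ) ≤ 24 * (n / L) := by
    have := (Nat.ceil_lt_add_one (by positivity : 0 ≤ 23 * n / L)).le
    rw [mul_div_assoc] at *
    linarith
  have hT₁ : L / l ≤ ⌈L / l⌉₊ := Nat.le_ceil _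
  have hLl : 1 ≤ L / l := (one_le_div hl0).2 (by linarith)
  have hT₂ : (⌈L / l⌉₊ : ℝ) ≤ 2 * (L / l) := by
    have := (Nat.ceil_lt_add_one (by positivity : 0 ≤ L / l)).le
    linarith
  refine ⟨⌊L ^ 3⌋₊, k + 1, ⌈23 * n / L⌉₊, E, ⌈L / l⌉₊, ?_, ?_, ?_, ?_, ?_, ?_, ?_, ?_,
    Nat.floor_le (by positivity)⟩
  · have : (2 : ℝ) ^ (k + 1) ≤ ⌊L ^ 3⌋₊ := by linarith
    exact_mod_cast this
  · rw [← Real.exp_nat_mul, mul_one]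
    calc (n : ℝ) = Real.exp L := hexpL.symm
      _ ≤ Real.exp ((2 ^ (k + 1) : ℕ) : ℝ) := Real.exp_le_exp.2 (by push_cast; exact hk₂.le)
  · have : (2 : ℝ) ≤ ⌈23 * n / L⌉₊ := by
      rw [mul_div_assoc] at *
      linarith
    exact_mod_cast this
  · have : 640 * (E : ℝ) * 2 ^ (k + 1) ≤ ⌊L ^ 3⌋₊ := by
      refine le_trans ?_ hL3
      calc 640 * (E : ℝ) * 2 ^ (k + 1) ≤ 640 * E * (2 * L) := by gcongr
        _ = 2560 * E * L / 2 := by ring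
        _ ≤ L ^ 2 * L / 2 := by gcongr; linarith
        _ = L ^ 3 / 2 := by ring
    exact_mod_cast this
  · have : 128 * (2 : ℝ) ^ (k + 1) * n ^ 2 ≤ ⌊L ^ 3⌋₊ * ⌈23 * n / L⌉₊ ^ 2 := by
      calc 128 * (2 : ℝ) ^ (k + 1) * n ^ 2 ≤ 128 * (2 * L) * n ^ 2 := by gcongr
        _ ≤ (529 / 2) * L * n ^ 2 := by gcongr ?_ * _; linarith
        _ = L ^ 3 / 2 * (23 * n / L) ^ 2 := by
            field_simp
            ring
        _ ≤ _ := by gcongr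
    exact_mod_cast this
  · have : (1 : ℝ) ≤ ⌈L / l⌉₊ := hLl.trans hT₁
    exact_mod_cast this
  · have : (n : ℝ) ≤ (E : ℝ) ^ ⌈L / l⌉₊ := by
      rw [← hexpL, ← hexpE, ← Real.exp_nat_mul]
      exact Real.exp_le_exp.2 ((div_le_iff₀ hl0).1 hT₁)
    exact_mod_cast this
  · have : 7201 * (⌈23 * n / L⌉₊ : ℝ) * ⌈L / l⌉₊ ≤ n := by
      calc 7201 * (⌈23 * n / L⌉₊ : ℝ) * ⌈L / l⌉₊
          ≤ 7201 * (24 * (n / L)) * (2 * (L / l)) := by gcongr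
        _ = 345648 * n / l := by
            field_simp
            ring
        _ ≤ n := by
            rw [div_le_iff₀ hl0]
            nlinarith
    exact_mod_cast this

theorem card_image_edges_le {V : Type*} [DecidableEq V] {c : Sym2 V → ℕ} {d : ℕ} {f : Fin d → ℕ}
    {v : V} (p : (colourGraph c f).Walk v v) : #(p.edges.map c).toFinset ≤ d := by
  have hsub : (p.edges.map c).toFinset ⊆ univ.image f := by
    intro a ha
    obtain ⟨e, he, rfl⟩ := List.mem_map.1 (List.mem_toFinset.1 ha)
    have hedge := p.edges_subset_edgeSet he
    induction e with
    | h x y =>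
      obtain ⟨i, hi⟩ := ((SimpleGraph.mem_edgeSet _).1 hedge).2
      exact hi ▸ mem_image_of_mem f (mem_univ i)
  calc #(p.edges.map c).toFinset ≤ #(univ.image f) := card_le_card hsub
    _ ≤ #(univ : Finset (Fin d)) := card_image_le
    _ = d := by rw [card_univ, Fintype.card_fin]

end HamiltonFewColours

/-- For sufficiently large even `n`, every proper edge colouring of `K_n` with at most
`n - 1` colours has a Hamilton cycle with at most `(log n)^3` colours. -/
theorem statement1 :
    ∃ N : ℕ, ∀ n : ℕ, N ≤ n → Even n →
      ∀ c : Sym2 (Fin n) → ℕ,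
        IsProperEdgeColoring c →
        ((((⊤ : SimpleGraph (Fin n)).edgeFinset).image c).card ≤ n - 1) →
        ∃ (v : Fin n) (p : (⊤ : SimpleGraph (Fin n)).Walk v v),
          p.IsHamiltonianCycle ∧
          (((p.edges.map c).toFinset.card : ℝ) ≤ Real.log n ^ 3) := by
  obtain ⟨N, hN⟩ := HamiltonFewColours.exists_parameters
  refine ⟨N, fun n hn _ c hc hcard => ?_⟩
  obtain ⟨hn3, d, k, m, E, T, hkd, hnk, hm, hE, hdm, hT, hnT, hmT, hd⟩ := hN n hn
  have hcardV : Fintype.card (Fin n) = n := Fintype.card_fin n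
  obtain ⟨f, hjoin, hexp⟩ := HamiltonFewColours.exists_expanding_colourGraph (V := Fin n)
    (by omega) hc (by rw [hcardV]; unfold HamiltonFewColours.colours; convert hcard) hkd
    (by rwa [hcardV]) hm hE (by rwa [hcardV])
  obtain ⟨l, hl, hmem, hchain, s, t, hs, ht, hts⟩ :=
    HamiltonFewColours.exists_hamiltonian_list (by omega) hT hjoin hexp (by rwa [hcardV])
      (by rwa [hcardV])
  obtain ⟨v, p, hp⟩ :=
    HamiltonFewColours.exists_isHamiltonianCycle_of_list (by omega) hl hmem hchain hs ht hts
  refine ⟨v, p.mapLe le_top, hp.map Function.bijective_id, ?_⟩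
  rw [SimpleGraph.Walk.edges_mapLe_eq_edges]
  exact (Nat.cast_le.2 (HamiltonFewColours.card_image_edges_le p)).trans hd
end
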